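/- Let n ≥ 1 and s ∈ (0,1) with n > 2s, let K > 0, b ≥ 0 and p > 0. Let v ∈ C^{1,1}_{loc}(ℝⁿ_+) ∩ L_{2s} be nonnegative and bounded, with v = 0 on ℝⁿ \ ℝⁿ_+, satisfying (-Δ)^s v(x) = K v(x)^p + b classically for all x ∈ ℝⁿ_+ = {x ∈ ℝⁿ : x_n > 0}. Then v(x) ≥ ∫_{ℝⁿ_+} G_∞(x,y) (K v(y)^p + b) dy for every x ∈ ℝⁿ_+, where G_∞(x,y) = C_{n,s} |x−y|^{2s−n} ∫₀^{4 x_n y_n / |x−y|²} t^{s−1} (1+t)^{−n/2} dt is the Green function of (-Δ)^s on the half-space; consequently b = 0. -/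

import Mathlib

open MeasureTheory Metric Set Filter
open scoped Topology NNReal ENNReal RealInnerProductSpace

noncomputable section

/-- `n`-dimensional Euclidean space `ℝⁿ`. -/
abbrev Euc (n : ℕ) := EuclideanSpace ℝ (Fin n)

/-- The standard normalization constant `C_{n,s}` of the fractional Laplacian,
`C_{n,s} = 4^s Γ(n/2+s) / (π^{n/2} |Γ(-s)|) = s·4^s·Γ(n/2+s) / (π^{n/2} Γ(1-s))`. -/
def fracC (n : ℕ) (s : ℝ) : ℝ :=
  s * 4 ^ s * Real.Gamma ((n : ℝ) / 2 + s) /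
    (Real.pi ^ ((n : ℝ) / 2) * Real.Gamma (1 - s))

/-- `(-Δ)^s u (x) = v` in the classical (Cauchy principal value) sense: the truncated
integrals `C_{n,s} ∫_{|x-y| ≥ ε} (u(x) - u(y))/|x-y|^{n+2s} dy` tend to `v` as `ε → 0⁺`. -/
def HasFracLapAt (n : ℕ) (s : ℝ) (u : Euc n → ℝ) (x : Euc n) (v : ℝ) : Prop :=
  Tendsto (fun ε : ℝ =>
      fracC n s *
        ∫ y in {y : Euc n | ε ≤ dist x y}, (u x - u y) / dist x y ^ ((n : ℝ) + 2 * s))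
    (𝓝[>] (0 : ℝ)) (𝓝 v)

/-- The tail space `L_{2s}`: locally integrable functions with
`∫_{ℝⁿ} |u(y)|/(1+|y|^{n+2s}) dy < ∞`. -/
def MemL2s (n : ℕ) (s : ℝ) (u : Euc n → ℝ) : Prop :=
  LocallyIntegrable u volume ∧
    Integrable (fun y : Euc n => |u y| / (1 + ‖y‖ ^ ((n : ℝ) + 2 * s))) volume

/-- The `L_{2s}` norm `‖u‖_{L_{2s}} = ∫_{ℝⁿ} |u(y)|/(1+|y|^{n+2s}) dy`. -/
def l2sNorm (n : ℕ) (s : ℝ) (u : Euc n → ℝ) : ℝ :=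
  ∫ y : Euc n, |u y| / (1 + ‖y‖ ^ ((n : ℝ) + 2 * s))

/-- `u ∈ C^{1,1}_{loc}(Ω)`: near every point of `Ω`, `u` is `C^1` with a Lipschitz
continuous derivative. -/
def C11LocOn (n : ℕ) (u : Euc n → ℝ) (Ω : Set (Euc n)) : Prop :=
  ∀ x ∈ Ω, ∃ ε > 0, ball x ε ⊆ Ω ∧ ContDiffOn ℝ 1 u (ball x ε) ∧
    ∃ L : ℝ≥0, LipschitzOnWith L (fun y => fderiv ℝ u y) (ball x ε)

/-- The `C^γ(K)` norm (`0 < γ < 1`) of `u` is bounded by `A`: both the sup norm and the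
`γ`-Hölder seminorm of `u` on `K` are at most `A`. -/
def HolderBoundOn (n : ℕ) (γ : ℝ) (u : Euc n → ℝ) (K : Set (Euc n)) (A : ℝ) : Prop :=
  (∀ x ∈ K, |u x| ≤ A) ∧ ∀ x ∈ K, ∀ y ∈ K, |u x - u y| ≤ A * dist x y ^ γ

/-- Two-sided (interior and exterior) tangent ball condition of radius `ρ` at a boundary
point `z` of `Ω`.  A uniform two-sided ball condition is the standard geometric
characterization of a (locally) `C^{1,1}` boundary: the radius `ρ` is controlled by the
local `C^{1,1}` norm of `∂Ω` and vice versa. -/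
def TwoSidedBallAt (n : ℕ) (Ω : Set (Euc n)) (ρ : ℝ) (z : Euc n) : Prop :=
  ∃ ν : Euc n, ‖ν‖ = 1 ∧ ball (z + ρ • ν) ρ ⊆ Ω ∧ ball (z - ρ • ν) ρ ⊆ Ωᶜ

/-- The Green function of `(-Δ)^s` on the half-space `ℝⁿ_+` (with `n = m+1`), with
normalization constant `Cns`:
`G_∞(x,y) = Cns · |x-y|^{2s-n} ∫₀^{4xₙyₙ/|x-y|²} t^{s-1} (1+t)^{-n/2} dt`. -/
def greenHalf (m : ℕ) (s Cns : ℝ) (x y : Euc (m + 1)) : ℝ :=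
  Cns * dist x y ^ (2 * s - ((m : ℝ) + 1)) *
    ∫ t in Ioo (0 : ℝ) (4 * x (Fin.last m) * y (Fin.last m) / dist x y ^ 2),
      t ^ (s - 1) * (1 + t) ^ (-((m : ℝ) + 1) / 2)

/-- The normalization constant of the half-space Green function,
`κ(n,s) = Γ(n/2) / (4^s π^{n/2} Γ(s)²)`. -/
def greenC (n : ℕ) (s : ℝ) : ℝ :=
  Real.Gamma ((n : ℝ) / 2) / (4 ^ s * Real.pi ^ ((n : ℝ) / 2) * Real.Gamma s ^ 2)

/-- Cauchy–Schlömilch substitution `u ↦ u - c / u`. -/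
lemma integral_cauchy_schlomilch {c : ℝ} (hc : 0 < c) :
    ∫ u in Ioi (0 : ℝ), Real.exp (-(u - c / u) ^ 2) = √Real.pi / 2 := by
  set E : ℝ → ℝ := fun u => Real.exp (-(u - c / u) ^ 2)
  have hder : ∀ u ∈ Ioi (0 : ℝ), HasDerivWithinAt (fun u => u - c / u) (1 + c / u ^ 2) (Ioi 0) u := by
    intro u hu
    have hu' : u ≠ 0 := ne_of_gt hu
    have := ((hasDerivAt_id u).sub ((hasDerivAt_inv hu').const_mul c)).hasDerivWithinAt (s := Ioi 0)
    convert! this using 1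
    field_simp
    ring
  have hinj : InjOn (fun u : ℝ => u - c / u) (Ioi 0) := by
    refine (StrictMonoOn.injOn ?_)
    intro a ha b hb hab
    have : c / b < c / a := div_lt_div_of_pos_left hc ha hab
    simp only
    linarith
  have himg : (fun u : ℝ => u - c / u) '' Ioi 0 = univ := by
    refine eq_univ_of_forall fun t => ?_
    have h1 : |t| < √(t ^ 2 + 4 * c) := by
      rw [← Real.sqrt_sq_eq_abs]
      exact Real.sqrt_lt_sqrt (sq_nonneg t) (by linarith)
    have h2 : 0 < t + √(t ^ 2 + 4 * c) := by linarith [neg_abs_le t]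
    refine ⟨(t + √(t ^ 2 + 4 * c)) / 2, by simpa using h2, ?_⟩
    have h3 : √(t ^ 2 + 4 * c) ^ 2 = t ^ 2 + 4 * c := Real.sq_sqrt (by positivity)
    have h4 := h2.ne'
    simp only
    field_simp
    linear_combination h3
  have hpos : ∀ u : ℝ, |1 + c / u ^ 2| = 1 + c / u ^ 2 := fun u => abs_of_pos (by positivity)
  have htot := integral_image_eq_integral_abs_deriv_smul measurableSet_Ioi hder hinj
    (fun t => Real.exp (-t ^ 2))
  have hint := (integrableOn_image_iff_integrableOn_abs_deriv_smul measurableSet_Ioi hder hinj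
    (fun t => Real.exp (-t ^ 2))).1 (by
      rw [himg, integrableOn_univ]
      simpa using integrable_exp_neg_mul_sq (b := 1) one_pos)
  rw [himg, setIntegral_univ] at htot
  simp only [hpos, smul_eq_mul] at htot hint
  have hg : ∫ t : ℝ, Real.exp (-t ^ 2) = √Real.pi := by
    simpa using integral_gaussian 1
  rw [hg] at htot
  have hEm : Measurable E := by fun_prop
  have hE1 : IntegrableOn E (Ioi 0) := by
    refine hint.mono' hEm.aestronglyMeasurable (ae_of_all _ fun u => ?_)
    rw [Real.norm_of_nonneg (Real.exp_pos _).le]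
    have : 0 ≤ c / u ^ 2 := by positivity
    nlinarith [Real.exp_pos (-(u - c / u) ^ 2)]
  have hE2 : IntegrableOn (fun u => c / u ^ 2 * E u) (Ioi 0) := by
    have := hint.sub hE1
    refine this.congr (ae_of_all _ fun u => ?_)
    simp only [E, Pi.sub_apply]
    ring
  -- the involution `u ↦ c / u` exchanges the two halves
  have hder2 : ∀ u ∈ Ioi (0 : ℝ), HasDerivWithinAt (fun u => c / u) (-(c / u ^ 2)) (Ioi 0) u := by
    intro u hu
    have hu' : u ≠ 0 := ne_of_gt hu
    have := ((hasDerivAt_inv hu').const_mul c).hasDerivWithinAt (s := Ioi 0)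
    convert! this using 1
    field_simp
  have hinj2 : InjOn (fun u : ℝ => c / u) (Ioi 0) := by
    intro a ha b hb hab
    have ha' : a ≠ 0 := ne_of_gt ha
    have hb' : b ≠ 0 := ne_of_gt hb
    simp only at hab
    field_simp at hab
    exact hab.symm
  have himg2 : (fun u : ℝ => c / u) '' Ioi 0 = Ioi 0 := by
    ext t
    constructor
    · rintro ⟨u, hu, rfl⟩
      exact div_pos hc hu
    · intro ht
      refine ⟨c / t, div_pos hc ht, ?_⟩
      have : t ≠ 0 := ne_of_gt ht
      simp only
      field_simp
  have hsw := integral_image_eq_integral_abs_deriv_smul measurableSet_Ioi hder2 hinj2 E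
  rw [himg2] at hsw
  have hsw' : ∫ u in Ioi (0 : ℝ), E u = ∫ u in Ioi (0 : ℝ), c / u ^ 2 * E u := by
    rw [hsw]
    refine setIntegral_congr_fun measurableSet_Ioi fun u hu => ?_
    have hu' : u ≠ 0 := ne_of_gt hu
    simp only [abs_neg, E, smul_eq_mul]
    rw [abs_of_nonneg (by positivity), div_div_cancel₀ hc.ne']
    congr 3
    ring
  have hsum : ∫ u in Ioi (0 : ℝ), (1 + c / u ^ 2) * E u =
      (∫ u in Ioi (0 : ℝ), E u) + ∫ u in Ioi (0 : ℝ), c / u ^ 2 * E u := by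
    rw [← integral_add hE1 hE2]
    congr 1
    ext u
    ring
  change ∫ u in Ioi (0 : ℝ), E u = _
  change _ = ∫ u in Ioi (0 : ℝ), (1 + c / u ^ 2) * E u at htot
  linarith

lemma integrableOn_rpow_mul_exp_neg_Ioi {q : ℝ} (hq : 0 < q) {r : ℝ} (hr : 0 < r) :
    IntegrableOn (fun t : ℝ => t ^ (q - 1) * Real.exp (-(r * t))) (Ioi 0) := by
  have := integrableOn_rpow_mul_exp_neg_mul_rpow (s := q - 1) (p := 1) (b := r) (by linarith)
    one_pos hr
  simpa using this

/-- Laplace transform in `1 / r` of the `Gamma (1/2)` density. -/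
lemma integral_gamma_half_exp {ρ : ℝ} (hρ : 0 ≤ ρ) :
    ∫ r in Ioi (0 : ℝ), r ^ (-(1 / 2) : ℝ) * Real.exp (-r - ρ ^ 2 / (4 * r)) =
      √Real.pi * Real.exp (-ρ) := by
  rcases hρ.eq_or_lt with rfl | hρ
  · have := Real.integral_rpow_mul_exp_neg_mul_Ioi (a := 1 / 2) (r := 1) (by norm_num) one_pos
    rw [Real.Gamma_one_half_eq] at this
    norm_num at this ⊢
    exact this
  have h := integral_cauchy_schlomilch (c := ρ / 2) (by positivity)
  have h2 := integral_comp_rpow_Ioi_of_pos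
    (g := fun r : ℝ => r ^ (-(1 / 2) : ℝ) * Real.exp (-r - ρ ^ 2 / (4 * r))) (p := 2) two_pos
  rw [← h2]
  calc _ = ∫ u in Ioi (0 : ℝ), 2 * Real.exp (-ρ) * Real.exp (-(u - ρ / 2 / u) ^ 2) := by
        refine setIntegral_congr_fun measurableSet_Ioi fun u hu => ?_
        have hu0 : (0 : ℝ) < u := hu
        have h3 : (u ^ (2 : ℝ)) ^ (-(1 / 2) : ℝ) = u⁻¹ := by
          rw [← Real.rpow_mul hu0.le]
          norm_num
          exact Real.rpow_neg_one u
        simp only [smul_eq_mul]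
        rw [h3, mul_assoc 2 (Real.exp _), ← Real.exp_add]
        norm_num
        have : -u ^ 2 - ρ ^ 2 / (4 * u ^ 2) = -ρ + -(u - ρ / 2 / u) ^ 2 := by
          field_simp
          ring
        rw [this]
        field_simp
    _ = _ := by
        rw [integral_const_mul, h]
        ring

lemma norm_one_sub_cexp_neg_le {z : ℂ} (hz : 0 ≤ z.re) : ‖1 - Complex.exp (-z)‖ ≤ ‖z‖ := by
  have hconv : Convex ℝ {w : ℂ | 0 ≤ w.re} := convex_halfSpace_re_ge 0
  have h := hconv.norm_image_sub_le_of_norm_hasDerivWithin_le (𝕜 := ℂ)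
    (f := fun w => Complex.exp (-w)) (f' := fun w => -Complex.exp (-w)) (C := 1) (x := z) (y := 0)
    (fun w _ => by
      simpa using (hasDerivAt_neg w).cexp.hasDerivWithinAt)
    (fun w hw => by
      rw [norm_neg, Complex.norm_exp]
      simpa using hw) hz (by simp)
  simpa using h

lemma norm_cexp_neg_le_one {z : ℂ} (hz : 0 ≤ z.re) : ‖Complex.exp (-z)‖ ≤ 1 := by
  rw [Complex.norm_exp]
  simpa using hz

/-- The Gamma integral `∫ t ^ (q - 1) * exp (-(λ t))` for complex `λ` of positive real part. -/
lemma integral_rpow_mul_cexp_neg_mul_Ioi {q : ℝ} (hq : 0 < q) {l : ℂ} (hl : 0 < l.re) :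
    ∫ t in Ioi (0 : ℝ), ((t ^ (q - 1) : ℝ) : ℂ) * Complex.exp (-(t * l)) =
      Real.Gamma q * l ^ (-q : ℂ) := by
  set F : ℂ → ℂ := fun l => ∫ t in Ioi (0 : ℝ), ((t ^ (q - 1) : ℝ) : ℂ) * Complex.exp (-(t * l))
  have hmeas : ∀ (p : ℝ) (z : ℂ), AEStronglyMeasurable
      (fun t : ℝ => ((t ^ p : ℝ) : ℂ) * Complex.exp (-(t * z))) (volume.restrict (Ioi 0)) := by
    intro p z
    exact Measurable.aestronglyMeasurable (by fun_prop)
  have hnorm : ∀ (p : ℝ) (z : ℂ) (t : ℝ), 0 < t → ‖((t ^ p : ℝ) : ℂ) * Complex.exp (-(t * z))‖ =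
      t ^ p * Real.exp (-(z.re * t)) := by
    intro p z t ht
    rw [norm_mul, Complex.norm_real, Real.norm_of_nonneg (Real.rpow_nonneg ht.le _),
      Complex.norm_exp]
    simp [mul_comm]
  have hintg : ∀ (p : ℝ), 0 < p → ∀ z : ℂ, 0 < z.re → Integrable
      (fun t : ℝ => ((t ^ (p - 1) : ℝ) : ℂ) * Complex.exp (-(t * z)))
      (volume.restrict (Ioi 0)) := by
    intro p hp z hz
    refine (integrableOn_rpow_mul_exp_neg_Ioi hp hz).mono' (hmeas _ _) ?_
    filter_upwards [ae_restrict_mem measurableSet_Ioi] with t ht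
    exact (hnorm _ z t ht).le
  have hdiff : DifferentiableOn ℂ F {z | 0 < z.re} := by
    intro z hz
    have hz' : 0 < z.re := hz
    have key := hasDerivAt_integral_of_dominated_loc_of_deriv_le (𝕜 := ℂ)
      (μ := volume.restrict (Ioi (0 : ℝ)))
      (F := fun l (t : ℝ) => ((t ^ (q - 1) : ℝ) : ℂ) * Complex.exp (-(t * l)))
      (F' := fun l (t : ℝ) => ((t ^ (q - 1) : ℝ) : ℂ) * (Complex.exp (-(t * l)) * (-t)))
      (bound := fun t : ℝ => t ^ (q + 1 - 1) * Real.exp (-(z.re / 2 * t)))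
      (x₀ := z) (s := {w | z.re / 2 < w.re})
      ((isOpen_lt continuous_const Complex.continuous_re).mem_nhds (by
        simp only [mem_ofPred_eq]; linarith))
      (Eventually.of_forall fun w => hmeas _ _) (hintg q hq z hz')
      (Measurable.aestronglyMeasurable (by fun_prop))
      (by
        filter_upwards [ae_restrict_mem measurableSet_Ioi] with t ht w hw
        have ht' : (0 : ℝ) < t := ht
        rw [← mul_assoc, norm_mul, hnorm _ w t ht, norm_neg, Complex.norm_real,
          Real.norm_of_nonneg ht'.le]
        have : t ^ (q + 1 - 1) = t ^ (q - 1) * t := by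
          rw [← Real.rpow_add_one ht'.ne']
          congr 1
          ring
        rw [this, mul_right_comm]
        have hw' : z.re / 2 < w.re := hw
        gcongr)
      (integrableOn_rpow_mul_exp_neg_Ioi (by linarith) (by linarith))
      (by
        filter_upwards with t w _
        refine HasDerivAt.const_mul _ ?_
        have h1 : HasDerivAt (fun l : ℂ => -(t * l)) (-(t : ℂ)) w := by
          simpa using ((hasDerivAt_id w).const_mul (t : ℂ)).fun_neg
        exact (Complex.hasDerivAt_exp _).comp w h1)
    exact key.2.differentiableAt.differentiableWithinAt
  have hopen : IsOpen {z : ℂ | 0 < z.re} := isOpen_lt continuous_const Complex.continuous_re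
  have hFa := hdiff.analyticOnNhd hopen
  have hGd : DifferentiableOn ℂ (fun l : ℂ => (Real.Gamma q : ℂ) * l ^ (-q : ℂ)) {z | 0 < z.re} := by
    intro z hz
    refine DifferentiableAt.differentiableWithinAt ?_
    exact (differentiableAt_id.cpow_const (Or.inl hz)).const_mul _
  have hGa := hGd.analyticOnNhd hopen
  have hpre : IsPreconnected {z : ℂ | 0 < z.re} := (convex_halfSpace_re_gt 0).isPreconnected
  refine hFa.eqOn_of_preconnected_of_frequently_eq hGa hpre (z₀ := 1) (by simp) ?_ hl
  have htend : Tendsto (fun r : ℝ => (r : ℂ)) (𝓝[≠] (1 : ℝ)) (𝓝[≠] (1 : ℂ)) := by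
    refine tendsto_nhdsWithin_iff.2 ⟨?_, ?_⟩
    · exact (Complex.continuous_ofReal.tendsto' 1 1 (by simp)).mono_left nhdsWithin_le_nhds
    · filter_upwards [self_mem_nhdsWithin] with r hr
      simpa using hr
  refine htend.frequently (Eventually.frequently ?_)
  have : ∀ᶠ r : ℝ in 𝓝[≠] 1, 0 < r := (lt_mem_nhds one_pos).filter_mono nhdsWithin_le_nhds
  filter_upwards [this] with r hr
  have h := Real.integral_rpow_mul_exp_neg_mul_Ioi hq hr
  have h2 : F (r : ℂ) = ((∫ t in Ioi (0 : ℝ), t ^ (q - 1) * Real.exp (-(r * t)) : ℝ) : ℂ) := by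
    refine Eq.trans ?_ integral_complex_ofReal
    refine integral_congr_ae (ae_of_all _ fun t => ?_)
    simp only
    push_cast
    rw [mul_comm (t : ℂ) (r : ℂ)]
  rw [h2, h]
  rw [one_div, Real.inv_rpow hr.le, ← Real.rpow_neg hr.le]
  push_cast
  rw [Complex.ofReal_cpow hr.le, mul_comm]
  push_cast
  rfl

/-- The majorant `a ^ (-1 - s) * min 1 a` in the Marchaud integral. -/
lemma integrableOn_marchaud_majorant {s : ℝ} (hs0 : 0 < s) (hs1 : s < 1) :
    IntegrableOn (fun a : ℝ => a ^ (-1 - s) * min 1 a) (Ioi 0) := by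
  rw [← Ioc_union_Ioi_eq_Ioi zero_le_one]
  refine IntegrableOn.union ?_ ?_
  · have h1 : IntegrableOn (fun a : ℝ => a ^ (-s)) (Ioc 0 1) := by
      rw [← intervalIntegrable_iff_integrableOn_Ioc_of_le zero_le_one]
      exact intervalIntegral.intervalIntegrable_rpow' (by linarith)
    refine h1.congr_fun (fun a ha => ?_) measurableSet_Ioc
    simp only
    rw [min_eq_right ha.2, ← Real.rpow_add_one ha.1.ne']
    congr 1
    ring
  · have h1 : IntegrableOn (fun a : ℝ => a ^ (-1 - s)) (Ioi 1) :=
      integrableOn_Ioi_rpow_of_lt (by linarith) one_pos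
    refine h1.congr_fun (fun a ha => ?_) measurableSet_Ioi
    have ha' : (1 : ℝ) < a := ha
    simp only
    rw [min_eq_left ha'.le, mul_one]

lemma norm_marchaud_integrand_le {s a : ℝ} (ha : 0 < a) {l : ℂ} (hl : 0 ≤ l.re) :
    ‖((a ^ (-1 - s) : ℝ) : ℂ) * (1 - Complex.exp (-(a * l)))‖ ≤
      2 * (1 + ‖l‖) * (a ^ (-1 - s) * min 1 a) := by
  have hre : 0 ≤ ((a : ℂ) * l).re := by simpa using mul_nonneg ha.le hl
  have h1 := norm_one_sub_cexp_neg_le hre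
  rw [norm_mul, Complex.norm_real, Real.norm_of_nonneg ha.le] at h1
  have h2 : ‖1 - Complex.exp (-(a * l))‖ ≤ 2 := by
    refine (norm_sub_le _ _).trans ?_
    have := norm_cexp_neg_le_one hre
    simp only [norm_one]
    linarith
  rw [norm_mul, Complex.norm_real, Real.norm_of_nonneg (Real.rpow_nonneg ha.le _)]
  have h3 : ‖1 - Complex.exp (-(a * l))‖ ≤ 2 * (1 + ‖l‖) * min 1 a := by
    have := norm_nonneg l
    rcases le_total 1 a with h | h
    · rw [min_eq_left h]; linarith
    · rw [min_eq_right h]; nlinarith [mul_nonneg ha.le this]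
  calc _ ≤ a ^ (-1 - s) * (2 * (1 + ‖l‖) * min 1 a) := by gcongr
    _ = _ := by ring

lemma integrableOn_marchaud {s : ℝ} (hs0 : 0 < s) (hs1 : s < 1) {l : ℂ} (hl : 0 ≤ l.re) :
    IntegrableOn (fun a : ℝ => ((a ^ (-1 - s) : ℝ) : ℂ) * (1 - Complex.exp (-(a * l)))) (Ioi 0) := by
  refine ((integrableOn_marchaud_majorant hs0 hs1).const_mul (2 * (1 + ‖l‖))).mono'
    (Measurable.aestronglyMeasurable (by fun_prop)) ?_
  filter_upwards [ae_restrict_mem measurableSet_Ioi] with a ha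
  exact norm_marchaud_integrand_le ha hl

lemma integral_marchaud_of_re_pos {s : ℝ} (hs0 : 0 < s) (hs1 : s < 1) {l : ℂ} (hl : 0 < l.re) :
    ∫ a in Ioi (0 : ℝ), ((a ^ (-1 - s) : ℝ) : ℂ) * (1 - Complex.exp (-(a * l))) =
      Real.Gamma (1 - s) / s * l ^ (s : ℂ) := by
  have hl0 : l ≠ 0 := by rintro rfl; simp at hl
  have hs0' : (s : ℂ) ≠ 0 := by exact_mod_cast hs0.ne'
  have hgam := integral_rpow_mul_cexp_neg_mul_Ioi (q := 1 - s) (by linarith) hl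
  have hbd : ∀ a : ℝ, 0 < a → ‖(1 - Complex.exp (-(a * l)))‖ ≤ min 2 (a * ‖l‖) := by
    intro a ha
    have hre : 0 ≤ ((a : ℂ) * l).re := by simpa using mul_nonneg ha.le hl.le
    have h1 := norm_one_sub_cexp_neg_le hre
    rw [norm_mul, Complex.norm_real, Real.norm_of_nonneg ha.le] at h1
    refine le_min ?_ h1
    refine (norm_sub_le _ _).trans ?_
    have := norm_cexp_neg_le_one hre
    simp only [norm_one]
    linarith
  have hnv : ∀ a : ℝ, 0 < a → ‖(-((a ^ (-s) / s : ℝ) : ℂ))‖ = a ^ (-s) / s := by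
    intro a ha
    rw [norm_neg, Complex.norm_real, Real.norm_of_nonneg]
    exact div_nonneg (Real.rpow_nonneg ha.le _) hs0.le
  have hib := integral_Ioi_mul_deriv_eq_deriv_mul (a := (0 : ℝ))
    (u := fun a : ℝ => 1 - Complex.exp (-(a * l))) (u' := fun a : ℝ => Complex.exp (-(a * l)) * l)
    (v := fun a : ℝ => -((a ^ (-s) / s : ℝ) : ℂ)) (v' := fun a : ℝ => ((a ^ (-1 - s) : ℝ) : ℂ))
    (a' := 0) (b' := 0)
    (fun a _ => by
      have h1 : HasDerivAt (fun a : ℝ => -((a : ℂ) * l)) (-l) a := by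
        simpa using ((Complex.ofRealCLM.hasDerivAt (x := a)).mul_const l).fun_neg
      have := (h1.cexp).const_sub 1
      simpa using this)
    (fun a ha => by
      have ha' : a ≠ 0 := ne_of_gt ha
      have h1 := ((Real.hasDerivAt_rpow_const (x := a) (p := -s) (Or.inl ha')).div_const s).neg
      have h2 := h1.ofReal_comp
      have h3 : -(-s * a ^ (-s - 1) / s) = a ^ (-1 - s) := by
        rw [show -s - 1 = -1 - s by ring]
        field_simp
      rw [h3] at h2
      simpa using h2)
    (by
      refine (integrableOn_marchaud hs0 hs1 hl.le).congr (ae_of_all _ fun a => ?_)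
      simp only [Pi.mul_apply]; ring)
    (by
      have h1 : IntegrableOn (fun t : ℝ => t ^ ((1 - s) - 1) * Real.exp (-(l.re * t))) (Ioi 0) :=
        integrableOn_rpow_mul_exp_neg_Ioi (by linarith) hl
      refine (h1.const_mul (‖l‖ / s)).mono' (Measurable.aestronglyMeasurable (by fun_prop)) ?_
      filter_upwards [ae_restrict_mem measurableSet_Ioi] with a ha
      have ha' : (0 : ℝ) < a := ha
      rw [Pi.mul_apply, norm_mul, norm_mul, hnv a ha, Complex.norm_exp]
      have e1 : (-((a : ℂ) * l)).re = -(l.re * a) := by simp [mul_comm]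
      rw [e1, show 1 - s - 1 = -s by ring]
      apply le_of_eq
      ring)
    (by
      have hlim : Tendsto (fun a : ℝ => a ^ (1 - s) * (‖l‖ / s)) (𝓝[>] 0) (𝓝 0) := by
        have : Tendsto (fun a : ℝ => a ^ (1 - s)) (𝓝 0) (𝓝 0) := by
          have := (Real.continuousAt_rpow_const (0 : ℝ) (1 - s) (Or.inr (by linarith))).tendsto
          rwa [Real.zero_rpow (by linarith)] at this
        simpa using (this.mono_left nhdsWithin_le_nhds).mul_const (‖l‖ / s)
      refine squeeze_zero_norm' ?_ hlim
      filter_upwards [self_mem_nhdsWithin] with a ha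
      have ha' : (0 : ℝ) < a := ha
      rw [Pi.mul_apply, norm_mul, hnv a ha]
      have h1 := (hbd a ha).trans (min_le_right _ _)
      have h2 : a ^ (1 - s) = a * a ^ (-s) := by
        rw [show 1 - s = -s + 1 by ring, Real.rpow_add_one ha'.ne']
        ring
      have h3 : 0 ≤ a ^ (-s) / s := div_nonneg (Real.rpow_nonneg ha'.le _) hs0.le
      calc _ ≤ (a * ‖l‖) * (a ^ (-s) / s) := by gcongr
        _ = _ := by rw [h2]; ring)
    (by
      have hlim : Tendsto (fun a : ℝ => a ^ (-s) * (2 / s)) atTop (𝓝 0) := by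
        simpa using (tendsto_rpow_neg_atTop hs0).mul_const (2 / s)
      refine squeeze_zero_norm' ?_ hlim
      filter_upwards [eventually_gt_atTop 0] with a ha
      rw [Pi.mul_apply, norm_mul, hnv a ha]
      have h1 := (hbd a ha).trans (min_le_left _ _)
      have h3 : 0 ≤ a ^ (-s) / s := div_nonneg (Real.rpow_nonneg ha.le _) hs0.le
      calc _ ≤ 2 * (a ^ (-s) / s) := by gcongr
        _ = _ := by ring)
  calc _ = ∫ a in Ioi (0 : ℝ), (1 - Complex.exp (-(a * l))) * ((a ^ (-1 - s) : ℝ) : ℂ) := by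
        congr 1; ext a; ring
    _ = l / s * ∫ t in Ioi (0 : ℝ), ((t ^ (1 - s - 1) : ℝ) : ℂ) * Complex.exp (-(t * l)) := by
        rw [hib, ← integral_const_mul, sub_zero, zero_sub, ← integral_neg]
        congr 1; ext a
        rw [show 1 - s - 1 = -s by ring]
        push_cast
        ring
    _ = _ := by
        rw [hgam]
        have : (-((1 - s : ℝ) : ℂ)) = (s : ℂ) - 1 := by push_cast; ring
        rw [this, Complex.cpow_sub _ _ hl0, Complex.cpow_one]
        field_simp

/-- Marchaud's representation of the power `λ ^ s` for `Re λ ≥ 0`. -/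
lemma integral_marchaud {s : ℝ} (hs0 : 0 < s) (hs1 : s < 1) {l : ℂ} (hl : 0 ≤ l.re) :
    ∫ a in Ioi (0 : ℝ), ((a ^ (-1 - s) : ℝ) : ℂ) * (1 - Complex.exp (-(a * l))) =
      Real.Gamma (1 - s) / s * l ^ (s : ℂ) := by
  have hη : Tendsto (fun k : ℕ => l + ((1 / ((k : ℝ) + 1) : ℝ) : ℂ)) atTop (𝓝 l) := by
    have := (Complex.continuous_ofReal.tendsto 0).comp tendsto_one_div_add_atTop_nhds_zero_nat
    simpa using this.const_add l
  have hpos : ∀ k : ℕ, 0 < 1 / ((k : ℝ) + 1) := fun k => Nat.one_div_pos_of_nat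
  have hle : ∀ k : ℕ, 1 / ((k : ℝ) + 1) ≤ 1 := fun k => by
    rw [div_le_one (by positivity)]; linarith [Nat.cast_nonneg (α := ℝ) k]
  have hR : Tendsto (fun k : ℕ => Real.Gamma (1 - s) / s *
      (l + ((1 / ((k : ℝ) + 1) : ℝ) : ℂ)) ^ (s : ℂ)) atTop
      (𝓝 (Real.Gamma (1 - s) / s * l ^ (s : ℂ))) := by
    refine Tendsto.const_mul _ ?_
    exact ((Complex.continuousAt_cpow_const_of_re_pos (Or.inl hl) (by simpa)).tendsto).comp hη
  have hL := tendsto_integral_of_dominated_convergence (μ := volume.restrict (Ioi (0 : ℝ)))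
    (F := fun (k : ℕ) (a : ℝ) => ((a ^ (-1 - s) : ℝ) : ℂ) *
      (1 - Complex.exp (-(a * (l + ((1 / ((k : ℝ) + 1) : ℝ) : ℂ))))))
    (f := fun a : ℝ => ((a ^ (-1 - s) : ℝ) : ℂ) * (1 - Complex.exp (-(a * l))))
    (fun a => 2 * (1 + (‖l‖ + 1)) * (a ^ (-1 - s) * min 1 a))
    (fun k => Measurable.aestronglyMeasurable (by fun_prop))
    ((integrableOn_marchaud_majorant hs0 hs1).const_mul _)
    (fun k => by
      filter_upwards [ae_restrict_mem measurableSet_Ioi] with a ha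
      have ha' : (0 : ℝ) < a := ha
      refine (norm_marchaud_integrand_le ha ?_).trans ?_
      · have := hpos k
        rw [Complex.add_re, Complex.ofReal_re]
        linarith
      · have h1 : ‖l + ((1 / ((k : ℝ) + 1) : ℝ) : ℂ)‖ ≤ ‖l‖ + 1 := by
          refine (norm_add_le _ _).trans ?_
          rw [Complex.norm_real, Real.norm_of_nonneg (hpos k).le]
          linarith [hle k]
        gcongr)
    (ae_of_all _ fun a => by
      have hc : Continuous fun z : ℂ => ((a ^ (-1 - s) : ℝ) : ℂ) * (1 - Complex.exp (-(a * z))) := by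
        fun_prop
      exact (hc.tendsto l).comp hη)
  refine tendsto_nhds_unique (hL.congr fun k => ?_) hR
  refine integral_marchaud_of_re_pos hs0 hs1 ?_
  have := hpos k
  rw [Complex.add_re, Complex.ofReal_re]
  linarith

/-- The density of the Poisson kernel of the half-space `ℝᵐ × (0, ∞)` at height one. -/
def poissonDensity (m : ℕ) (y : Euc m) : ℝ :=
  Real.Gamma (((m : ℝ) + 1) / 2) / Real.pi ^ (((m : ℝ) + 1) / 2) *
    (1 + ‖y‖ ^ 2) ^ (-((m : ℝ) + 1) / 2)

/-- The Poisson kernel of the half-space at height one, as a measure on `ℝᵐ`. -/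
def poissonMeasure (m : ℕ) : Measure (Euc m) :=
  volume.withDensity fun y => ENNReal.ofReal (poissonDensity m y)

lemma poissonDensity_nonneg (m : ℕ) (y : Euc m) : 0 ≤ poissonDensity m y := by
  have := Real.Gamma_pos_of_pos (s := ((m : ℝ) + 1) / 2) (by positivity)
  unfold poissonDensity
  positivity

lemma measurable_poissonDensity (m : ℕ) : Measurable (poissonDensity m) := by
  unfold poissonDensity
  fun_prop

lemma poissonDensity_eq_integral (m : ℕ) (y : Euc m) :
    poissonDensity m y = ∫ r in Ioi (0 : ℝ), (Real.pi ^ (((m : ℝ) + 1) / 2))⁻¹ *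
      (r ^ (((m : ℝ) + 1) / 2 - 1) * Real.exp (-((1 + ‖y‖ ^ 2) * r))) := by
  rw [integral_const_mul, Real.integral_rpow_mul_exp_neg_mul_Ioi (by positivity) (by positivity),
    poissonDensity, one_div, Real.inv_rpow (by positivity), neg_div (2 : ℝ) ((m : ℝ) + 1),
    Real.rpow_neg (by positivity)]
  ring

lemma integral_gaussian_cos_exp (m : ℕ) {r : ℝ} (hr : 0 < r) (ξ : Euc m) :
    ∫ y : Euc m, ((Real.exp (-(r * ‖y‖ ^ 2)) : ℝ) : ℂ) * Complex.exp (⟪y, ξ⟫ * Complex.I) =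
      (((Real.pi / r) ^ ((m : ℝ) / 2) * Real.exp (-(‖ξ‖ ^ 2 / (4 * r))) : ℝ) : ℂ) := by
  have h := GaussianFourier.integral_cexp_neg_mul_sq_norm_add (V := Euc m) (b := (r : ℂ))
    (by simpa using hr) Complex.I ξ
  have hpr : 0 ≤ Real.pi / r := by positivity
  rw [finrank_euclideanSpace_fin] at h
  convert! h using 1
  · congr 1; ext y
    rw [Complex.ofReal_exp, ← Complex.exp_add, real_inner_comm]
    push_cast
    ring_nf
  · rw [Complex.ofReal_mul, Complex.ofReal_cpow hpr, Complex.ofReal_exp]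
    push_cast
    rw [Complex.I_sq]
    ring_nf

lemma integral_gaussian_norm (m : ℕ) {r : ℝ} (hr : 0 < r) :
    ∫ y : Euc m, Real.exp (-(r * ‖y‖ ^ 2)) = (Real.pi / r) ^ ((m : ℝ) / 2) := by
  have h := GaussianFourier.integral_rexp_neg_mul_sq_norm (V := Euc m) hr
  rw [finrank_euclideanSpace_fin] at h
  simpa using h

lemma integrable_gaussian_norm (m : ℕ) {r : ℝ} (hr : 0 < r) :
    Integrable fun y : Euc m => Real.exp (-(r * ‖y‖ ^ 2)) := by
  by_contra h
  have := integral_undef h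
  rw [integral_gaussian_norm m hr] at this
  have h2 : 0 < (Real.pi / r) ^ ((m : ℝ) / 2) := by positivity
  linarith

lemma integrable_poisson_subordination (m : ℕ) :
    Integrable (fun q : Euc m × ℝ => (Real.pi ^ (((m : ℝ) + 1) / 2))⁻¹ *
      (q.2 ^ (((m : ℝ) + 1) / 2 - 1) * Real.exp (-((1 + ‖q.1‖ ^ 2) * q.2))))
      (volume.prod (volume.restrict (Ioi (0 : ℝ)))) := by
  refine Integrable.const_mul ?_ _
  have hm : AEStronglyMeasurable (fun q : Euc m × ℝ =>
      q.2 ^ (((m : ℝ) + 1) / 2 - 1) * Real.exp (-((1 + ‖q.1‖ ^ 2) * q.2)))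
      (volume.prod (volume.restrict (Ioi (0 : ℝ)))) :=
    Measurable.aestronglyMeasurable (by fun_prop)
  have hsplit : ∀ (y : Euc m) (r : ℝ), Real.exp (-((1 + ‖y‖ ^ 2) * r)) =
      Real.exp (-r) * Real.exp (-(r * ‖y‖ ^ 2)) := by
    intro y r
    rw [← Real.exp_add]
    ring_nf
  rw [integrable_prod_iff' hm]
  constructor
  · filter_upwards [ae_restrict_mem measurableSet_Ioi] with r hr
    refine Integrable.const_mul ?_ _
    simp only [hsplit]
    exact (integrable_gaussian_norm m hr).const_mul _
  · have h0 : IntegrableOn (fun t : ℝ => Real.pi ^ ((m : ℝ) / 2) *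
        (t ^ ((1 / 2 : ℝ) - 1) * Real.exp (-(1 * t)))) (Ioi 0) :=
      (integrableOn_rpow_mul_exp_neg_Ioi (by norm_num) one_pos).const_mul _
    refine h0.congr_fun (fun r hr => ?_) measurableSet_Ioi
    have hr' : (0 : ℝ) < r := hr
    have : ∀ y : Euc m, ‖r ^ (((m : ℝ) + 1) / 2 - 1) * Real.exp (-((1 + ‖y‖ ^ 2) * r))‖ =
        r ^ (((m : ℝ) + 1) / 2 - 1) * Real.exp (-r) * Real.exp (-(r * ‖y‖ ^ 2)) := by
      intro y
      rw [Real.norm_of_nonneg (by positivity), hsplit, mul_assoc]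
    simp only [this]
    rw [integral_const_mul, integral_gaussian_norm m hr', Real.div_rpow Real.pi_pos.le hr'.le,
      show ((m : ℝ) + 1) / 2 - 1 = (1 / 2 - 1) + m / 2 by ring, Real.rpow_add hr', one_mul]
    have : r ^ ((m : ℝ) / 2) ≠ 0 := by positivity
    field_simp

lemma integrable_poissonDensity (m : ℕ) : Integrable (poissonDensity m) := by
  have h := (integrable_poisson_subordination m).integral_prod_left
  refine h.congr (ae_of_all _ fun y => ?_)
  exact (poissonDensity_eq_integral m y).symm

lemma integral_poissonMeasure (m : ℕ) (f : Euc m → ℂ) :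
    ∫ y, f y ∂(poissonMeasure m) = ∫ y, (poissonDensity m y : ℂ) * f y := by
  rw [poissonMeasure, integral_withDensity_eq_integral_toReal_smul
    (measurable_poissonDensity m).ennreal_ofReal (by simp)]
  refine integral_congr_ae (ae_of_all _ fun y => ?_)
  simp [ENNReal.toReal_ofReal (poissonDensity_nonneg m y)]

lemma charFun_poissonMeasure (m : ℕ) (ξ : Euc m) :
    charFun (poissonMeasure m) ξ = ((Real.exp (-‖ξ‖) : ℝ) : ℂ) := by
  have hpi : (Real.pi ^ (((m : ℝ) + 1) / 2)) = Real.pi ^ ((m : ℝ) / 2) * √Real.pi := by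
    rw [Real.sqrt_eq_rpow, ← Real.rpow_add Real.pi_pos]; ring_nf
  have hint : Integrable (fun q : Euc m × ℝ => Complex.exp (⟪q.1, ξ⟫ * Complex.I) *
      (((Real.pi ^ (((m : ℝ) + 1) / 2))⁻¹ *
      (q.2 ^ (((m : ℝ) + 1) / 2 - 1) * Real.exp (-((1 + ‖q.1‖ ^ 2) * q.2))) : ℝ) : ℂ))
      (volume.prod (volume.restrict (Ioi (0 : ℝ)))) := by
    refine (integrable_poisson_subordination m).ofReal.bdd_mul (c := 1)
      (Measurable.aestronglyMeasurable (by fun_prop)) (ae_of_all _ fun q => ?_)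
    rw [Complex.norm_exp_ofReal_mul_I]
  rw [charFun_apply, integral_poissonMeasure]
  calc _ = ∫ y : Euc m, ∫ r in Ioi (0 : ℝ), Complex.exp (⟪y, ξ⟫ * Complex.I) *
      (((Real.pi ^ (((m : ℝ) + 1) / 2))⁻¹ *
      (r ^ (((m : ℝ) + 1) / 2 - 1) * Real.exp (-((1 + ‖y‖ ^ 2) * r))) : ℝ) : ℂ) := by
        refine integral_congr_ae (ae_of_all _ fun y => ?_)
        simp only
        rw [integral_const_mul, integral_complex_ofReal, ← poissonDensity_eq_integral, mul_comm]
    _ = ∫ r in Ioi (0 : ℝ), ∫ y : Euc m, Complex.exp (⟪y, ξ⟫ * Complex.I) *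
      (((Real.pi ^ (((m : ℝ) + 1) / 2))⁻¹ *
      (r ^ (((m : ℝ) + 1) / 2 - 1) * Real.exp (-((1 + ‖y‖ ^ 2) * r))) : ℝ) : ℂ) :=
        integral_integral_swap hint
    _ = ∫ r in Ioi (0 : ℝ), (((√Real.pi)⁻¹ *
          (r ^ (-(1 / 2) : ℝ) * Real.exp (-r - ‖ξ‖ ^ 2 / (4 * r))) : ℝ) : ℂ) := by
        refine setIntegral_congr_fun measurableSet_Ioi fun r hr => ?_
        have hr' : (0 : ℝ) < r := hr
        have h1 : ∀ y : Euc m, Complex.exp (⟪y, ξ⟫ * Complex.I) *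
            (((Real.pi ^ (((m : ℝ) + 1) / 2))⁻¹ *
            (r ^ (((m : ℝ) + 1) / 2 - 1) * Real.exp (-((1 + ‖y‖ ^ 2) * r))) : ℝ) : ℂ) =
            (((Real.pi ^ (((m : ℝ) + 1) / 2))⁻¹ * r ^ (((m : ℝ) + 1) / 2 - 1) *
              Real.exp (-r) : ℝ) : ℂ) *
            (((Real.exp (-(r * ‖y‖ ^ 2)) : ℝ) : ℂ) * Complex.exp (⟪y, ξ⟫ * Complex.I)) := by
          intro y
          rw [show -((1 + ‖y‖ ^ 2) * r) = -r + -(r * ‖y‖ ^ 2) by ring, Real.exp_add]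
          push_cast
          ring
        simp only [h1]
        rw [integral_const_mul, integral_gaussian_cos_exp m hr', ← Complex.ofReal_mul]
        congr 1
        rw [Real.div_rpow Real.pi_pos.le hr'.le, hpi,
          show ((m : ℝ) + 1) / 2 - 1 = -(1 / 2) + m / 2 by ring, Real.rpow_add hr', sub_eq_add_neg,
          Real.exp_add]
        have : r ^ ((m : ℝ) / 2) ≠ 0 := by positivity
        have : Real.pi ^ ((m : ℝ) / 2) ≠ 0 := by positivity
        field_simp
    _ = _ := by
        rw [integral_complex_ofReal, integral_const_mul, integral_gamma_half_exp (norm_nonneg ξ)]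
        have : √Real.pi ≠ 0 := by positivity
        congr 1
        field_simp

instance isFiniteMeasure_poissonMeasure (m : ℕ) : IsFiniteMeasure (poissonMeasure m) :=
  isFiniteMeasure_withDensity_ofReal (integrable_poissonDensity m).2

instance isProbabilityMeasure_poissonMeasure (m : ℕ) :
    IsProbabilityMeasure (poissonMeasure m) := by
  have h := charFun_poissonMeasure m 0
  rw [charFun_zero] at h
  simp only [norm_zero, neg_zero, Real.exp_zero, Complex.ofReal_one, Complex.ofReal_eq_one] at h
  constructor
  rw [← ENNReal.toReal_eq_one_iff]
  exact h

/-- The convolution semigroup property of the Poisson kernels. -/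
lemma lintegral_lintegral_poissonMeasure (m : ℕ) {a b : ℝ} (ha : 0 ≤ a) (hb : 0 ≤ b)
    {F : Euc m → ℝ≥0∞} (hF : Measurable F) :
    ∫⁻ y, ∫⁻ z, F (a • y + b • z) ∂(poissonMeasure m) ∂(poissonMeasure m) =
      ∫⁻ y, F ((a + b) • y) ∂(poissonMeasure m) := by
  have hsm : ∀ c : ℝ, Measurable fun y : Euc m => c • y := fun c => by fun_prop
  have hprob : ∀ c : ℝ, IsProbabilityMeasure ((poissonMeasure m).map fun y => c • y) :=
    fun c => Measure.isProbabilityMeasure_map (hsm c).aemeasurable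
  have key : ((poissonMeasure m).map fun y => a • y) ∗ ((poissonMeasure m).map fun y => b • y) =
      (poissonMeasure m).map fun y => (a + b) • y := by
    have := hprob a
    have := hprob b
    have := hprob (a + b)
    refine Measure.ext_of_charFun ?_
    ext ξ
    rw [charFun_conv, charFun_map_smul, charFun_map_smul, charFun_map_smul]
    simp only [charFun_poissonMeasure]
    rw [← Complex.ofReal_mul, ← Real.exp_add, norm_smul, norm_smul, norm_smul,
      Real.norm_of_nonneg ha, Real.norm_of_nonneg hb, Real.norm_of_nonneg (add_nonneg ha hb)]
    ring_nf
  rw [← lintegral_map (f := F) hF (hsm (a + b)), ← key, Measure.lintegral_conv hF,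
    lintegral_map _ (hsm a)]
  · refine lintegral_congr fun y => ?_
    rw [lintegral_map _ (hsm b)]
    fun_prop
  · have := hprob b
    refine Measurable.lintegral_prod_right' (f := fun q : Euc m × Euc m => F (q.1 + q.2)) ?_
    fun_prop

lemma integrableOn_marchaud_real {s : ℝ} (hs0 : 0 < s) (hs1 : s < 1) {c : ℝ} (hc : 0 ≤ c) :
    IntegrableOn (fun a : ℝ => a ^ (-1 - s) * (1 - Real.exp (-(a * c)))) (Ioi 0) := by
  have h := (integrableOn_marchaud hs0 hs1 (l := (c : ℂ)) (by simpa using hc)).re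
  refine h.congr (ae_of_all _ fun a => ?_)
  have : ((a ^ (-1 - s) : ℝ) : ℂ) * (1 - Complex.exp (-(a * c))) =
      ((a ^ (-1 - s) * (1 - Real.exp (-(a * c))) : ℝ) : ℂ) := by push_cast; rfl
  simp only [this]
  exact Complex.ofReal_re _

lemma integral_marchaud_real {s : ℝ} (hs0 : 0 < s) (hs1 : s < 1) {c : ℝ} (hc : 0 ≤ c) :
    ∫ a in Ioi (0 : ℝ), a ^ (-1 - s) * (1 - Real.exp (-(a * c))) =
      Real.Gamma (1 - s) / s * c ^ s := by
  have h := integral_marchaud hs0 hs1 (l := (c : ℂ)) (by simpa using hc)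
  rw [← Complex.ofReal_inj, ← integral_complex_ofReal]
  push_cast
  rw [Complex.ofReal_cpow hc, ← h]

lemma rpow_marchaud_subst {s c x : ℝ} (hx : 0 < x) :
    (|(-1 : ℝ)| * x ^ ((-1 : ℝ) - 1)) •
      ((x ^ (-1 : ℝ)) ^ (s - 1) * (1 - Real.exp (-(c / (x ^ (-1 : ℝ)))))) =
      x ^ (-1 - s) * (1 - Real.exp (-(x * c))) := by
  rw [← Real.rpow_mul hx.le, smul_eq_mul, abs_neg, abs_one, one_mul, ← mul_assoc,
    ← Real.rpow_add hx, Real.rpow_neg_one, div_inv_eq_mul, mul_comm c]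
  ring_nf

lemma integrableOn_rpow_mul_one_sub_exp_div {s : ℝ} (hs0 : 0 < s) (hs1 : s < 1) {c : ℝ}
    (hc : 0 ≤ c) :
    IntegrableOn (fun t : ℝ => t ^ (s - 1) * (1 - Real.exp (-(c / t)))) (Ioi 0) := by
  rw [← integrableOn_Ioi_comp_rpow_iff _ (show (-1 : ℝ) ≠ 0 by norm_num)]
  refine (integrableOn_marchaud_real hs0 hs1 hc).congr_fun (fun x hx => ?_) measurableSet_Ioi
  exact (rpow_marchaud_subst hx).symm

lemma integral_rpow_mul_one_sub_exp_div {s : ℝ} (hs0 : 0 < s) (hs1 : s < 1) {c : ℝ}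
    (hc : 0 ≤ c) :
    ∫ t in Ioi (0 : ℝ), t ^ (s - 1) * (1 - Real.exp (-(c / t))) =
      Real.Gamma (1 - s) / s * c ^ s := by
  rw [← integral_comp_rpow_Ioi _ (show (-1 : ℝ) ≠ 0 by norm_num), ← integral_marchaud_real hs0 hs1 hc]
  exact setIntegral_congr_fun measurableSet_Ioi fun x hx => rpow_marchaud_subst hx

lemma rpow_neg_eq_integral {n s R : ℝ} (hn : 0 ≤ n) (hs0 : 0 < s) (hR : 0 < R) :
    R ^ (-(n + 2 * s)) = (Real.Gamma (n / 2 + s))⁻¹ *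
      ∫ t in Ioi (0 : ℝ), t ^ (n / 2 + s - 1) * Real.exp (-(R ^ 2 * t)) := by
  have hG := Real.Gamma_pos_of_pos (s := n / 2 + s) (by positivity)
  rw [Real.integral_rpow_mul_exp_neg_mul_Ioi (by positivity) (by positivity), one_div,
    Real.inv_rpow (by positivity), ← Real.rpow_natCast, ← Real.rpow_mul hR.le, Real.rpow_neg hR.le]
  field_simp
  congr 2
  push_cast
  ring

lemma integral_gaussian_one_sub_cos (n : ℕ) {r : ℝ} (hr : 0 < r) (ξ : Euc n) :
    ∫ y : Euc n, Real.exp (-(r * ‖y‖ ^ 2)) * (1 - Real.cos ⟪y, ξ⟫) =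
      (Real.pi / r) ^ ((n : ℝ) / 2) * (1 - Real.exp (-(‖ξ‖ ^ 2 / (4 * r)))) := by
  have hi : Integrable fun y : Euc n => Real.exp (-(r * ‖y‖ ^ 2)) * Real.cos ⟪y, ξ⟫ := by
    refine (integrable_gaussian_norm n hr).mul_bdd (c := 1)
      (Measurable.aestronglyMeasurable (by fun_prop)) (ae_of_all _ fun y => ?_)
    exact Real.abs_cos_le_one _
  have hic : Integrable fun y : Euc n =>
      ((Real.exp (-(r * ‖y‖ ^ 2)) : ℝ) : ℂ) * Complex.exp (⟪y, ξ⟫ * Complex.I) := by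
    refine (integrable_gaussian_norm n hr).ofReal.mul_bdd (c := 1)
      (Measurable.aestronglyMeasurable (by fun_prop)) (ae_of_all _ fun y => ?_)
    rw [Complex.norm_exp_ofReal_mul_I]
  have h := congrArg Complex.re (integral_gaussian_cos_exp n hr ξ)
  rw [Complex.ofReal_re] at h
  have h2 : (∫ y : Euc n, ((Real.exp (-(r * ‖y‖ ^ 2)) : ℝ) : ℂ) *
      Complex.exp (⟪y, ξ⟫ * Complex.I)).re =
      ∫ y : Euc n, Real.exp (-(r * ‖y‖ ^ 2)) * Real.cos ⟪y, ξ⟫ := by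
    have h3 := integral_re hic
    refine h3.symm.trans (integral_congr_ae (ae_of_all _ fun y => ?_))
    simp only
    exact (Complex.re_ofReal_mul _ _).trans (by rw [Complex.exp_ofReal_mul_I_re])
  simp only [mul_sub, mul_one]
  rw [integral_sub (integrable_gaussian_norm n hr) hi, integral_gaussian_norm n hr, ← h2, h]

lemma integral_frac_symbol_aux (n : ℕ) {s : ℝ} (hs0 : 0 < s) (hs1 : s < 1) (ξ : Euc n) :
    Integrable (fun q : Euc n × ℝ => (1 - Real.cos ⟪q.1, ξ⟫) *
      (q.2 ^ ((n : ℝ) / 2 + s - 1) * Real.exp (-(‖q.1‖ ^ 2 * q.2))))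
      (volume.prod (volume.restrict (Ioi (0 : ℝ)))) ∧
    ∫ t in Ioi (0 : ℝ), ∫ y : Euc n, (1 - Real.cos ⟪y, ξ⟫) *
      (t ^ ((n : ℝ) / 2 + s - 1) * Real.exp (-(‖y‖ ^ 2 * t))) =
      Real.pi ^ ((n : ℝ) / 2) * (Real.Gamma (1 - s) / s * (‖ξ‖ ^ 2 / 4) ^ s) := by
  have hinner : ∀ t : ℝ, 0 < t → ∫ y : Euc n, (1 - Real.cos ⟪y, ξ⟫) *
      (t ^ ((n : ℝ) / 2 + s - 1) * Real.exp (-(‖y‖ ^ 2 * t))) =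
      Real.pi ^ ((n : ℝ) / 2) * (t ^ (s - 1) * (1 - Real.exp (-(‖ξ‖ ^ 2 / 4 / t)))) := by
    intro t ht
    have : ∀ y : Euc n, (1 - Real.cos ⟪y, ξ⟫) *
      (t ^ ((n : ℝ) / 2 + s - 1) * Real.exp (-(‖y‖ ^ 2 * t))) = t ^ ((n : ℝ) / 2 + s - 1) *
      (Real.exp (-(t * ‖y‖ ^ 2)) * (1 - Real.cos ⟪y, ξ⟫)) := by
      intro y
      rw [mul_comm t]
      ring
    simp only [this]
    rw [integral_const_mul, integral_gaussian_one_sub_cos n ht, Real.div_rpow Real.pi_pos.le ht.le,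
      show (n : ℝ) / 2 + s - 1 = n / 2 + (s - 1) by ring, Real.rpow_add ht, div_div]
    have : t ^ ((n : ℝ) / 2) ≠ 0 := by positivity
    field_simp
  constructor
  · rw [integrable_prod_iff' (Measurable.aestronglyMeasurable (by fun_prop))]
    constructor
    · filter_upwards [ae_restrict_mem measurableSet_Ioi] with t ht
      refine Integrable.bdd_mul (c := 2) ?_ (Measurable.aestronglyMeasurable (by fun_prop))
        (ae_of_all _ fun y => ?_)
      · refine Integrable.const_mul ?_ _
        simp only [mul_comm _ t]
        exact integrable_gaussian_norm n ht
      · rw [Real.norm_of_nonneg (sub_nonneg.2 (Real.cos_le_one _))]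
        linarith [Real.neg_one_le_cos ⟪y, ξ⟫]
    · have := (integrableOn_rpow_mul_one_sub_exp_div hs0 hs1
        (show 0 ≤ ‖ξ‖ ^ 2 / 4 by positivity)).const_mul (Real.pi ^ ((n : ℝ) / 2))
      refine IntegrableOn.congr_fun this (fun t ht => ?_) measurableSet_Ioi
      have ht' : (0 : ℝ) < t := ht
      simp only
      rw [← hinner t ht']
      refine integral_congr_ae (ae_of_all _ fun y => ?_)
      simp only
      rw [Real.norm_of_nonneg]
      exact mul_nonneg (sub_nonneg.2 (Real.cos_le_one _)) (by positivity)
  · rw [setIntegral_congr_fun measurableSet_Ioi fun t ht => hinner t ht, integral_const_mul,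
      integral_rpow_mul_one_sub_exp_div hs0 hs1 (by positivity)]

lemma frac_symbol_eq_integral (n : ℕ) {s : ℝ} (hs0 : 0 < s) (ξ y : Euc n) :
    (1 - Real.cos ⟪y, ξ⟫) * ‖y‖ ^ (-((n : ℝ) + 2 * s)) =
      (Real.Gamma ((n : ℝ) / 2 + s))⁻¹ * ∫ t in Ioi (0 : ℝ), (1 - Real.cos ⟪y, ξ⟫) *
      (t ^ ((n : ℝ) / 2 + s - 1) * Real.exp (-(‖y‖ ^ 2 * t))) := by
  rcases eq_or_ne y 0 with rfl | hy
  · simp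
  · rw [integral_const_mul, rpow_neg_eq_integral (Nat.cast_nonneg n) hs0 (norm_pos_iff.2 hy)]
    ring

lemma integrable_frac_symbol (n : ℕ) {s : ℝ} (hs0 : 0 < s) (hs1 : s < 1) (ξ : Euc n) :
    Integrable fun y : Euc n => (1 - Real.cos ⟪y, ξ⟫) * ‖y‖ ^ (-((n : ℝ) + 2 * s)) := by
  simp only [frac_symbol_eq_integral n hs0 ξ]
  exact ((integral_frac_symbol_aux n hs0 hs1 ξ).1.integral_prod_left).const_mul _

/-- The Fourier symbol of the fractional Laplacian. -/
lemma fracC_mul_integral_frac_symbol (n : ℕ) {s : ℝ} (hs0 : 0 < s) (hs1 : s < 1) (ξ : Euc n) :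
    fracC n s * ∫ y : Euc n, (1 - Real.cos ⟪y, ξ⟫) * ‖y‖ ^ (-((n : ℝ) + 2 * s)) =
      ‖ξ‖ ^ (2 * s) := by
  simp only [frac_symbol_eq_integral n hs0 ξ]
  obtain ⟨h1, h2⟩ := integral_frac_symbol_aux n hs0 hs1 ξ
  rw [integral_const_mul, integral_integral_swap h1, h2, fracC,
    Real.div_rpow (by positivity) (by norm_num), ← Real.rpow_natCast ‖ξ‖, ← Real.rpow_mul (norm_nonneg _)]
  have hG := Real.Gamma_pos_of_pos (s := (n : ℝ) / 2 + s) (by positivity)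
  have hG' := Real.Gamma_pos_of_pos (s := 1 - s) (by linarith)
  have : (0 : ℝ) < 4 ^ s := by positivity
  have : (0 : ℝ) < Real.pi ^ ((n : ℝ) / 2) := by positivity
  field_simp
  push_cast
  rfl

lemma fracC_nonneg (n : ℕ) {s : ℝ} (hs0 : 0 < s) (hs1 : s < 1) : 0 ≤ fracC n s := by
  have hG := Real.Gamma_pos_of_pos (s := (n : ℝ) / 2 + s) (by positivity)
  have hG' := Real.Gamma_pos_of_pos (s := 1 - s) (by linarith)
  unfold fracC
  positivity

lemma fracC_pos (n : ℕ) {s : ℝ} (hs0 : 0 < s) (hs1 : s < 1) : 0 < fracC n s := by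
  have hG := Real.Gamma_pos_of_pos (s := (n : ℝ) / 2 + s) (by positivity)
  have hG' := Real.Gamma_pos_of_pos (s := 1 - s) (by linarith)
  unfold fracC
  positivity

lemma measurableSet_le_norm (n : ℕ) (ε : ℝ) : MeasurableSet {z : Euc n | ε ≤ ‖z‖} :=
  measurableSet_le measurable_const measurable_norm

lemma integrableOn_norm_rpow_tail (n : ℕ) {s ε : ℝ} (hs0 : 0 < s) (hε : 0 < ε) :
    IntegrableOn (fun z : Euc n => ‖z‖ ^ (-((n : ℝ) + 2 * s))) {z | ε ≤ ‖z‖} := by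
  have h := integrable_one_add_norm (E := Euc n) (μ := volume) (r := (n : ℝ) + 2 * s)
    (by rw [finrank_euclideanSpace_fin]; linarith)
  refine (h.const_mul ((ε / (1 + ε)) ^ (-((n : ℝ) + 2 * s)))).integrableOn.mono'
    (Measurable.aestronglyMeasurable (by fun_prop)) ?_
  filter_upwards [ae_restrict_mem (measurableSet_le_norm n ε)] with z hz
  have hz' : ε ≤ ‖z‖ := hz
  have hz0 : 0 < ‖z‖ := hε.trans_le hz'
  rw [Real.norm_of_nonneg (by positivity), ← Real.mul_rpow (by positivity) (by positivity)]
  refine Real.rpow_le_rpow_of_nonpos (by positivity) ?_ ?_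
  · rw [div_mul_eq_mul_div, div_le_iff₀ (by positivity)]
    nlinarith
  · have : (0 : ℝ) ≤ n := Nat.cast_nonneg n
    linarith

lemma setIntegral_dist_eq (n : ℕ) (ε : ℝ) (x : Euc n) {F : Type*} [NormedAddCommGroup F]
    [NormedSpace ℝ F] (g : Euc n → F) :
    ∫ y in {y : Euc n | ε ≤ dist x y}, g y = ∫ z in {z : Euc n | ε ≤ ‖z‖}, g (x + z) := by
  have h1 : MeasurableSet {y : Euc n | ε ≤ dist x y} :=
    measurableSet_le measurable_const (by fun_prop)
  rw [← integral_indicator h1, ← integral_indicator (measurableSet_le_norm n ε),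
    ← integral_add_left_eq_self _ x]
  refine integral_congr_ae (ae_of_all _ fun z => ?_)
  simp [indicator_apply]

lemma integral_truncated_symbol (n : ℕ) {s ε : ℝ} (hs0 : 0 < s) (hε : 0 < ε) (ξ : Euc n) :
    ∫ z in {z : Euc n | ε ≤ ‖z‖}, (1 - Complex.exp (⟪ξ, z⟫ * Complex.I)) *
      ((‖z‖ ^ (-((n : ℝ) + 2 * s)) : ℝ) : ℂ) =
    ((∫ z in {z : Euc n | ε ≤ ‖z‖}, (1 - Real.cos ⟪z, ξ⟫) *
      ‖z‖ ^ (-((n : ℝ) + 2 * s)) : ℝ) : ℂ) := by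
  have hi := integrableOn_norm_rpow_tail n hs0 hε
  have hsin : Integrable (fun z : Euc n => Real.sin ⟪z, ξ⟫ * ‖z‖ ^ (-((n : ℝ) + 2 * s)))
      (volume.restrict {z : Euc n | ε ≤ ‖z‖}) := by
    refine hi.bdd_mul (c := 1) (Measurable.aestronglyMeasurable (by fun_prop))
      (ae_of_all _ fun z => ?_)
    exact Real.abs_sin_le_one _
  have hcos : Integrable (fun z : Euc n => (1 - Real.cos ⟪z, ξ⟫) * ‖z‖ ^ (-((n : ℝ) + 2 * s)))
      (volume.restrict {z : Euc n | ε ≤ ‖z‖}) := by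
    refine hi.bdd_mul (c := 2) (Measurable.aestronglyMeasurable (by fun_prop))
      (ae_of_all _ fun z => ?_)
    rw [Real.norm_of_nonneg (sub_nonneg.2 (Real.cos_le_one _))]
    linarith [Real.neg_one_le_cos ⟪z, ξ⟫]
  have h0 : ∫ z in {z : Euc n | ε ≤ ‖z‖}, Real.sin ⟪z, ξ⟫ * ‖z‖ ^ (-((n : ℝ) + 2 * s)) = 0 := by
    have h1 : ∫ z in {z : Euc n | ε ≤ ‖z‖}, Real.sin ⟪z, ξ⟫ * ‖z‖ ^ (-((n : ℝ) + 2 * s)) =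
        -∫ z in {z : Euc n | ε ≤ ‖z‖}, Real.sin ⟪z, ξ⟫ * ‖z‖ ^ (-((n : ℝ) + 2 * s)) := by
      rw [← integral_indicator (measurableSet_le_norm n ε), ← integral_neg]
      refine (integral_neg_eq_self _ volume).symm.trans ?_
      refine integral_congr_ae (ae_of_all _ fun z => ?_)
      by_cases hz : ε ≤ ‖z‖ <;> simp [hz]
    linarith
  have hpt : ∀ z : Euc n, (1 - Complex.exp (⟪ξ, z⟫ * Complex.I)) *
      ((‖z‖ ^ (-((n : ℝ) + 2 * s)) : ℝ) : ℂ) =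
      (((1 - Real.cos ⟪z, ξ⟫) * ‖z‖ ^ (-((n : ℝ) + 2 * s)) : ℝ) : ℂ) -
      Complex.I * ((Real.sin ⟪z, ξ⟫ * ‖z‖ ^ (-((n : ℝ) + 2 * s)) : ℝ) : ℂ) := by
    intro z
    rw [real_inner_comm, Complex.exp_mul_I]
    push_cast
    ring
  simp only [hpt]
  rw [integral_sub hcos.ofReal (hsin.ofReal.const_mul _), integral_const_mul,
    integral_complex_ofReal, integral_complex_ofReal, h0]
  simp

/-- The fractional Laplacian of a superposition of plane waves. -/
lemma hasFracLapAt_of_fourier {Ω : Type*} [MeasurableSpace Ω] {μ : Measure Ω} [SFinite μ]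
    (n : ℕ) {s : ℝ} (hs0 : 0 < s) (hs1 : s < 1) {c : Ω → ℂ} {k : Ω → Euc n} (hk : Measurable k)
    (hc : Integrable c μ) (hck : Integrable (fun ω => ‖c ω‖ * ‖k ω‖ ^ (2 * s)) μ)
    {W : Euc n → ℝ} (hW : ∀ x, (W x : ℂ) = ∫ ω, c ω * Complex.exp (⟪k ω, x⟫ * Complex.I) ∂μ)
    (x : Euc n) :
    HasFracLapAt n s W x
      (∫ ω, c ω * ((‖k ω‖ ^ (2 * s) : ℝ) : ℂ) * Complex.exp (⟪k ω, x⟫ * Complex.I) ∂μ).re := by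
  have hce : ∀ x, Integrable (fun ω => c ω * Complex.exp (⟪k ω, x⟫ * Complex.I)) μ := by
    intro x
    refine hc.mul_bdd (c := 1) (Measurable.aestronglyMeasurable (by fun_prop))
      (ae_of_all _ fun ω => ?_)
    rw [Complex.norm_exp_ofReal_mul_I]
  set σ : ℝ → Euc n → ℝ := fun ε ξ => fracC n s * ∫ z in {z : Euc n | ε ≤ ‖z‖},
    (1 - Real.cos ⟪z, ξ⟫) * ‖z‖ ^ (-((n : ℝ) + 2 * s)) with hσ
  have hcosnn : ∀ (ξ z : Euc n), 0 ≤ (1 - Real.cos ⟪z, ξ⟫) * ‖z‖ ^ (-((n : ℝ) + 2 * s)) :=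
    fun ξ z => mul_nonneg (sub_nonneg.2 (Real.cos_le_one _)) (by positivity)
  have hσ0 : ∀ ε ξ, 0 ≤ σ ε ξ := fun ε ξ => mul_nonneg (fracC_nonneg n hs0 hs1)
    (integral_nonneg (hcosnn ξ))
  have hσ1 : ∀ ε ξ, σ ε ξ ≤ ‖ξ‖ ^ (2 * s) := fun ε ξ => by
    rw [← fracC_mul_integral_frac_symbol n hs0 hs1 ξ]
    refine mul_le_mul_of_nonneg_left ?_ (fracC_nonneg n hs0 hs1)
    exact setIntegral_le_integral (integrable_frac_symbol n hs0 hs1 ξ) (ae_of_all _ (hcosnn ξ))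
  have hσlim : ∀ ξ, Tendsto (fun ε => σ ε ξ) (𝓝[>] 0) (𝓝 (‖ξ‖ ^ (2 * s))) := by
    intro ξ
    rw [← fracC_mul_integral_frac_symbol n hs0 hs1 ξ]
    refine Tendsto.const_mul _ ?_
    simp only [← integral_indicator (measurableSet_le_norm n _)]
    refine tendsto_integral_filter_of_dominated_convergence _
      (Eventually.of_forall fun ε => ?_) (Eventually.of_forall fun ε => ae_of_all _ fun z => ?_)
      (integrable_frac_symbol n hs0 hs1 ξ) (ae_of_all _ fun z => ?_)
    · exact ((integrable_frac_symbol n hs0 hs1 ξ).indicator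
        (measurableSet_le_norm n ε)).aestronglyMeasurable
    · rw [Real.norm_of_nonneg (indicator_nonneg (fun z _ => hcosnn ξ z) z)]
      exact indicator_le_self' (fun z _ => hcosnn ξ z) z
    · rcases eq_or_ne z 0 with rfl | hz
      · refine tendsto_const_nhds.congr fun ε => ?_
        simp [indicator_apply]
      · refine tendsto_const_nhds.congr' ?_
        have : ∀ᶠ ε in 𝓝[>] (0 : ℝ), ε < ‖z‖ :=
          (gt_mem_nhds (norm_pos_iff.2 hz)).filter_mono nhdsWithin_le_nhds
        filter_upwards [this] with ε hε
        rw [indicator_of_mem]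
        exact hε.le
  have htrunc : ∀ ε : ℝ, 0 < ε →
      (((fracC n s * ∫ y in {y : Euc n | ε ≤ dist x y},
        (W x - W y) / dist x y ^ ((n : ℝ) + 2 * s) : ℝ)) : ℂ) =
      ∫ ω, c ω * ((σ ε (k ω) : ℝ) : ℂ) * Complex.exp (⟪k ω, x⟫ * Complex.I) ∂μ := by
    intro ε hε
    rw [setIntegral_dist_eq, Complex.ofReal_mul, ← integral_complex_ofReal]
    have h1 : ∀ z : Euc n, (((W x - W (x + z)) / dist x (x + z) ^ ((n : ℝ) + 2 * s) : ℝ) : ℂ) =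
        ∫ ω, c ω * Complex.exp (⟪k ω, x⟫ * Complex.I) *
          ((1 - Complex.exp (⟪k ω, z⟫ * Complex.I)) *
            ((‖z‖ ^ (-((n : ℝ) + 2 * s)) : ℝ) : ℂ)) ∂μ := by
      intro z
      rw [dist_self_add_right, div_eq_mul_inv, ← Real.rpow_neg (norm_nonneg z), Complex.ofReal_mul,
        Complex.ofReal_sub, hW, hW, ← integral_sub (hce _) (hce _), ← integral_mul_const]
      refine integral_congr_ae (ae_of_all _ fun ω => ?_)
      simp only
      rw [inner_add_right, Complex.ofReal_add, add_mul, Complex.exp_add]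
      ring
    simp only [h1]
    rw [integral_integral_swap]
    · rw [← integral_const_mul]
      refine integral_congr_ae (ae_of_all _ fun ω => ?_)
      simp only
      rw [integral_const_mul, integral_truncated_symbol n hs0 hε, hσ]
      push_cast
      ring
    · have hp := (integrableOn_norm_rpow_tail n hs0 hε).ofReal (𝕜 := ℂ)
      have hq := Integrable.mul_prod hp hc
      have hr := hq.bdd_mul (c := 2) (f := fun q : Euc n × Ω =>
        Complex.exp (⟪k q.2, x⟫ * Complex.I) * (1 - Complex.exp (⟪k q.2, q.1⟫ * Complex.I)))
        (Measurable.aestronglyMeasurable (by fun_prop)) (ae_of_all _ fun q => by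
          rw [norm_mul, Complex.norm_exp_ofReal_mul_I, one_mul]
          refine (norm_sub_le _ _).trans ?_
          rw [Complex.norm_exp_ofReal_mul_I, norm_one]
          norm_num)
      refine hr.congr (ae_of_all _ fun q => ?_)
      simp only [Function.uncurry]
      change _ * (((‖q.1‖ ^ (-((n : ℝ) + 2 * s)) : ℝ) : ℂ) * c q.2) = _
      ring
  have hmain : Tendsto (fun ε => ∫ ω, c ω * ((σ ε (k ω) : ℝ) : ℂ) *
      Complex.exp (⟪k ω, x⟫ * Complex.I) ∂μ) (𝓝[>] (0 : ℝ))
      (𝓝 (∫ ω, c ω * ((‖k ω‖ ^ (2 * s) : ℝ) : ℂ) * Complex.exp (⟪k ω, x⟫ * Complex.I) ∂μ)) := by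
    refine tendsto_integral_filter_of_dominated_convergence _
      (Eventually.of_forall fun ε => ?_) (Eventually.of_forall fun ε => ae_of_all _ fun ω => ?_)
      hck (ae_of_all _ fun ω => ?_)
    · refine (hc.aestronglyMeasurable.mul ?_).mul (Measurable.aestronglyMeasurable (by fun_prop))
      have hm : Measurable (σ ε) := by
        refine Measurable.const_mul ?_ _
        refine StronglyMeasurable.measurable ?_
        refine StronglyMeasurable.integral_prod_right (f := fun ξ z : Euc n =>
          (1 - Real.cos ⟪z, ξ⟫) * ‖z‖ ^ (-((n : ℝ) + 2 * s))) ?_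
        refine Measurable.stronglyMeasurable ?_
        simp only [Function.uncurry_def]
        fun_prop
      exact Measurable.aestronglyMeasurable (by fun_prop)
    · rw [norm_mul, Complex.norm_exp_ofReal_mul_I, mul_one, norm_mul, Complex.norm_real,
        Real.norm_of_nonneg (hσ0 _ _)]
      exact mul_le_mul_of_nonneg_left (hσ1 _ _) (norm_nonneg _)
    · exact (((Complex.continuous_ofReal.tendsto _).comp (hσlim (k ω))).const_mul _).mul_const _
  refine ((Complex.continuous_re.tendsto _).comp hmain).congr' ?_
  filter_upwards [self_mem_nhdsWithin] with ε hε
  rw [Function.comp_apply, ← htrunc ε hε, Complex.ofReal_re]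

/-- The point of `ℝᵐ⁺¹` with horizontal part `y` and last coordinate `t`. -/
def appendLast {m : ℕ} (y : Euc m) (t : ℝ) : Euc (m + 1) :=
  WithLp.toLp 2 (Fin.snoc (α := fun _ => ℝ) (fun i => y i) t)

/-- The horizontal part of a point of `ℝᵐ⁺¹`. -/
def horizontal {m : ℕ} (x : Euc (m + 1)) : Euc m :=
  WithLp.toLp 2 fun i => x i.castSucc

@[simp] lemma appendLast_last {m : ℕ} (y : Euc m) (t : ℝ) :
    appendLast y t (Fin.last m) = t := by
  simp [appendLast]

@[simp] lemma appendLast_castSucc {m : ℕ} (y : Euc m) (t : ℝ) (i : Fin m) :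
    appendLast y t i.castSucc = y i := by
  simp [appendLast]

@[simp] lemma horizontal_apply {m : ℕ} (x : Euc (m + 1)) (i : Fin m) :
    horizontal x i = x i.castSucc := rfl

lemma continuous_appendLast {m : ℕ} :
    Continuous fun q : Euc m × ℝ => appendLast q.1 q.2 := by
  refine (PiLp.continuous_toLp 2 _).comp (continuous_pi fun i => ?_)
  refine Fin.lastCases ?_ (fun j => ?_) i
  · simpa using continuous_snd
  · simp only [Fin.snoc_castSucc]
    fun_prop

lemma continuous_horizontal {m : ℕ} : Continuous (horizontal (m := m)) := by
  unfold horizontal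
  fun_prop

@[fun_prop]
lemma Continuous.appendLast {X : Type*} [TopologicalSpace X] {m : ℕ} {f : X → Euc m} {g : X → ℝ}
    (hf : Continuous f) (hg : Continuous g) : Continuous fun x => appendLast (f x) (g x) :=
  continuous_appendLast.comp (hf.prodMk hg)

@[fun_prop]
lemma Measurable.appendLast {X : Type*} [MeasurableSpace X] {m : ℕ} {f : X → Euc m} {g : X → ℝ}
    (hf : Measurable f) (hg : Measurable g) : Measurable fun x => appendLast (f x) (g x) :=
  continuous_appendLast.measurable.comp (hf.prodMk hg)

@[fun_prop]
lemma Measurable.horizontal {X : Type*} [MeasurableSpace X] {m : ℕ} {f : X → Euc (m + 1)}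
    (hf : Measurable f) : Measurable fun x => horizontal (f x) :=
  continuous_horizontal.measurable.comp hf

lemma inner_appendLast {m : ℕ} (k : Euc (m + 1)) (y : Euc m) (t : ℝ) :
    ⟪k, appendLast y t⟫ = ⟪y, horizontal k⟫ + k (Fin.last m) * t := by
  simp [PiLp.inner_apply, Fin.sum_univ_castSucc, mul_comm]

lemma norm_sq_eq_horizontal {m : ℕ} (x : Euc (m + 1)) :
    ‖x‖ ^ 2 = ‖horizontal x‖ ^ 2 + x (Fin.last m) ^ 2 := by
  simp [EuclideanSpace.norm_sq_eq, Fin.sum_univ_castSucc]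

/-- The symbol `|k'| - σ i kₙ` of the directional half-derivative. -/
def halfSymbol {m : ℕ} (σ : ℝ) (k : Euc (m + 1)) : ℂ :=
  (‖horizontal k‖ : ℂ) - ((σ * k (Fin.last m) : ℝ) : ℂ) * Complex.I

lemma halfSymbol_re {m : ℕ} (σ : ℝ) (k : Euc (m + 1)) :
    (halfSymbol σ k).re = ‖horizontal k‖ := by
  simp [halfSymbol]

lemma halfSymbol_im {m : ℕ} (σ : ℝ) (k : Euc (m + 1)) :
    (halfSymbol σ k).im = -(σ * k (Fin.last m)) := by
  simp [halfSymbol]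

lemma halfSymbol_re_nonneg {m : ℕ} (σ : ℝ) (k : Euc (m + 1)) : 0 ≤ (halfSymbol σ k).re := by
  rw [halfSymbol_re]; exact norm_nonneg _

lemma norm_halfSymbol {m : ℕ} {σ : ℝ} (hσ : σ ^ 2 = 1) (k : Euc (m + 1)) :
    ‖halfSymbol σ k‖ = ‖k‖ := by
  rw [← sq_eq_sq₀ (norm_nonneg _) (norm_nonneg _), ← Complex.normSq_eq_norm_sq, Complex.normSq_apply,
    halfSymbol_re, halfSymbol_im, norm_sq_eq_horizontal]
  linear_combination (k (Fin.last m)) ^ 2 * hσ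

@[fun_prop]
lemma Measurable.halfSymbol {X : Type*} [MeasurableSpace X] {m : ℕ} {σ : ℝ}
    {f : X → Euc (m + 1)} (hf : Measurable f) : Measurable fun x => halfSymbol σ (f x) := by
  unfold _root_.halfSymbol
  fun_prop

/-- The average of `W` against the Poisson kernel of height `a`, shifted by `σ a` in the last
coordinate. -/
def poissonAvg {m : ℕ} (σ : ℝ) (W : Euc (m + 1) → ℝ) (x : Euc (m + 1)) (a : ℝ) : ℝ :=
  ∫ y, W (x + appendLast (a • y) (σ * a)) ∂(poissonMeasure m)

lemma integral_planeWave_poissonMeasure {m : ℕ} (σ : ℝ) {a : ℝ} (ha : 0 ≤ a) (k x : Euc (m + 1)) :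
    ∫ y, Complex.exp (⟪k, x + appendLast (a • y) (σ * a)⟫ * Complex.I) ∂(poissonMeasure m) =
      Complex.exp (⟪k, x⟫ * Complex.I) * Complex.exp (-(a * halfSymbol σ k)) := by
  have h := charFun_poissonMeasure m (a • horizontal k)
  rw [charFun_apply, norm_smul, Real.norm_of_nonneg ha] at h
  have : ∀ y : Euc m, Complex.exp (⟪k, x + appendLast (a • y) (σ * a)⟫ * Complex.I) =
      Complex.exp (⟪k, x⟫ * Complex.I) *
        Complex.exp (((k (Fin.last m) * (σ * a) : ℝ) : ℂ) * Complex.I) *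
        Complex.exp (⟪y, a • horizontal k⟫ * Complex.I) := by
    intro y
    rw [inner_add_right, inner_appendLast, real_inner_smul_left, real_inner_smul_right,
      ← Complex.exp_add, ← Complex.exp_add]
    push_cast
    ring_nf
  simp only [this]
  rw [integral_const_mul, h, mul_assoc, Complex.ofReal_exp, ← Complex.exp_add, halfSymbol]
  push_cast
  ring_nf

lemma integrable_mul_planeWave {Ω : Type*} [MeasurableSpace Ω] {μ : Measure Ω} {n : ℕ}
    {c : Ω → ℂ} {k : Ω → Euc n} (hk : Measurable k) (hc : Integrable c μ) (x : Euc n) :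
    Integrable (fun ω => c ω * Complex.exp (⟪k ω, x⟫ * Complex.I)) μ := by
  refine hc.mul_bdd (c := 1) (Measurable.aestronglyMeasurable (by fun_prop))
    (ae_of_all _ fun ω => ?_)
  rw [Complex.norm_exp_ofReal_mul_I]

lemma continuous_integral_planeWave {Ω : Type*} [MeasurableSpace Ω] {μ : Measure Ω} {n : ℕ}
    {c : Ω → ℂ} {k : Ω → Euc n} (hk : Measurable k) (hc : Integrable c μ) :
    Continuous fun x => ∫ ω, c ω * Complex.exp (⟪k ω, x⟫ * Complex.I) ∂μ := by
  refine continuous_of_dominated (bound := fun ω => ‖c ω‖)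
    (fun x => (integrable_mul_planeWave hk hc x).aestronglyMeasurable)
    (fun x => ae_of_all _ fun ω => ?_) hc.norm (ae_of_all _ fun ω => by fun_prop)
  rw [norm_mul, Complex.norm_exp_ofReal_mul_I, mul_one]

lemma continuous_of_fourier {Ω : Type*} [MeasurableSpace Ω] {μ : Measure Ω} {n : ℕ}
    {c : Ω → ℂ} {k : Ω → Euc n} (hk : Measurable k) (hc : Integrable c μ) {W : Euc n → ℝ}
    (hW : ∀ x, (W x : ℂ) = ∫ ω, c ω * Complex.exp (⟪k ω, x⟫ * Complex.I) ∂μ) : Continuous W := by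
  have h := Complex.continuous_re.comp (continuous_integral_planeWave hk hc)
  refine h.congr fun x => ?_
  rw [Function.comp_apply, ← hW, Complex.ofReal_re]

lemma abs_le_of_fourier {Ω : Type*} [MeasurableSpace Ω] {μ : Measure Ω} {n : ℕ}
    {c : Ω → ℂ} {k : Ω → Euc n} {W : Euc n → ℝ}
    (hW : ∀ x, (W x : ℂ) = ∫ ω, c ω * Complex.exp (⟪k ω, x⟫ * Complex.I) ∂μ) (x : Euc n) :
    |W x| ≤ ∫ ω, ‖c ω‖ ∂μ := by
  rw [← Real.norm_eq_abs, ← Complex.norm_real, hW]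
  refine (norm_integral_le_integral_norm _).trans (le_of_eq ?_)
  simp only [norm_mul, Complex.norm_exp_ofReal_mul_I, mul_one]

lemma integrable_poissonMeasure_of_bounded {m : ℕ} {W : Euc (m + 1) → ℝ} (hW : Measurable W)
    {B : ℝ} (hB : ∀ x, |W x| ≤ B) (σ : ℝ) (x : Euc (m + 1)) (a : ℝ) :
    Integrable (fun y => W (x + appendLast (a • y) (σ * a))) (poissonMeasure m) := by
  refine Integrable.mono' (integrable_const B) ?_ (ae_of_all _ fun y => hB _)
  exact Measurable.aestronglyMeasurable (by fun_prop)

lemma ofReal_poissonAvg {m : ℕ} {W : Euc (m + 1) → ℝ} (hW : Measurable W) (hW0 : ∀ x, 0 ≤ W x)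
    {B : ℝ} (hB : ∀ x, |W x| ≤ B) (σ : ℝ) (x : Euc (m + 1)) (a : ℝ) :
    ENNReal.ofReal (poissonAvg σ W x a) =
      ∫⁻ y, ENNReal.ofReal (W (x + appendLast (a • y) (σ * a))) ∂(poissonMeasure m) :=
  ofReal_integral_eq_lintegral_ofReal (integrable_poissonMeasure_of_bounded hW hB σ x a)
    (ae_of_all _ fun _ => hW0 _)

lemma poissonAvg_eq_integral {Ω : Type*} [MeasurableSpace Ω] {μ : Measure Ω} [SFinite μ] {m : ℕ}
    {c : Ω → ℂ} {k : Ω → Euc (m + 1)} (hk : Measurable k) (hc : Integrable c μ)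
    {W : Euc (m + 1) → ℝ}
    (hW : ∀ x, (W x : ℂ) = ∫ ω, c ω * Complex.exp (⟪k ω, x⟫ * Complex.I) ∂μ)
    (σ : ℝ) {a : ℝ} (ha : 0 ≤ a) (x : Euc (m + 1)) :
    (poissonAvg σ W x a : ℂ) = ∫ ω, c ω * Complex.exp (⟪k ω, x⟫ * Complex.I) *
      Complex.exp (-(a * halfSymbol σ (k ω))) ∂μ := by
  rw [poissonAvg, ← integral_complex_ofReal]
  simp only [hW]
  rw [integral_integral_swap]
  · refine integral_congr_ae (ae_of_all _ fun ω => ?_)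
    simp only
    rw [integral_const_mul, integral_planeWave_poissonMeasure σ ha, mul_assoc]
  · refine (hc.comp_snd (poissonMeasure m)).mul_bdd (c := 1)
      (Measurable.aestronglyMeasurable (by fun_prop)) (ae_of_all _ fun q => ?_)
    rw [Complex.norm_exp_ofReal_mul_I]

/-- Marchaud-type formula for the power `s` of the generator of the shifted Poisson semigroup. -/
lemma integral_marchaud_poissonAvg {Ω : Type*} [MeasurableSpace Ω] {μ : Measure Ω} [SFinite μ]
    {m : ℕ} {s : ℝ} (hs0 : 0 < s) (hs1 : s < 1) {c : Ω → ℂ} {k : Ω → Euc (m + 1)}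
    (hk : Measurable k) (hc : Integrable c μ) (hck : Integrable (fun ω => ‖c ω‖ * ‖k ω‖) μ)
    {W : Euc (m + 1) → ℝ}
    (hW : ∀ x, (W x : ℂ) = ∫ ω, c ω * Complex.exp (⟪k ω, x⟫ * Complex.I) ∂μ)
    {σ : ℝ} (hσ : σ ^ 2 = 1) (x : Euc (m + 1)) :
    IntegrableOn (fun a : ℝ => a ^ (-1 - s) * (W x - poissonAvg σ W x a)) (Ioi 0) ∧
    ((∫ a in Ioi (0 : ℝ), a ^ (-1 - s) * (W x - poissonAvg σ W x a) : ℝ) : ℂ) =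
      Real.Gamma (1 - s) / s * ∫ ω, c ω * halfSymbol σ (k ω) ^ (s : ℂ) *
        Complex.exp (⟪k ω, x⟫ * Complex.I) ∂μ := by
  have hpt : ∀ a : ℝ, 0 < a → ((a ^ (-1 - s) * (W x - poissonAvg σ W x a) : ℝ) : ℂ) =
      ∫ ω, c ω * Complex.exp (⟪k ω, x⟫ * Complex.I) *
        (((a ^ (-1 - s) : ℝ) : ℂ) * (1 - Complex.exp (-(a * halfSymbol σ (k ω))))) ∂μ := by
    intro a ha
    have hi : Integrable (fun ω => c ω * Complex.exp (⟪k ω, x⟫ * Complex.I) *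
        Complex.exp (-(a * halfSymbol σ (k ω)))) μ := by
      refine (integrable_mul_planeWave hk hc x).mul_bdd (c := 1)
        (Measurable.aestronglyMeasurable (by fun_prop)) (ae_of_all _ fun ω => ?_)
      refine norm_cexp_neg_le_one ?_
      simpa using mul_nonneg ha.le (halfSymbol_re_nonneg σ (k ω))
    rw [Complex.ofReal_mul, Complex.ofReal_sub, poissonAvg_eq_integral hk hc hW σ ha.le, hW,
      ← integral_sub (integrable_mul_planeWave hk hc x) hi, ← integral_const_mul]
    refine integral_congr_ae (ae_of_all _ fun ω => ?_)
    simp only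
    ring
  have hI : Integrable (fun q : ℝ × Ω => c q.2 * Complex.exp (⟪k q.2, x⟫ * Complex.I) *
      (((q.1 ^ (-1 - s) : ℝ) : ℂ) * (1 - Complex.exp (-(q.1 * halfSymbol σ (k q.2))))))
      ((volume.restrict (Ioi (0 : ℝ))).prod μ) := by
    have hmaj := (integrableOn_marchaud_majorant hs0 hs1).mul_prod
      ((hc.norm.add hck).const_mul 2)
    refine hmaj.mono' ?_ ?_
    · refine (hc.aestronglyMeasurable.comp_snd.mul ?_).mul ?_ <;>
      exact Measurable.aestronglyMeasurable (by fun_prop)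
    · have h0 : ∀ᵐ q ∂((volume.restrict (Ioi (0 : ℝ))).prod μ), q.1 ∈ Ioi (0 : ℝ) :=
        Measure.quasiMeasurePreserving_fst.ae (ae_restrict_mem measurableSet_Ioi)
      filter_upwards [h0] with q hq
      rw [norm_mul, norm_mul, Complex.norm_exp_ofReal_mul_I, mul_one]
      have h1 := norm_marchaud_integrand_le (s := s) hq (halfSymbol_re_nonneg σ (k q.2))
      rw [norm_halfSymbol hσ] at h1
      refine (mul_le_mul_of_nonneg_left h1 (norm_nonneg _)).trans (le_of_eq ?_)
      simp only [Pi.add_apply]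
      ring
  have hleft := hI.integral_prod_left
  constructor
  · have h1 : IntegrableOn (fun a : ℝ => ((a ^ (-1 - s) * (W x - poissonAvg σ W x a) : ℝ) : ℂ))
        (Ioi 0) := by
      refine IntegrableOn.congr_fun hleft (fun a ha => ?_) measurableSet_Ioi
      exact (hpt a ha).symm
    refine h1.re.congr (ae_of_all _ fun a => ?_)
    exact Complex.ofReal_re _
  · rw [← integral_complex_ofReal, setIntegral_congr_fun measurableSet_Ioi hpt,
      integral_integral_swap hI, ← integral_const_mul]
    refine integral_congr_ae (ae_of_all _ fun ω => ?_)
    simp only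
    rw [integral_const_mul, integral_marchaud hs0 hs1 (halfSymbol_re_nonneg _ _)]
    ring

/-- The potential of order `s` of the shifted Poisson semigroup acts on a nonnegative function
as multiplication of the symbol by `halfSymbol ^ (-s)`. -/
lemma lintegral_potential_poissonMeasure {Ω : Type*} [MeasurableSpace Ω] {μ : Measure Ω}
    [SFinite μ] {m : ℕ} {s : ℝ} (hs0 : 0 < s) {c : Ω → ℂ} {k : Ω → Euc (m + 1)}
    (hk : Measurable k) (hk0 : ∀ᵐ ω ∂μ, k ω ≠ 0) (hc : Integrable c μ)
    (hck : Integrable (fun ω => ‖c ω‖ * ‖k ω‖ ^ (-s)) μ) {W : Euc (m + 1) → ℝ}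
    (hW0 : ∀ x, 0 ≤ W x)
    (hW : ∀ x, (W x : ℂ) = ∫ ω, c ω * Complex.exp (⟪k ω, x⟫ * Complex.I) ∂μ)
    {σ : ℝ} (hσ : σ ^ 2 = 1) (x : Euc (m + 1)) :
    ∃ P : ℝ, 0 ≤ P ∧ (P : ℂ) = ∫ ω, c ω * halfSymbol σ (k ω) ^ (-s : ℂ) *
        Complex.exp (⟪k ω, x⟫ * Complex.I) ∂μ ∧
      ∫⁻ a in Ioi (0 : ℝ), ENNReal.ofReal (a ^ (s - 1)) *
        ∫⁻ y, ENNReal.ofReal (W (x + appendLast (a • y) (σ * a))) ∂(poissonMeasure m) =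
        ENNReal.ofReal (Real.Gamma s * P) := by
  have hWc := continuous_of_fourier hk hc hW
  have hWB := abs_le_of_fourier (μ := μ) hW
  have hGs := Real.Gamma_pos_of_pos hs0
  have hU0 : ∀ a, 0 ≤ poissonAvg σ W x a := fun a => integral_nonneg fun y => hW0 _
  have hUm : Measurable (poissonAvg σ W x) := by
    refine StronglyMeasurable.measurable ?_
    refine StronglyMeasurable.integral_prod_right
      (f := fun (a : ℝ) y => W (x + appendLast (a • y) (σ * a))) ?_
    refine Measurable.stronglyMeasurable ?_
    have := hWc.measurable
    simp only [Function.uncurry_def]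
    fun_prop
  set η : ℕ → ℝ := fun j => 1 / ((j : ℝ) + 1) with hη
  have hη0 : ∀ j, 0 < η j := fun j => Nat.one_div_pos_of_nat
  have hηlim : Tendsto η atTop (𝓝 0) := tendsto_one_div_add_atTop_nhds_zero_nat
  have hηanti : Antitone η := fun i j hij => Nat.one_div_le_one_div hij
  -- the damped potentials
  set I : ℕ → ℝ := fun j => ∫ a in Ioi (0 : ℝ),
    a ^ (s - 1) * Real.exp (-(η j * a)) * poissonAvg σ W x a with hIdef
  have hIint : ∀ j, IntegrableOn
      (fun a => a ^ (s - 1) * Real.exp (-(η j * a)) * poissonAvg σ W x a) (Ioi 0) := by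
    intro j
    refine (integrableOn_rpow_mul_exp_neg_Ioi hs0 (hη0 j)).mul_bdd (c := ∫ ω, ‖c ω‖ ∂μ)
      hUm.aestronglyMeasurable (ae_of_all _ fun a => ?_)
    refine (norm_integral_le_of_norm_le_const (ae_of_all _ fun y => hWB _)).trans (le_of_eq ?_)
    simp
  have hIfourier : ∀ j, ((I j : ℝ) : ℂ) = Real.Gamma s * ∫ ω, c ω *
      (halfSymbol σ (k ω) + (η j : ℂ)) ^ (-s : ℂ) * Complex.exp (⟪k ω, x⟫ * Complex.I) ∂μ := by
    intro j
    rw [hIdef]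
    simp only
    rw [← integral_complex_ofReal]
    have h1 : ∀ a ∈ Ioi (0 : ℝ),
        ((a ^ (s - 1) * Real.exp (-(η j * a)) * poissonAvg σ W x a : ℝ) : ℂ) =
        ∫ ω, c ω * Complex.exp (⟪k ω, x⟫ * Complex.I) * (((a ^ (s - 1) : ℝ) : ℂ) *
          Complex.exp (-(a * (halfSymbol σ (k ω) + (η j : ℂ))))) ∂μ := by
      intro a ha
      rw [Complex.ofReal_mul, poissonAvg_eq_integral hk hc hW σ (le_of_lt ha),
        ← integral_const_mul]
      refine integral_congr_ae (ae_of_all _ fun ω => ?_)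
      simp only
      rw [mul_add, neg_add, Complex.exp_add]
      push_cast
      ring_nf
    rw [setIntegral_congr_fun measurableSet_Ioi h1, integral_integral_swap, ← integral_const_mul]
    · refine integral_congr_ae (ae_of_all _ fun ω => ?_)
      simp only
      rw [integral_const_mul, integral_rpow_mul_cexp_neg_mul_Ioi hs0]
      · ring
      · rw [Complex.add_re, Complex.ofReal_re]
        exact add_pos_of_nonneg_of_pos (halfSymbol_re_nonneg _ _) (hη0 j)
    · have hmaj := (integrableOn_rpow_mul_exp_neg_Ioi hs0 (hη0 j)).mul_prod hc.norm
      refine hmaj.mono' ?_ ?_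
      · simp only [Function.uncurry_def]
        refine (hc.aestronglyMeasurable.comp_snd.mul ?_).mul ?_ <;>
        exact Measurable.aestronglyMeasurable (by fun_prop)
      · have h0 : ∀ᵐ q ∂((volume.restrict (Ioi (0 : ℝ))).prod μ), q.1 ∈ Ioi (0 : ℝ) :=
          Measure.quasiMeasurePreserving_fst.ae (ae_restrict_mem measurableSet_Ioi)
        filter_upwards [h0] with q hq
        have hq' : (0 : ℝ) < q.1 := hq
        simp only [Function.uncurry_def]
        rw [norm_mul, norm_mul, Complex.norm_exp_ofReal_mul_I, mul_one, norm_mul,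
          Complex.norm_real, Real.norm_of_nonneg (by positivity), Complex.norm_exp, mul_comm]
        have : (-((q.1 : ℂ) * (halfSymbol σ (k q.2) + (η j : ℂ)))).re ≤ -(η j * q.1) := by
          simp only [Complex.neg_re, Complex.mul_re, Complex.ofReal_re, Complex.add_re,
            Complex.ofReal_im, zero_mul, sub_zero]
          nlinarith [mul_nonneg hq'.le (halfSymbol_re_nonneg σ (k q.2))]
        gcongr
  have hcpow : ∀ z : ℂ, ‖z ^ (-s : ℂ)‖ = ‖z‖ ^ (-s) := by
    intro z
    rw [← Complex.ofReal_neg, Complex.norm_cpow_real]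
  have hFlim : Tendsto (fun j => ∫ ω, c ω * (halfSymbol σ (k ω) + (η j : ℂ)) ^ (-s : ℂ) *
      Complex.exp (⟪k ω, x⟫ * Complex.I) ∂μ) atTop (𝓝 (∫ ω, c ω * halfSymbol σ (k ω) ^ (-s : ℂ) *
        Complex.exp (⟪k ω, x⟫ * Complex.I) ∂μ)) := by
    refine tendsto_integral_of_dominated_convergence _ (fun j => ?_) hck (fun j => ?_) ?_
    · refine (hc.aestronglyMeasurable.mul ?_).mul ?_ <;>
      exact Measurable.aestronglyMeasurable (by fun_prop)
    · filter_upwards [hk0] with ω hω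
      rw [norm_mul, norm_mul, Complex.norm_exp_ofReal_mul_I, mul_one, hcpow]
      refine mul_le_mul_of_nonneg_left ?_ (norm_nonneg _)
      refine Real.rpow_le_rpow_of_nonpos (norm_pos_iff.2 hω) ?_ (by linarith)
      rw [← norm_halfSymbol hσ, ← sq_le_sq₀ (norm_nonneg _) (norm_nonneg _),
        ← Complex.normSq_eq_norm_sq, ← Complex.normSq_eq_norm_sq, Complex.normSq_apply,
        Complex.normSq_apply]
      simp only [Complex.add_re, Complex.ofReal_re, Complex.add_im, Complex.ofReal_im, add_zero]
      nlinarith [halfSymbol_re_nonneg σ (k ω), hη0 j]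
    · filter_upwards [hk0] with ω hω
      refine Tendsto.mul_const _ (Tendsto.const_mul _ ?_)
      have hne : halfSymbol σ (k ω) ∈ Complex.slitPlane := by
        rw [Complex.mem_slitPlane_iff_not_le_zero]
        intro hle
        have h1 := (Complex.le_def.1 hle)
        have h2 : halfSymbol σ (k ω) = 0 := Complex.ext
          (le_antisymm h1.1 (halfSymbol_re_nonneg σ (k ω))) h1.2
        have h3 := norm_halfSymbol hσ (k ω)
        rw [h2, norm_zero] at h3
        exact hω (norm_eq_zero.1 h3.symm)
      have hlim2 : Tendsto (fun j => halfSymbol σ (k ω) + (η j : ℂ)) atTop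
          (𝓝 (halfSymbol σ (k ω))) := by
        simpa using ((Complex.continuous_ofReal.tendsto 0).comp hηlim).const_add
          (halfSymbol σ (k ω))
      exact ((continuousAt_id.cpow continuousAt_const hne).tendsto).comp hlim2
  set Z : ℂ := ∫ ω, c ω * halfSymbol σ (k ω) ^ (-s : ℂ) *
        Complex.exp (⟪k ω, x⟫ * Complex.I) ∂μ with hZ
  have hIlim : Tendsto (fun j => ((I j : ℝ) : ℂ)) atTop (𝓝 (Real.Gamma s * Z)) := by
    simp only [hIfourier]
    exact hFlim.const_mul _
  have hre : Tendsto I atTop (𝓝 (Real.Gamma s * Z.re)) := by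
    have := (Complex.continuous_re.tendsto _).comp hIlim
    simpa [Function.comp_def] using this
  have him : Z.im = 0 := by
    have := (Complex.continuous_im.tendsto _).comp hIlim
    have h2 : Tendsto (fun _ : ℕ => (0 : ℝ)) atTop (𝓝 (Real.Gamma s * Z.im)) := by
      simpa [Function.comp_def] using this
    have h3 := tendsto_nhds_unique h2 tendsto_const_nhds
    rcases mul_eq_zero.1 h3 with h | h
    · exact absurd h hGs.ne'
    · exact h
  have hI0 : ∀ j, 0 ≤ I j := fun j => setIntegral_nonneg measurableSet_Ioi fun a ha => by
    have : (0 : ℝ) < a := ha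
    have := hU0 a
    positivity
  have hP0 : 0 ≤ Real.Gamma s * Z.re := ge_of_tendsto' hre hI0
  refine ⟨Z.re, nonneg_of_mul_nonneg_right hP0 hGs, ?_, ?_⟩
  · exact Complex.ext (by simp) (by simp [him])
  · have hmono := lintegral_tendsto_of_tendsto_of_monotone
      (μ := volume.restrict (Ioi (0 : ℝ)))
      (f := fun j a => ENNReal.ofReal (a ^ (s - 1) * Real.exp (-(η j * a)) * poissonAvg σ W x a))
      (F := fun a => ENNReal.ofReal (a ^ (s - 1)) *
        ∫⁻ y, ENNReal.ofReal (W (x + appendLast (a • y) (σ * a))) ∂(poissonMeasure m))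
      (fun j => Measurable.aemeasurable (by fun_prop))
      (by
        filter_upwards [ae_restrict_mem measurableSet_Ioi] with a ha i j hij
        have ha' : (0 : ℝ) < a := ha
        refine ENNReal.ofReal_le_ofReal ?_
        have := hηanti hij
        have := hU0 a
        gcongr)
      (by
        filter_upwards [ae_restrict_mem measurableSet_Ioi] with a ha
        have ha' : (0 : ℝ) < a := ha
        rw [← ofReal_poissonAvg hWc.measurable hW0 hWB, ← ENNReal.ofReal_mul (by positivity)]
        refine (ENNReal.continuous_ofReal.tendsto _).comp ?_
        have h1 : Tendsto (fun j => Real.exp (-(η j * a))) atTop (𝓝 1) := by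
          have h2 : Continuous fun t : ℝ => Real.exp (-(t * a)) := by fun_prop
          simpa [Function.comp_def] using (h2.tendsto 0).comp hηlim
        simpa using (h1.const_mul (a ^ (s - 1))).mul_const (poissonAvg σ W x a))
    refine tendsto_nhds_unique hmono ?_
    refine ((ENNReal.continuous_ofReal.tendsto _).comp hre).congr fun j => ?_
    rw [Function.comp_apply, hIdef]
    refine ofReal_integral_eq_lintegral_ofReal (hIint j) ?_
    filter_upwards [ae_restrict_mem measurableSet_Ioi] with a ha
    have : (0 : ℝ) < a := ha
    have := hU0 a
    simp only [Pi.zero_apply]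
    positivity

lemma setLIntegral_eq_lintegral_indicator_mul {α : Type*} [MeasurableSpace α] {μ : Measure α}
    {S : Set α} (hS : MeasurableSet S) (f : α → ℝ≥0∞) :
    ∫⁻ a in S, f a ∂μ = ∫⁻ a, S.indicator 1 a * f a ∂μ := by
  rw [← lintegral_indicator hS]
  refine lintegral_congr fun a => ?_
  by_cases ha : a ∈ S <;> simp [ha]

lemma lintegral_eq_lintegral_appendLast {m : ℕ} {Φ : Euc (m + 1) → ℝ≥0∞} (hΦ : Measurable Φ) :
    ∫⁻ y, Φ y = ∫⁻ t : ℝ, ∫⁻ w : Euc m, Φ (appendLast w t) := by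
  have h1 := (PiLp.volume_preserving_toLp (Fin (m + 1))).lintegral_comp hΦ
  have h2 := (volume_preserving_piFinSuccAbove (fun _ : Fin (m + 1) => ℝ)
    (Fin.last m)).symm.lintegral_comp
    (f := fun z : Fin (m + 1) → ℝ => Φ (WithLp.toLp 2 z)) (by fun_prop)
  rw [← h1, ← h2, Measure.volume_eq_prod, lintegral_prod _ (Measurable.aemeasurable (by fun_prop))]
  refine lintegral_congr fun t => ?_
  rw [← (PiLp.volume_preserving_toLp (Fin m)).lintegral_comp (by fun_prop)]
  refine lintegral_congr fun w => ?_
  congr 1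
  simp only [appendLast, MeasurableEquiv.piFinSuccAbove_symm_apply]
  exact congrArg _ (Fin.insertNth_last' t _)

/-- The scaled Poisson kernel. -/
lemma lintegral_smul_poissonMeasure {m : ℕ} {r : ℝ} (hr : 0 < r) {F : Euc m → ℝ≥0∞}
    (hF : Measurable F) :
    ∫⁻ z, F (r • z) ∂(poissonMeasure m) = ∫⁻ w, F w *
      ENNReal.ofReal (Real.Gamma (((m : ℝ) + 1) / 2) / Real.pi ^ (((m : ℝ) + 1) / 2) *
        (r * (r ^ 2 + ‖w‖ ^ 2) ^ (-((m : ℝ) + 1) / 2))) := by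
  have hρ := measurable_poissonDensity m
  have hsm : Measurable fun z : Euc m => r • z := by fun_prop
  rw [poissonMeasure, lintegral_withDensity_eq_lintegral_mul _ (by fun_prop) (by fun_prop)]
  have h1 : ∀ z : Euc m, ((fun y => ENNReal.ofReal (poissonDensity m y)) * fun z => F (r • z)) z =
      (fun w => ENNReal.ofReal (poissonDensity m (r⁻¹ • w)) * F w) (r • z) := by
    intro z
    simp [smul_smul, inv_mul_cancel₀ hr.ne']
  simp only [h1]
  rw [← lintegral_map (f := fun w => ENNReal.ofReal (poissonDensity m (r⁻¹ • w)) * F w)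
    (by fun_prop) hsm, Measure.map_addHaar_smul _ hr.ne', lintegral_smul_measure,
    smul_eq_mul, ← lintegral_const_mul _ (by fun_prop)]
  refine lintegral_congr fun w => ?_
  rw [← mul_assoc, ← ENNReal.ofReal_mul (abs_nonneg _), mul_comm]
  congr 2
  rw [finrank_euclideanSpace_fin, abs_of_nonneg (by positivity), poissonDensity, norm_smul,
    Real.norm_of_nonneg (by positivity)]
  have h2 : 1 + (r⁻¹ * ‖w‖) ^ 2 = (r ^ 2 + ‖w‖ ^ 2) / r ^ 2 := by field_simp
  have h3 : (r ^ 2) ^ (-((m : ℝ) + 1) / 2) = (r ^ m)⁻¹ * r⁻¹ := by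
    rw [← Real.rpow_natCast, ← Real.rpow_mul hr.le, ← Real.rpow_natCast, ← Real.rpow_neg hr.le,
      ← Real.rpow_neg_one, ← Real.rpow_add hr]
    congr 1
    push_cast
    ring
  rw [h2, Real.div_rpow (by positivity) (by positivity), h3]
  have : r ^ m ≠ 0 := by positivity
  field_simp

lemma image_green_subst {X t D : ℝ} (hX : 0 < X) (hXt : 0 < X + t) (hD : 0 < D) :
    (fun a : ℝ => 4 * a * (a + t) / D) '' Ioo (max 0 (-t)) X = Ioo 0 (4 * X * (X + t) / D) := by
  ext u
  constructor
  · rintro ⟨a, ⟨ha1, ha2⟩, rfl⟩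
    obtain ⟨h0, h1⟩ := max_lt_iff.1 ha1
    have h2 : 0 < a + t := by linarith
    refine ⟨by positivity, ?_⟩
    simp only
    gcongr
  · rintro ⟨hu0, hu1⟩
    rw [lt_div_iff₀ hD] at hu1
    have hpos : 0 < u * D := by positivity
    set q := √(t ^ 2 + u * D) with hq
    have hq2 : q ^ 2 = t ^ 2 + u * D := Real.sq_sqrt (by positivity)
    have hq0 : 0 ≤ q := Real.sqrt_nonneg _
    have h1 : |t| < q := by
      refine abs_lt_of_sq_lt_sq ?_ hq0
      linarith
    obtain ⟨h2, h3⟩ := abs_lt.1 h1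
    refine ⟨(q - t) / 2, ⟨max_lt (by linarith) (by linarith), ?_⟩, ?_⟩
    · have : q < 2 * X + t := by
        refine lt_of_pow_lt_pow_left₀ 2 (by linarith) ?_
        nlinarith
      linarith
    · simp only
      rw [div_eq_iff hD.ne']
      nlinarith

lemma lintegral_green_subst {m : ℕ} {s X t R d : ℝ} (hX : 0 < X) (hXt : 0 < X + t)
    (hR : 0 ≤ R) (hd : 0 < d) (hdR : d ^ 2 = R + t ^ 2) :
    ∫⁻ a in Ioo (max 0 (-t)) X, ENNReal.ofReal ((a * (t + a)) ^ (s - 1) *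
      ((a + (t + a)) * ((a + (t + a)) ^ 2 + R) ^ (-((m : ℝ) + 1) / 2))) =
    ENNReal.ofReal (4 ^ (-s) * d ^ (2 * s - ((m : ℝ) + 1))) *
      ∫⁻ u in Ioo 0 (4 * X * (X + t) / d ^ 2),
        ENNReal.ofReal (u ^ (s - 1) * (1 + u) ^ (-((m : ℝ) + 1) / 2)) := by
  have hd2 : 0 < d ^ 2 := by positivity
  rw [← image_green_subst hX hXt hd2, lintegral_image_eq_lintegral_abs_deriv_mul measurableSet_Ioo
    (f' := fun a => 4 * (2 * a + t) / d ^ 2), ← lintegral_const_mul _ (by fun_prop)]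
  · refine setLIntegral_congr_fun measurableSet_Ioo fun a ha => ?_
    obtain ⟨h0, h1⟩ := max_lt_iff.1 ha.1
    have h2 : 0 < a + t := by linarith
    have h3 : 0 < 2 * a + t := by linarith
    rw [← ENNReal.ofReal_mul (abs_nonneg _), ← ENNReal.ofReal_mul (by positivity),
      abs_of_nonneg (by positivity)]
    congr 1
    have e1 : 1 + 4 * a * (a + t) / d ^ 2 = ((a + (t + a)) ^ 2 + R) / d ^ 2 := by
      rw [eq_div_iff hd2.ne', add_mul, div_mul_cancel₀ _ hd2.ne', one_mul, hdR]
      ring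
    have e2 : 4 * a * (a + t) = 4 * (a * (t + a)) := by ring
    rw [e1, e2]
    have hP : 0 < a * (t + a) := by rw [add_comm t]; positivity
    have hS : 0 < a + (t + a) := by linarith
    have hS2 : 2 * a + t = a + (t + a) := by ring
    rw [hS2]
    generalize a * (t + a) = P at hP
    generalize a + (t + a) = S at hS
    rw [Real.div_rpow (by positivity) hd2.le, Real.div_rpow (by positivity) hd2.le,
      Real.mul_rpow (by norm_num) hP.le]
    have e3 : (4 : ℝ) ^ (-s) * 4 * 4 ^ (s - 1) = 1 := by
      rw [← Real.rpow_add_one (by norm_num), ← Real.rpow_add (by norm_num)]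
      norm_num
    have e4 : d ^ (2 * s - ((m : ℝ) + 1)) / d ^ 2 / (d ^ 2) ^ (s - 1) /
        (d ^ 2) ^ (-((m : ℝ) + 1) / 2) = 1 := by
      rw [← Real.rpow_natCast d 2, ← Real.rpow_mul hd.le, ← Real.rpow_mul hd.le,
        ← Real.rpow_sub hd, ← Real.rpow_sub hd, ← Real.rpow_sub hd]
      convert! Real.rpow_zero d using 2
      push_cast
      ring
    calc _ = (4 ^ (-s) * 4 * 4 ^ (s - 1)) * (d ^ (2 * s - ((m : ℝ) + 1)) / d ^ 2 /
          (d ^ 2) ^ (s - 1) / (d ^ 2) ^ (-((m : ℝ) + 1) / 2)) * (P ^ (s - 1) *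
          (S * (S ^ 2 + R) ^ (-((m : ℝ) + 1) / 2))) := by
            rw [e3, e4]; ring
      _ = _ := by ring
  · intro a _
    have h := (((hasDerivAt_id a).const_mul 4).mul ((hasDerivAt_id a).add_const t)).div_const (d ^ 2)
    refine HasDerivAt.hasDerivWithinAt ?_
    convert! h using 1
    simp only [id]
    ring
  · intro a ha b hb hab
    obtain ⟨h0, h1⟩ := max_lt_iff.1 ha.1
    obtain ⟨h2, h3⟩ := max_lt_iff.1 hb.1
    simp only at hab
    rw [div_left_inj' hd2.ne'] at hab
    have : (a - b) * (a + b + t) = 0 := by linarith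
    rcases mul_eq_zero.1 this with h | h
    · linarith
    · linarith

lemma ofReal_greenHalf_appendLast {m : ℕ} {s : ℝ} (hs0 : 0 < s) {x : Euc (m + 1)} {w : Euc m}
    {t : ℝ} (hd : 0 < ‖appendLast w t‖) :
    ENNReal.ofReal (greenHalf m s (greenC (m + 1) s) x (x + appendLast w t)) =
      ENNReal.ofReal (greenC (m + 1) s * ‖appendLast w t‖ ^ (2 * s - ((m : ℝ) + 1))) *
        ∫⁻ u in Ioo 0 (4 * x (Fin.last m) * (x (Fin.last m) + t) / ‖appendLast w t‖ ^ 2),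
          ENNReal.ofReal (u ^ (s - 1) * (1 + u) ^ (-((m : ℝ) + 1) / 2)) := by
  have hC : 0 ≤ greenC (m + 1) s := by
    have h1 := Real.Gamma_pos_of_pos hs0
    have h2 := Real.Gamma_pos_of_pos (s := ((m + 1 : ℕ) : ℝ) / 2) (by positivity)
    unfold greenC
    positivity
  rw [greenHalf, dist_self_add_right, ENNReal.ofReal_mul (by positivity)]
  congr 1
  rw [PiLp.add_apply, appendLast_last]
  refine ofReal_integral_eq_lintegral_ofReal ?_ ?_
  · set M := 4 * x (Fin.last m) * (x (Fin.last m) + t) / ‖appendLast w t‖ ^ 2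
    rcases le_or_gt M 0 with hM | hM
    · rw [Ioo_eq_empty (not_lt.2 hM)]; simp
    have h1 : IntegrableOn (fun u : ℝ => u ^ (s - 1)) (Ioo 0 M) := by
      have : IntegrableOn (fun u : ℝ => u ^ (s - 1)) (Ioc 0 M) := by
        rw [← intervalIntegrable_iff_integrableOn_Ioc_of_le hM.le]
        exact intervalIntegral.intervalIntegrable_rpow' (by linarith)
      exact this.mono_set Ioo_subset_Ioc_self
    refine Integrable.mul_bdd (c := 1) h1 (Measurable.aestronglyMeasurable (by fun_prop)) ?_
    filter_upwards [ae_restrict_mem measurableSet_Ioo] with u hu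
    have hu0 : 0 < u := hu.1
    rw [Real.norm_of_nonneg (by positivity)]
    refine Real.rpow_le_one_of_one_le_of_nonpos (by linarith) ?_
    have : (0 : ℝ) ≤ m := Nat.cast_nonneg m
    linarith
  · filter_upwards [ae_restrict_mem measurableSet_Ioo] with u hu
    have hu0 : 0 < u := hu.1
    simp only [Pi.zero_apply]
    positivity

/-- The factorization of the half-space Green potential through the shifted Poisson semigroups
in the two normal directions. -/
lemma lintegral_greenHalf_eq {m : ℕ} {s : ℝ} (hs0 : 0 < s) {x : Euc (m + 1)}
    (hx : 0 < x (Fin.last m)) {F : Euc (m + 1) → ℝ≥0∞} (hF : Measurable F) :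
    ∫⁻ y in {y : Euc (m + 1) | 0 < y (Fin.last m)},
      ENNReal.ofReal (greenHalf m s (greenC (m + 1) s) x y) * F y =
    ENNReal.ofReal ((Real.Gamma s ^ 2)⁻¹) * ∫⁻ a in Ioo 0 (x (Fin.last m)), ∫⁻ b in Ioi (0 : ℝ),
      ENNReal.ofReal ((a * b) ^ (s - 1)) *
        ∫⁻ z, F (x + appendLast ((a + b) • z) (b - a)) ∂(poissonMeasure m) := by
  set X := x (Fin.last m) with hXdef
  set C := Real.Gamma (((m : ℝ) + 1) / 2) / Real.pi ^ (((m : ℝ) + 1) / 2) with hCdef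
  have hC0 : 0 ≤ C := by
    have h2 := Real.Gamma_pos_of_pos (s := ((m : ℝ) + 1) / 2) (by positivity)
    positivity
  have hGs := Real.Gamma_pos_of_pos hs0
  set p : ℝ → ℝ≥0∞ := (Ioo 0 X).indicator 1 with hp
  set q : ℝ → ℝ≥0∞ := (Ioi 0).indicator 1 with hq
  have hpm : Measurable p := measurable_one.indicator measurableSet_Ioo
  have hqm : Measurable q := measurable_one.indicator measurableSet_Ioi
  set κ : ℝ → Euc m → ℝ≥0∞ := fun r w =>
    ENNReal.ofReal (C * (r * (r ^ 2 + ‖w‖ ^ 2) ^ (-((m : ℝ) + 1) / 2))) with hκ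
  have hright : ∫⁻ a in Ioo 0 X, ∫⁻ b in Ioi (0 : ℝ), ENNReal.ofReal ((a * b) ^ (s - 1)) *
        ∫⁻ z, F (x + appendLast ((a + b) • z) (b - a)) ∂(poissonMeasure m) =
      ∫⁻ t : ℝ, ∫⁻ w : Euc m, ∫⁻ a : ℝ, p a * (q (t + a) * (ENNReal.ofReal ((a * (t + a)) ^ (s - 1)) *
        (F (x + appendLast w t) * κ (a + (t + a)) w))) := by
    calc _ = ∫⁻ a : ℝ, ∫⁻ t : ℝ, ∫⁻ w : Euc m, p a * (q (t + a) *
          (ENNReal.ofReal ((a * (t + a)) ^ (s - 1)) *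
            (F (x + appendLast w t) * κ (a + (t + a)) w))) := by
          rw [setLIntegral_eq_lintegral_indicator_mul measurableSet_Ioo]
          refine lintegral_congr fun a => ?_
          change p a * _ = _
          by_cases ha : a ∈ Ioo 0 X
          swap
          · simp [hp, ha]
          rw [setLIntegral_eq_lintegral_indicator_mul measurableSet_Ioi,
            ← lintegral_add_right_eq_self _ a, ← lintegral_const_mul']
          · refine lintegral_congr fun t => ?_
            change p a * (q (t + a) * _) = _
            by_cases ht : t + a ∈ Ioi 0
            swap
            · simp [hq, ht]
            have hpos : 0 < a + (t + a) := add_pos ha.1 ht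
            rw [lintegral_smul_poissonMeasure hpos
              (F := fun w => F (x + appendLast w (t + a - a))) (by fun_prop),
              add_sub_cancel_right, ← lintegral_const_mul _ (by fun_prop),
              ← lintegral_const_mul _ (by fun_prop), ← lintegral_const_mul _ (by fun_prop)]
          · simp [hp, ha]
      _ = ∫⁻ t : ℝ, ∫⁻ a : ℝ, ∫⁻ w : Euc m, p a * (q (t + a) *
          (ENNReal.ofReal ((a * (t + a)) ^ (s - 1)) *
            (F (x + appendLast w t) * κ (a + (t + a)) w))) := by
          refine lintegral_lintegral_swap (Measurable.aemeasurable ?_)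
          refine Measurable.lintegral_prod_right' (f := fun z : (ℝ × ℝ) × Euc m =>
            p z.1.1 * (q (z.1.2 + z.1.1) * (ENNReal.ofReal ((z.1.1 * (z.1.2 + z.1.1)) ^ (s - 1)) *
            (F (x + appendLast z.2 z.1.2) * κ (z.1.1 + (z.1.2 + z.1.1)) z.2)))) ?_
          fun_prop
      _ = _ := by
          refine lintegral_congr fun t => ?_
          refine lintegral_lintegral_swap (Measurable.aemeasurable ?_)
          simp only [Function.uncurry_def]
          fun_prop
  have hgm : Measurable fun y : Euc (m + 1) => greenHalf m s (greenC (m + 1) s) x y := by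
    unfold greenHalf
    refine Measurable.mul (by fun_prop) ?_
    have hmeas : MeasurableSet {z : Euc (m + 1) × ℝ |
        z.2 ∈ Ioo (0 : ℝ) (4 * x (Fin.last m) * z.1 (Fin.last m) / dist x z.1 ^ 2)} := by
      simp only [mem_Ioo, ofPred_and]
      exact (measurableSet_lt measurable_const measurable_snd).inter
        (measurableSet_lt measurable_snd (by fun_prop))
    have h1 := ((Measurable.stronglyMeasurable (f := fun z : Euc (m + 1) × ℝ =>
      z.2 ^ (s - 1) * (1 + z.2) ^ (-((m : ℝ) + 1) / 2)) (by fun_prop)).indicator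
        hmeas).integral_prod_right' (ν := volume)
    convert! h1.measurable using 2 with y
    rw [← integral_indicator measurableSet_Ioo]
    rfl
  have hH : MeasurableSet {y : Euc (m + 1) | 0 < y (Fin.last m)} :=
    measurableSet_lt measurable_const (by fun_prop)
  rw [hright, setLIntegral_eq_lintegral_indicator_mul hH, ← lintegral_add_left_eq_self _ x]
  have hind : Measurable ({y : Euc (m + 1) | 0 < y (Fin.last m)}.indicator
    (1 : Euc (m + 1) → ℝ≥0∞)) := measurable_one.indicator hH
  rw [lintegral_eq_lintegral_appendLast (by fun_prop), ← lintegral_const_mul _ ?_]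
  swap
  · refine Measurable.lintegral_prod_right' (f := fun z : ℝ × Euc m => ∫⁻ a : ℝ, p a *
      (q (z.1 + a) * (ENNReal.ofReal ((a * (z.1 + a)) ^ (s - 1)) *
        (F (x + appendLast z.2 z.1) * κ (a + (z.1 + a)) z.2)))) ?_
    refine Measurable.lintegral_prod_right' (f := fun z : (ℝ × Euc m) × ℝ => p z.2 *
      (q (z.1.1 + z.2) * (ENNReal.ofReal ((z.2 * (z.1.1 + z.2)) ^ (s - 1)) *
        (F (x + appendLast z.1.2 z.1.1) * κ (z.2 + (z.1.1 + z.2)) z.1.2)))) ?_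
    fun_prop
  have hae : ∀ᵐ t : ℝ, t ≠ 0 := Measure.ae_ne volume 0
  refine lintegral_congr_ae ?_
  filter_upwards [hae] with t ht
  rw [← lintegral_const_mul _ ?_]
  swap
  · refine Measurable.lintegral_prod_right' (f := fun z : Euc m × ℝ => p z.2 *
      (q (t + z.2) * (ENNReal.ofReal ((z.2 * (t + z.2)) ^ (s - 1)) *
        (F (x + appendLast z.1 t) * κ (z.2 + (t + z.2)) z.1)))) ?_
    fun_prop
  refine lintegral_congr fun w => ?_
  have hnsq : ‖appendLast w t‖ ^ 2 = ‖w‖ ^ 2 + t ^ 2 := by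
    rw [norm_sq_eq_horizontal, appendLast_last]
    congr 3
    ext i
    simp
  have hd : 0 < ‖appendLast w t‖ := by
    have h1 : 0 < ‖appendLast w t‖ ^ 2 := by rw [hnsq]; positivity
    exact (norm_nonneg _).lt_of_ne' fun h => by simp [h] at h1
  have hinner : ∫⁻ a : ℝ, p a * (q (t + a) * (ENNReal.ofReal ((a * (t + a)) ^ (s - 1)) *
        (F (x + appendLast w t) * κ (a + (t + a)) w))) =
      (F (x + appendLast w t) * ENNReal.ofReal C) * ∫⁻ a in Ioo (max 0 (-t)) X,
        ENNReal.ofReal ((a * (t + a)) ^ (s - 1) *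
          ((a + (t + a)) * ((a + (t + a)) ^ 2 + ‖w‖ ^ 2) ^ (-((m : ℝ) + 1) / 2))) := by
    rw [← lintegral_const_mul _ (by fun_prop),
      setLIntegral_eq_lintegral_indicator_mul measurableSet_Ioo]
    refine lintegral_congr fun a => ?_
    by_cases ha : a ∈ Ioo (max 0 (-t)) X
    · obtain ⟨h0, h1⟩ := max_lt_iff.1 ha.1
      have h2 : 0 < t + a := by linarith
      have e1 : p a = 1 := by simp [hp, h0, ha.2]
      have e2 : q (t + a) = 1 := by simp [hq, h2]
      rw [e1, e2, indicator_of_mem ha, hκ]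
      simp only [Pi.one_apply, one_mul]
      rw [ENNReal.ofReal_mul hC0, ENNReal.ofReal_mul (p := (a * (t + a)) ^ (s - 1)) (by positivity)]
      ring
    · rw [indicator_of_notMem ha, zero_mul]
      by_cases h1 : a ∈ Ioo 0 X
      · have : t + a ∉ Ioi 0 := by
          intro h2
          have h2' : 0 < t + a := h2
          exact ha ⟨max_lt h1.1 (by linarith), h1.2⟩
        simp [hq, this]
      · simp [hp, h1]
  rw [hinner]
  by_cases hXt : 0 < X + t
  · have e1 : {y : Euc (m + 1) | 0 < y (Fin.last m)}.indicator (1 : Euc (m + 1) → ℝ≥0∞)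
        (x + appendLast w t) = 1 := by
      rw [indicator_of_mem]
      · rfl
      · simpa using hXt
    rw [e1, one_mul, ofReal_greenHalf_appendLast hs0 hd,
      lintegral_green_subst hx hXt (sq_nonneg ‖w‖) hd hnsq]
    have e2 : greenC (m + 1) s * ‖appendLast w t‖ ^ (2 * s - ((m : ℝ) + 1)) =
        (Real.Gamma s ^ 2)⁻¹ * (C * (4 ^ (-s) * ‖appendLast w t‖ ^ (2 * s - ((m : ℝ) + 1)))) := by
      rw [greenC, hCdef, Real.rpow_neg (by norm_num)]
      push_cast
      field_simp
    rw [e2, ENNReal.ofReal_mul (by positivity), ENNReal.ofReal_mul hC0]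
    ring
  · have e1 : {y : Euc (m + 1) | 0 < y (Fin.last m)}.indicator (1 : Euc (m + 1) → ℝ≥0∞)
        (x + appendLast w t) = 0 := by
      rw [indicator_of_notMem]
      simpa using hXt
    have e2 : Ioo (max 0 (-t)) X = ∅ := by
      refine Ioo_eq_empty fun h => hXt ?_
      have := (le_max_right 0 (-t)).trans_lt h
      linarith
    rw [e1, e2]
    simp

lemma integrableOn_div_dist_rpow {n : ℕ} {s ε B : ℝ} (hs0 : 0 < s) (hε : 0 < ε) (x : Euc n)
    {φ : Euc n → ℝ} (hφ : AEStronglyMeasurable φ) (hB : ∀ y, |φ y| ≤ B) :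
    IntegrableOn (fun y => φ y / dist x y ^ ((n : ℝ) + 2 * s)) {y | ε ≤ dist x y} := by
  have h1 : IntegrableOn (fun y => dist x y ^ (-((n : ℝ) + 2 * s))) {y | ε ≤ dist x y} := by
    rw [← (measurePreserving_add_left volume x).integrableOn_comp_preimage
      (measurableEmbedding_addLeft x)]
    convert! integrableOn_norm_rpow_tail n hs0 hε using 2
    · simp
    · ext z; simp
  refine (h1.bdd_mul (c := B) hφ.restrict (ae_of_all _ fun y => hB y)).congr
    (ae_of_all _ fun y => ?_)
  simp only [Real.rpow_neg dist_nonneg, div_eq_mul_inv]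

/-- Comparison principle on the half-space for the pointwise fractional Laplacian. -/
lemma le_of_hasFracLapAt_le {m : ℕ} {s δ B Bw : ℝ} (hs0 : 0 < s) (hs1 : s < 1)
    {v w f : Euc (m + 1) → ℝ} (hvc : ContinuousOn v {x : Euc (m + 1) | 0 < x (Fin.last m)})
    (hvm : AEStronglyMeasurable v) (hv0 : ∀ x, 0 ≤ v x) (hvB : ∀ x, v x ≤ B)
    (hv00 : ∀ x : Euc (m + 1), ¬ 0 < x (Fin.last m) → v x = 0)
    (hwc : Continuous w) (hBw : ∀ x, |w x| ≤ Bw) (hδ : 0 < δ) (hwδ : ∀ x : Euc (m + 1), x (Fin.last m) ≤ δ → w x = 0)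
    (hw0 : Tendsto w (cocompact _) (𝓝 0))
    (hvL : ∀ x : Euc (m + 1), 0 < x (Fin.last m) → HasFracLapAt (m + 1) s v x (f x))
    (hwL : ∀ x : Euc (m + 1), 0 < x (Fin.last m) → ∃ g ≤ f x, HasFracLapAt (m + 1) s w x g)
    (x : Euc (m + 1)) : w x ≤ v x := by
  by_contra! hlt
  set η := w x - v x with hη
  have hη0 : 0 < η := by linarith
  obtain ⟨t, ht, htw⟩ := mem_cocompact.1 (hw0.eventually_lt_const hη0)
  set S := {y | η ≤ w y} with hS
  have hSc : IsCompact S := by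
    refine ht.of_isClosed_subset (isClosed_le continuous_const hwc) fun y hy => ?_
    by_contra hyt
    have h1 : w y < η := htw hyt
    exact h1.not_ge hy
  have hSH : S ⊆ {x : Euc (m + 1) | 0 < x (Fin.last m)} := by
    intro y hy
    by_contra h
    have : w y = 0 := hwδ y ((not_lt.1 fun h' => h h').trans hδ.le)
    have h2 : η ≤ w y := hy
    linarith
  have hxS : x ∈ S := by
    have := hv0 x
    change η ≤ w x
    linarith
  obtain ⟨z, hzS, hz⟩ := hSc.exists_isMaxOn ⟨x, hxS⟩ (hwc.continuousOn.sub (hvc.mono hSH))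
  have hzH := hSH hzS
  set d := w z - v z with hd
  have hdη : η ≤ d := hz hxS
  have hd0 : 0 < d := by linarith
  have hmax : ∀ y, w y - v y ≤ d := by
    intro y
    by_cases hy : y ∈ S
    · exact hz hy
    · have h1 : w y < η := not_le.1 hy
      have := hv0 y
      linarith
  set N : ℝ := ((m + 1 : ℕ) : ℝ) + 2 * s with hN
  have hN0 : 0 < N := by positivity
  obtain ⟨g, hgf, hg⟩ := hwL z hzH
  have hlim := hg.sub (hvL z hzH)
  have hbv : ∀ y, |v z - v y| ≤ B := fun y => by
    rw [abs_le]
    have h1 := hv0 z; have h2 := hv0 y; have h3 := hvB z; have h4 := hvB y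
    constructor <;> linarith
  have hbw : ∀ y, |w z - w y| ≤ Bw + Bw := fun y =>
    (abs_sub _ _).trans (add_le_add (hBw z) (hBw y))
  have hiv : ∀ ε, 0 < ε → IntegrableOn (fun y => (v z - v y) / dist z y ^ N) {y | ε ≤ dist z y} :=
    fun ε hε => integrableOn_div_dist_rpow hs0 hε z (aestronglyMeasurable_const.sub hvm) hbv
  have hiw : ∀ ε, 0 < ε → IntegrableOn (fun y => (w z - w y) / dist z y ^ N) {y | ε ≤ dist z y} :=
    fun ε hε => integrableOn_div_dist_rpow hs0 hε z
      (aestronglyMeasurable_const.sub hwc.aestronglyMeasurable) hbw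
  set c : Euc (m + 1) := EuclideanSpace.single (Fin.last m) (-2) with hc
  have hball : ∀ y ∈ ball c 1, 1 ≤ dist z y ∧ ¬ 0 < y (Fin.last m) ∧ dist z y ≤ dist z c + 1 := by
    intro y hy
    have hy1 : dist y c < 1 := hy
    have h1 : |y (Fin.last m) - c (Fin.last m)| < 1 := by
      rw [dist_eq_norm] at hy1
      exact (PiLp.norm_apply_le (y - c) (Fin.last m)).trans_lt hy1
    have h2 : c (Fin.last m) = -2 := by simp [hc]
    rw [h2] at h1
    have h3 := abs_lt.1 h1
    have h4 : |z (Fin.last m) - y (Fin.last m)| ≤ dist z y := by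
      rw [dist_eq_norm]
      exact PiLp.norm_apply_le (z - y) (Fin.last m)
    have h5 : 0 < z (Fin.last m) := hzH
    refine ⟨?_, by linarith, ?_⟩
    · have := le_abs_self (z (Fin.last m) - y (Fin.last m))
      linarith
    · have := dist_triangle z c y
      rw [dist_comm] at hy1
      linarith
  set κ := volume.real (ball c 1) * (d / (dist z c + 1) ^ N) with hκ
  have hκ0 : 0 < κ := by
    have h1 : 0 < volume.real (ball c 1) :=
      ENNReal.toReal_pos (measure_ball_pos _ _ one_pos).ne' measure_ball_lt_top.ne
    have h2 : 0 < dist z c + 1 := by positivity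
    positivity
  have hfr := fracC_pos (m + 1) hs0 hs1
  have hge : fracC (m + 1) s * κ ≤ g - f z := by
    refine ge_of_tendsto hlim ?_
    have : ∀ᶠ ε : ℝ in 𝓝[>] 0, ε ∈ Ioo (0 : ℝ) 1 := Ioo_mem_nhdsGT one_pos
    filter_upwards [this] with ε hε
    rw [← mul_sub, ← integral_sub (hiw ε hε.1) (hiv ε hε.1)]
    refine mul_le_mul_of_nonneg_left ?_ hfr.le
    have hsub : ball c 1 ⊆ {y | ε ≤ dist z y} := fun y hy => hε.2.le.trans (hball y hy).1
    have hint := (hiw ε hε.1).sub (hiv ε hε.1)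
    refine le_trans ?_ (setIntegral_mono_set hint (ae_of_all _ fun y => ?_) hsub.eventuallyLE)
    · rw [hκ, ← smul_eq_mul, ← setIntegral_const]
      refine setIntegral_mono_on (integrableOn_const measure_ball_lt_top.ne) (hint.mono_set hsub)
        measurableSet_ball fun y hy => ?_
      obtain ⟨h1, h2, h3⟩ := hball y hy
      have h4 : v y = 0 := hv00 y h2
      have h5 : w y = 0 := hwδ y (by linarith [not_lt.1 h2])
      rw [← sub_div, h4, h5, sub_zero, sub_zero]
      have h6 : 0 < dist z y := by linarith
      exact div_le_div_of_nonneg_left hd0.le (by positivity) (by gcongr)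
    · simp only [Pi.zero_apply]
      rw [← sub_div]
      have := hmax y
      exact div_nonneg (by linarith) (by positivity)
  have : 0 < fracC (m + 1) s * κ := by positivity
  linarith

open scoped Manifold ContDiff in
/-- A nonnegative continuous function can be approximated from below, uniformly, by nonnegative
smooth functions. -/
lemma exists_smooth_between {n : ℕ} {φ : Euc n → ℝ} (hφ : Continuous φ) (hφ0 : ∀ x, 0 ≤ φ x)
    {ε : ℝ} (hε : 0 < ε) :
    ∃ h : Euc n → ℝ, ContDiff ℝ ∞ h ∧ ∀ x, 0 ≤ h x ∧ φ x - ε ≤ h x ∧ h x ≤ φ x := by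
  obtain ⟨g, hg⟩ := exists_contMDiffMap_forall_mem_convex_of_local_const (n := ⊤) 𝓘(ℝ, Euc n)
    (t := fun x => Icc (max (φ x - ε) 0) (φ x)) (fun x => convex_Icc _ _) (by
      intro x
      by_cases hx : φ x < ε
      · refine ⟨0, ?_⟩
        filter_upwards [hφ.continuousAt.eventually_lt_const hx] with y hy
        exact ⟨max_le (by linarith) le_rfl, hφ0 y⟩
      · refine ⟨φ x - ε / 2, ?_⟩
        have h1 := hφ.continuousAt (x := x).eventually_lt_const (show φ x < φ x + ε / 2 by linarith)
        have h2 := hφ.continuousAt (x := x).eventually_const_lt (show φ x - ε / 2 < φ x by linarith)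
        filter_upwards [h1, h2] with y hy1 hy2
        exact ⟨max_le (by linarith) (by linarith), hy2.le⟩)
  refine ⟨g, g.contMDiff.contDiff, fun x => ?_⟩
  obtain ⟨h1, h2⟩ := hg x
  exact ⟨(le_max_right _ _).trans h1, (le_max_left _ _).trans h1, h2⟩

/-- A continuous cutoff to the part of the upper half-space inside a ball. -/
def halfCutoff {m : ℕ} (j : ℕ) (x : Euc (m + 1)) : ℝ :=
  max 0 (min 1 (min ((j : ℝ) * x (Fin.last m) - 1) ((j : ℝ) + 1 - ‖x‖)))

lemma continuous_halfCutoff {m : ℕ} (j : ℕ) : Continuous (halfCutoff (m := m) j) := by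
  unfold halfCutoff
  fun_prop

lemma halfCutoff_nonneg {m : ℕ} (j : ℕ) (x : Euc (m + 1)) : 0 ≤ halfCutoff j x := le_max_left _ _

lemma halfCutoff_le_one {m : ℕ} (j : ℕ) (x : Euc (m + 1)) : halfCutoff j x ≤ 1 :=
  max_le zero_le_one (min_le_left _ _)

lemma halfCutoff_eq_zero {m : ℕ} {j : ℕ} {x : Euc (m + 1)}
    (h : (j : ℝ) * x (Fin.last m) ≤ 1 ∨ (j : ℝ) + 1 ≤ ‖x‖) : halfCutoff j x = 0 := by
  refine max_eq_left ((min_le_right _ _).trans ?_)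
  rcases h with h | h
  · exact (min_le_left _ _).trans (by linarith)
  · exact (min_le_right _ _).trans (by linarith)

lemma eventually_halfCutoff_eq_one {m : ℕ} {x : Euc (m + 1)} (hx : 0 < x (Fin.last m)) :
    ∀ᶠ j : ℕ in atTop, halfCutoff j x = 1 := by
  filter_upwards [tendsto_natCast_atTop_atTop.eventually_ge_atTop (2 / x (Fin.last m)),
    tendsto_natCast_atTop_atTop.eventually_ge_atTop ‖x‖] with j h1 h2
  rw [div_le_iff₀ hx] at h1
  rw [halfCutoff, min_eq_left, max_eq_right zero_le_one]
  exact le_min (by linarith) (by linarith)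

open scoped ContDiff in
lemma exists_seq_smooth_le {m : ℕ} {f : Euc (m + 1) → ℝ}
    (hf : ContinuousOn f {x : Euc (m + 1) | 0 < x (Fin.last m)}) (hf0 : ∀ x, 0 ≤ f x) :
    ∃ h : ℕ → Euc (m + 1) → ℝ, (∀ j, ContDiff ℝ ∞ (h j) ∧ HasCompactSupport (h j) ∧
      ∀ x, 0 ≤ h j x ∧ h j x ≤ f x) ∧
      ∀ x : Euc (m + 1), 0 < x (Fin.last m) → Tendsto (fun j => h j x) atTop (𝓝 (f x)) := by
  have hφ : ∀ j : ℕ, Continuous fun x => f x * halfCutoff j x := by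
    intro j
    refine continuous_iff_continuousAt.2 fun x => ?_
    by_cases hx : 0 < x (Fin.last m)
    · have hopen : IsOpen {x : Euc (m + 1) | 0 < x (Fin.last m)} :=
        isOpen_lt continuous_const (by fun_prop)
      exact (hf.continuousAt (hopen.mem_nhds hx)).mul (continuous_halfCutoff j).continuousAt
    · have h1 : (j : ℝ) * x (Fin.last m) < 1 := by
        have := mul_nonpos_of_nonneg_of_nonpos (Nat.cast_nonneg (α := ℝ) j) (not_lt.1 hx)
        linarith
      have h2 : ∀ᶠ y in 𝓝 x, (j : ℝ) * y (Fin.last m) < 1 :=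
        (Continuous.continuousAt (by fun_prop)).eventually_lt_const h1
      refine (continuousAt_const (y := (0 : ℝ))).congr ?_
      filter_upwards [h2] with y hy
      rw [halfCutoff_eq_zero (Or.inl hy.le), mul_zero]
  have hφ0 : ∀ (j : ℕ) x, 0 ≤ f x * halfCutoff j x := fun j x =>
    mul_nonneg (hf0 x) (halfCutoff_nonneg j x)
  choose h hsm hh using fun j : ℕ =>
    exists_smooth_between (hφ j) (hφ0 j) (ε := 1 / ((j : ℝ) + 1)) (by positivity)
  refine ⟨h, fun j => ⟨hsm j, ?_, fun x => ⟨(hh j x).1, (hh j x).2.2.trans ?_⟩⟩, fun x hx => ?_⟩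
  · refine HasCompactSupport.intro (isCompact_closedBall (0 : Euc (m + 1)) ((j : ℝ) + 1))
      fun x hx => ?_
    have h1 : (j : ℝ) + 1 ≤ ‖x‖ := by
      rw [mem_closedBall, dist_zero_right, not_le] at hx
      exact hx.le
    have h2 := hh j x
    rw [halfCutoff_eq_zero (Or.inr h1), mul_zero] at h2
    exact le_antisymm h2.2.2 h2.1
  · exact mul_le_of_le_one_right (hf0 x) (halfCutoff_le_one j x)
  · have h1 : Tendsto (fun j : ℕ => f x - 1 / ((j : ℝ) + 1)) atTop (𝓝 (f x)) := by
      simpa using tendsto_one_div_add_atTop_nhds_zero_nat.const_sub (f x)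
    refine tendsto_of_tendsto_of_tendsto_of_le_of_le' h1 tendsto_const_nhds ?_ ?_
    · filter_upwards [eventually_halfCutoff_eq_one hx] with j hj
      have := (hh j x).2.1
      rwa [hj, mul_one] at this
    · filter_upwards with j
      exact (hh j x).2.2.trans (mul_le_of_le_one_right (hf0 x) (halfCutoff_le_one j x))

/-- A smooth bump on the line which is nondecreasing on `(-∞, T]`. -/
def lineBump (δ T t : ℝ) : ℝ :=
  Real.smoothTransition (t / δ - 1) * Real.smoothTransition (T + 1 - t)

open scoped ContDiff in
lemma contDiff_lineBump (δ T : ℝ) : ContDiff ℝ ∞ (lineBump δ T) := by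
  unfold lineBump
  exact (Real.smoothTransition.contDiff.comp (by fun_prop)).mul
    (Real.smoothTransition.contDiff.comp (by fun_prop))

lemma lineBump_nonneg (δ T t : ℝ) : 0 ≤ lineBump δ T t :=
  mul_nonneg (Real.smoothTransition.nonneg _) (Real.smoothTransition.nonneg _)

lemma lineBump_le_one (δ T t : ℝ) : lineBump δ T t ≤ 1 :=
  mul_le_one₀ (Real.smoothTransition.le_one _) (Real.smoothTransition.nonneg _)
    (Real.smoothTransition.le_one _)

lemma lineBump_eq_zero {δ T t : ℝ} (hδ : 0 < δ) (ht : t ≤ δ) : lineBump δ T t = 0 := by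
  rw [lineBump, Real.smoothTransition.zero_of_nonpos, zero_mul]
  rw [sub_nonpos]
  exact (div_le_one hδ).2 ht

lemma lineBump_eq_one {δ T t : ℝ} (hδ : 0 < δ) (ht : 2 * δ ≤ t) (htT : t ≤ T) :
    lineBump δ T t = 1 := by
  rw [lineBump, Real.smoothTransition.one_of_one_le, Real.smoothTransition.one_of_one_le, mul_one]
  · linarith
  · rw [le_sub_iff_add_le, le_div_iff₀ hδ]
    linarith

lemma lineBump_mono {δ T t u : ℝ} (hδ : 0 < δ) (htu : t ≤ u) (hu : u ≤ T) :
    lineBump δ T t ≤ lineBump δ T u := by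
  unfold lineBump
  rw [Real.smoothTransition.one_of_one_le (x := T + 1 - t) (by linarith),
    Real.smoothTransition.one_of_one_le (x := T + 1 - u) (by linarith), mul_one, mul_one]
  exact Real.smoothTransition.monotone (by gcongr)

lemma hasCompactSupport_lineBump {δ T : ℝ} (hδ : 0 < δ) : HasCompactSupport (lineBump δ T) := by
  refine HasCompactSupport.intro (isCompact_Icc (a := δ) (b := T + 1)) fun t ht => ?_
  rcases not_and_or.1 ht with h | h
  · exact lineBump_eq_zero hδ (not_le.1 h).le
  · rw [lineBump, Real.smoothTransition.zero_of_nonpos (x := T + 1 - t), mul_zero]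
    linarith [not_le.1 h]

section Fourier
variable {V : Type*} [NormedAddCommGroup V] [InnerProductSpace ℝ V] [FiniteDimensional ℝ V]
  [MeasurableSpace V] [BorelSpace V]

open scoped ContDiff SchwartzMap FourierTransform in
lemma exists_schwartz_fourier_rep {h : V → ℝ} (hh : ContDiff ℝ ∞ h) (hc : HasCompactSupport h) :
    ∃ c : 𝓢(V, ℂ), ∀ x, (h x : ℂ) = ∫ ξ, c ξ * Complex.exp (⟪(2 * Real.pi) • ξ, x⟫ * Complex.I) := by
  have hc' : HasCompactSupport fun x => (h x : ℂ) := hc.comp_left (g := Complex.ofReal) rfl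
  have hh' : ContDiff ℝ ∞ fun x => (h x : ℂ) := Complex.ofRealCLM.contDiff.comp hh
  set S : 𝓢(V, ℂ) := hc'.toSchwartzMap hh' with hS
  refine ⟨𝓕 S, fun x => ?_⟩
  have h1 : 𝓕⁻ (𝓕 S) x = S x := by rw [FourierTransform.fourierInv_fourier_eq]
  rw [SchwartzMap.fourierInv_coe, Real.fourierInv_eq'] at h1
  change S x = _
  rw [← h1]
  refine integral_congr_ae (ae_of_all _ fun ξ => ?_)
  simp only [smul_eq_mul]
  rw [real_inner_smul_left, mul_comm]

lemma integrableOn_norm_rpow_neg_ball [Nontrivial V] {s : ℝ} (hs1 : s < 1) :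
    IntegrableOn (fun x : V => ‖x‖ ^ (-s)) (ball 0 1) := by
  rw [integrableOn_fun_norm_addHaar volume (f := fun r => r ^ (-s))]
  have h1 : IntegrableOn (fun y : ℝ => y ^ (-s)) (Ioo 0 1) :=
    (intervalIntegral.integrableOn_Ioo_rpow_iff one_pos).2 (by linarith)
  refine h1.bdd_mul (c := 1) (Measurable.aestronglyMeasurable (by fun_prop)) ?_
  filter_upwards [ae_restrict_mem measurableSet_Ioo] with y hy
  rw [norm_pow, Real.norm_of_nonneg hy.1.le]
  exact pow_le_one₀ hy.1.le hy.2.le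

lemma integrable_mul_norm_add_rpow_neg [Nontrivial V] {s B : ℝ} (hs0 : 0 ≤ s) (hs1 : s < 1)
    {g : V → ℝ} (hg : Integrable g) (hg0 : ∀ x, 0 ≤ g x) (hB : ∀ x, g x ≤ B) (a : V) :
    Integrable (fun x => g x * ‖a + x‖ ^ (-s)) ∧
      ∫ x, g x * ‖a + x‖ ^ (-s) ≤ B * (∫ x in ball (0 : V) 1, ‖x‖ ^ (-s)) + ∫ x, g x := by
  have hB0 : 0 ≤ B := (hg0 0).trans (hB 0)
  set q : V → ℝ := (ball 0 1).indicator fun x => ‖x‖ ^ (-s) with hq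
  have hqi : Integrable q := (integrableOn_norm_rpow_neg_ball hs1).integrable_indicator measurableSet_ball
  have hqa : Integrable fun x => q (a + x) := hqi.comp_add_left a
  have hbound : ∀ x, g x * ‖a + x‖ ^ (-s) ≤ B * q (a + x) + g x := by
    intro x
    by_cases hx : a + x ∈ ball (0 : V) 1
    · rw [hq, indicator_of_mem hx]
      have h1 := hg0 x
      have h2 : g x * ‖a + x‖ ^ (-s) ≤ B * ‖a + x‖ ^ (-s) :=
        mul_le_mul_of_nonneg_right (hB x) (by positivity)
      linarith
    · rw [hq, indicator_of_notMem hx, mul_zero, zero_add]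
      refine mul_le_of_le_one_right (hg0 x) (Real.rpow_le_one_of_one_le_of_nonpos ?_ (by linarith))
      simpa using hx
  have hint : Integrable fun x => g x * ‖a + x‖ ^ (-s) := by
    refine ((hqa.const_mul B).add hg).mono' (hg.1.mul (Measurable.aestronglyMeasurable (by fun_prop)))
      (ae_of_all _ fun x => ?_)
    rw [Real.norm_of_nonneg (mul_nonneg (hg0 x) (by positivity))]
    exact hbound x
  refine ⟨hint, (integral_mono hint ((hqa.const_mul B).add hg) hbound).trans (le_of_eq ?_)⟩
  simp only [Pi.add_apply]
  rw [integral_add (hqa.const_mul B) hg, integral_const_mul, integral_add_left_eq_self,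
    hq, integral_indicator measurableSet_ball]

end Fourier

/-- The frequency of the product of the plane wave with frequency `ξ` and the wave of frequency
`τ` in the normal variable. -/
def shiftFreq {m : ℕ} (z : Euc (m + 1) × ℝ) : Euc (m + 1) :=
  (2 * Real.pi) • (z.1 + appendLast 0 z.2)

@[fun_prop]
lemma measurable_shiftFreq {m : ℕ} : Measurable (shiftFreq (m := m)) := by
  unfold shiftFreq
  fun_prop

lemma inner_shiftFreq {m : ℕ} (ξ : Euc (m + 1)) (τ : ℝ) (x : Euc (m + 1)) :
    ⟪shiftFreq (ξ, τ), x⟫ = ⟪(2 * Real.pi) • ξ, x⟫ + ⟪(2 * Real.pi) • τ, x (Fin.last m)⟫ := by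
  rw [shiftFreq, smul_add, inner_add_left]
  congr 1
  rw [real_inner_comm, real_inner_smul_right, inner_appendLast, inner_zero_left]
  simp
  ring

lemma norm_shiftFreq_le {m : ℕ} (ξ : Euc (m + 1)) (τ : ℝ) :
    ‖shiftFreq (ξ, τ)‖ ≤ 2 * Real.pi * (‖ξ‖ + ‖τ‖) := by
  have h : ‖appendLast (0 : Euc m) τ‖ = ‖τ‖ := by
    rw [← sq_eq_sq₀ (norm_nonneg _) (norm_nonneg _), norm_sq_eq_horizontal, appendLast_last]
    have : horizontal (appendLast (0 : Euc m) τ) = 0 := by ext i; simp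
    simp [this]
  rw [shiftFreq, norm_smul, Real.norm_of_nonneg (by positivity)]
  gcongr
  exact (norm_add_le _ _).trans_eq (by rw [h])

lemma le_norm_shiftFreq {m : ℕ} (ξ : Euc (m + 1)) (τ : ℝ) :
    ‖ξ (Fin.last m) + τ‖ ≤ ‖shiftFreq (ξ, τ)‖ := by
  have h1 := PiLp.norm_apply_le (shiftFreq (ξ, τ)) (Fin.last m)
  refine le_trans ?_ h1
  have h2 : shiftFreq (ξ, τ) (Fin.last m) = (2 * Real.pi) * (ξ (Fin.last m) + τ) := by
    simp [shiftFreq]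
    ring
  rw [h2, norm_mul, Real.norm_of_nonneg (show (0 : ℝ) ≤ 2 * Real.pi by positivity)]
  refine le_mul_of_one_le_left (norm_nonneg _) ?_
  have := Real.pi_gt_three
  linarith

lemma ae_last_add_ne_zero (m : ℕ) :
    ∀ᵐ z : Euc (m + 1) × ℝ, z.1 (Fin.last m) + z.2 ≠ 0 := by
  have hm : MeasurableSet {z : Euc (m + 1) × ℝ | z.1 (Fin.last m) + z.2 ≠ 0} :=
    (measurableSet_eq_fun (by fun_prop) measurable_const).compl
  rw [Measure.volume_eq_prod, Measure.ae_prod_iff_ae_ae hm]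
  refine ae_of_all _ fun ξ => ?_
  filter_upwards [Measure.ae_ne volume (-ξ (Fin.last m))] with τ hτ h
  exact hτ (by linarith)

lemma ae_shiftFreq_ne_zero (m : ℕ) : ∀ᵐ z : Euc (m + 1) × ℝ, shiftFreq z ≠ 0 := by
  filter_upwards [ae_last_add_ne_zero m] with z hz h
  have h1 := le_norm_shiftFreq z.1 z.2
  rw [show (z.1, z.2) = z from rfl, h, norm_zero] at h1
  exact hz (norm_le_zero_iff.1 h1)

lemma ofReal_mul_eq_integral_shiftFreq {m : ℕ} {c : Euc (m + 1) → ℂ} {d : ℝ → ℂ}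
    {G : Euc (m + 1) → ℝ} {χ : ℝ → ℝ}
    (hG : ∀ x, (G x : ℂ) = ∫ ξ, c ξ * Complex.exp (⟪(2 * Real.pi) • ξ, x⟫ * Complex.I))
    (hχ : ∀ t, (χ t : ℂ) = ∫ τ, d τ * Complex.exp (⟪(2 * Real.pi) • τ, t⟫ * Complex.I))
    (x : Euc (m + 1)) :
    ((χ (x (Fin.last m)) * G x : ℝ) : ℂ) =
      ∫ z : Euc (m + 1) × ℝ, c z.1 * d z.2 * Complex.exp (⟪shiftFreq z, x⟫ * Complex.I) := by
  rw [mul_comm, Complex.ofReal_mul, hG, hχ, Measure.volume_eq_prod, ← integral_prod_mul]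
  refine integral_congr_ae (ae_of_all _ fun z => ?_)
  simp only
  rw [show z = (z.1, z.2) from rfl, inner_shiftFreq, Complex.ofReal_add, add_mul, Complex.exp_add]
  ring

lemma integrable_shiftFreq_norm {m : ℕ} {c : Euc (m + 1) → ℂ} {d : ℝ → ℂ} (hc : Integrable c)
    (hc1 : Integrable fun ξ => ‖c ξ‖ * ‖ξ‖) (hd : Integrable d)
    (hd1 : Integrable fun τ => ‖d τ‖ * ‖τ‖) :
    Integrable fun z : Euc (m + 1) × ℝ => ‖c z.1 * d z.2‖ * ‖shiftFreq z‖ := by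
  have h1 := (hc1.mul_prod hd.norm).add (hc.norm.mul_prod hd1)
  refine (h1.const_mul (2 * Real.pi)).mono' ?_ (ae_of_all _ fun z => ?_)
  · exact (hc.mul_prod hd).1.norm.mul (Measurable.aestronglyMeasurable (by fun_prop))
  · rw [Real.norm_of_nonneg (by positivity), norm_mul]
    have := mul_le_mul_of_nonneg_left (norm_shiftFreq_le z.1 z.2)
      (show 0 ≤ ‖c z.1‖ * ‖d z.2‖ by positivity)
    simp only [Pi.add_apply]
    linarith

lemma integrable_shiftFreq_rpow_neg {m : ℕ} {s B : ℝ} (hs0 : 0 ≤ s) (hs1 : s < 1)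
    {c : Euc (m + 1) → ℂ} {d : ℝ → ℂ} (hc : Integrable c) (hd : Integrable d)
    (hB : ∀ τ, ‖d τ‖ ≤ B) :
    Integrable fun z : Euc (m + 1) × ℝ => ‖c z.1 * d z.2‖ * ‖shiftFreq z‖ ^ (-s) := by
  have hmeas := (hc.mul_prod hd).1
  have h1 : Integrable fun z : Euc (m + 1) × ℝ =>
      ‖c z.1‖ * (‖d z.2‖ * ‖z.1 (Fin.last m) + z.2‖ ^ (-s)) := by
    have key := fun a : ℝ => integrable_mul_norm_add_rpow_neg hs0 hs1 hd.norm
      (fun τ => norm_nonneg (d τ)) hB a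
    have hm : AEStronglyMeasurable (fun z : Euc (m + 1) × ℝ =>
        ‖c z.1‖ * (‖d z.2‖ * ‖z.1 (Fin.last m) + z.2‖ ^ (-s))) := by
      refine (hmeas.norm.mul (g := fun z => ‖z.1 (Fin.last m) + z.2‖ ^ (-s))
        (Measurable.aestronglyMeasurable (by fun_prop))).congr (ae_of_all _ fun z => ?_)
      simp only [Pi.mul_apply, norm_mul]
      ring
    rw [Measure.volume_eq_prod] at hm ⊢
    refine (integrable_prod_iff hm).2 ⟨ae_of_all _ fun ξ =>
      (key (ξ (Fin.last m))).1.const_mul ‖c ξ‖, ?_⟩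
    refine (hc.norm.mul_const (B * (∫ x in ball (0 : ℝ) 1, ‖x‖ ^ (-s)) + ∫ x, ‖d x‖)).mono'
      hm.norm.integral_prod_right' (ae_of_all _ fun ξ => ?_)
    rw [Real.norm_of_nonneg (integral_nonneg fun _ => norm_nonneg _)]
    have h2 : ∀ τ, ‖‖c ξ‖ * (‖d τ‖ * ‖ξ (Fin.last m) + τ‖ ^ (-s))‖ =
        ‖c ξ‖ * (‖d τ‖ * ‖ξ (Fin.last m) + τ‖ ^ (-s)) := fun τ =>
      Real.norm_of_nonneg (by positivity)
    simp only [h2]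
    rw [integral_const_mul]
    exact mul_le_mul_of_nonneg_left (key _).2 (norm_nonneg _)
  refine h1.mono' (hmeas.norm.mul (Measurable.aestronglyMeasurable (by fun_prop))) ?_
  filter_upwards [ae_last_add_ne_zero m] with z hz
  rw [Real.norm_of_nonneg (by positivity), norm_mul, mul_assoc]
  have h2 := Real.rpow_le_rpow_of_nonpos (norm_pos_iff.2 hz) (le_norm_shiftFreq z.1 z.2)
    (show -s ≤ 0 by linarith)
  gcongr

lemma tendsto_cocompact_of_shiftFreq {m : ℕ} {c : Euc (m + 1) × ℝ → ℂ} (hc : Integrable c)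
    {W : Euc (m + 1) → ℝ}
    (hW : ∀ x, (W x : ℂ) = ∫ z, c z * Complex.exp (⟪shiftFreq z, x⟫ * Complex.I)) :
    Tendsto W (cocompact _) (𝓝 0) := by
  have hc' : Integrable c (volume.prod volume) := hc
  have hrep : ∀ x, (W x : ℂ) = ∫ τ : ℝ, Complex.exp (⟪(2 * Real.pi) • τ, x (Fin.last m)⟫ * Complex.I) *
      ∫ ξ, c (ξ, τ) * Complex.exp (⟪(2 * Real.pi) • ξ, x⟫ * Complex.I) := by
    intro x
    have hi : Integrable (fun z => c z * Complex.exp (⟪shiftFreq z, x⟫ * Complex.I))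
        (volume.prod volume) := integrable_mul_planeWave measurable_shiftFreq hc' x
    rw [hW, Measure.volume_eq_prod, integral_prod_symm _ hi]
    refine integral_congr_ae (ae_of_all _ fun τ => ?_)
    simp only
    rw [← integral_const_mul]
    refine integral_congr_ae (ae_of_all _ fun ξ => ?_)
    simp only
    rw [inner_shiftFreq, Complex.ofReal_add, add_mul, Complex.exp_add]
    ring
  have hlim : Tendsto (fun x => (W x : ℂ)) (cocompact (Euc (m + 1))) (𝓝 0) := by
    simp only [hrep]
    have hcg : (cocompact (Euc (m + 1))).IsCountablyGenerated := by
      rw [← cobounded_eq_cocompact, ← comap_norm_atTop]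
      infer_instance
    rw [← integral_zero ℝ ℂ (μ := volume)]
    refine tendsto_integral_filter_of_dominated_convergence (fun τ => ∫ ξ, ‖c (ξ, τ)‖) ?_ ?_
      hc'.norm.integral_prod_right ?_
    · refine Eventually.of_forall fun x => ?_
      refine AEStronglyMeasurable.mul (Measurable.aestronglyMeasurable (by fun_prop)) ?_
      have hm : AEStronglyMeasurable (fun z : Euc (m + 1) × ℝ =>
          c z * Complex.exp (⟪(2 * Real.pi) • z.1, x⟫ * Complex.I)) (volume.prod volume) :=
        hc'.1.mul (Measurable.aestronglyMeasurable (by fun_prop))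
      exact hm.prod_swap.integral_prod_right'
    · refine Eventually.of_forall fun x => ae_of_all _ fun τ => ?_
      rw [norm_mul, Complex.norm_exp_ofReal_mul_I, one_mul]
      refine (norm_integral_le_integral_norm _).trans (le_of_eq ?_)
      simp only [norm_mul, Complex.norm_exp_ofReal_mul_I, mul_one]
    · refine ae_of_all _ fun τ => ?_
      rw [tendsto_zero_iff_norm_tendsto_zero]
      simp only [norm_mul, Complex.norm_exp_ofReal_mul_I, one_mul]
      rw [← tendsto_zero_iff_norm_tendsto_zero]
      have h1 := tendsto_integral_exp_inner_smul_cocompact (fun ξ : Euc (m + 1) => c (ξ, τ))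
      have h2 := h1.comp (Homeomorph.neg (Euc (m + 1))).isClosedEmbedding.tendsto_cocompact
      refine h2.congr fun x => integral_congr_ae (ae_of_all _ fun ξ => ?_)
      simp only [Homeomorph.coe_neg, inner_neg_right, neg_neg, Circle.smul_def, Real.fourierChar_apply, smul_eq_mul]
      rw [real_inner_smul_left, mul_comm]
  have h := (Complex.continuous_re.tendsto _).comp hlim
  simpa [Function.comp_def] using h

lemma norm_halfSymbol_cpow {m : ℕ} {σ : ℝ} (hσ : σ ^ 2 = 1) (k : Euc (m + 1)) (r : ℝ) :
    ‖halfSymbol σ k ^ (r : ℂ)‖ = ‖k‖ ^ r := by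
  rw [Complex.norm_cpow_real, norm_halfSymbol hσ]

lemma halfSymbol_ne_zero {m : ℕ} {σ : ℝ} (hσ : σ ^ 2 = 1) {k : Euc (m + 1)} (hk : k ≠ 0) :
    halfSymbol σ k ≠ 0 := by
  rw [← norm_ne_zero_iff, norm_halfSymbol hσ]
  exact norm_ne_zero_iff.2 hk

open scoped ComplexConjugate in
lemma halfSymbol_neg_one {m : ℕ} (k : Euc (m + 1)) :
    halfSymbol (-1) k = conj (halfSymbol 1 k) := by
  apply Complex.ext <;> simp [halfSymbol_re, halfSymbol_im]

lemma halfSymbol_neg_one_cpow_mul {m : ℕ} {k : Euc (m + 1)} (hk : k ≠ 0) (s : ℝ) :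
    halfSymbol (-1) k ^ (-s : ℂ) * ((‖k‖ ^ (2 * s) : ℝ) : ℂ) = halfSymbol 1 k ^ (s : ℂ) := by
  have hz := halfSymbol_ne_zero (σ := 1) (by norm_num) hk
  have harg : (halfSymbol 1 k).arg ≠ Real.pi := by
    intro h
    rw [Complex.arg_eq_pi_iff] at h
    exact absurd h.1 (not_lt.2 (halfSymbol_re_nonneg 1 k))
  have hne : halfSymbol 1 k ^ (s : ℂ) ≠ 0 := by
    rw [Complex.cpow_ne_zero_iff]
    exact Or.inl hz
  rw [halfSymbol_neg_one, Complex.cpow_neg, Complex.conj_cpow _ _ harg, Complex.conj_ofReal,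
    mul_comm 2 s, Real.rpow_mul (norm_nonneg _), ← norm_halfSymbol_cpow (σ := 1) (by norm_num),
    Real.rpow_two, Complex.ofReal_pow, ← Complex.mul_conj']
  have hne' := (map_ne_zero (starRingEnd ℂ)).2 hne
  field_simp

section Weights
variable {Ω : Type*} [MeasurableSpace Ω] {μ : Measure Ω} {m : ℕ} {c : Ω → ℂ} {k : Ω → Euc (m + 1)}

lemma integrable_mul_halfSymbol_cpow {σ r : ℝ} (hσ : σ ^ 2 = 1) (hk : Measurable k)
    (hc : AEStronglyMeasurable c μ) (hck : Integrable (fun ω => ‖c ω‖ * ‖k ω‖ ^ r) μ) :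
    Integrable (fun ω => c ω * halfSymbol σ (k ω) ^ (r : ℂ)) μ := by
  refine hck.mono' (hc.mul (Measurable.aestronglyMeasurable (by fun_prop))) (ae_of_all _ fun ω => ?_)
  rw [norm_mul, norm_halfSymbol_cpow hσ]

lemma integrable_mul_norm_rpow {r : ℝ} (hr0 : 0 ≤ r) (hr1 : r ≤ 1) (hk : Measurable k)
    (hc : Integrable c μ) (hck : Integrable (fun ω => ‖c ω‖ * ‖k ω‖) μ) :
    Integrable (fun ω => ‖c ω‖ * ‖k ω‖ ^ r) μ := by
  refine (hc.norm.add hck).mono' (hc.1.norm.mul (Measurable.aestronglyMeasurable (by fun_prop)))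
    (ae_of_all _ fun ω => ?_)
  rw [Real.norm_of_nonneg (by positivity), Pi.add_apply]
  have h : ‖k ω‖ ^ r ≤ 1 + ‖k ω‖ := by
    rcases le_total ‖k ω‖ 1 with h1 | h1
    · linarith [Real.rpow_le_one (norm_nonneg (k ω)) h1 hr0, norm_nonneg (k ω)]
    · linarith [(Real.rpow_le_rpow_of_exponent_le h1 hr1).trans_eq (Real.rpow_one _)]
  linarith [mul_le_mul_of_nonneg_left h (norm_nonneg (c ω))]

lemma integrable_norm_mul_halfSymbol_cpow_neg {σ s : ℝ} (hσ : σ ^ 2 = 1) (hs0 : 0 ≤ s) (hs1 : s < 1)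
    (hk : Measurable k) (hc : Integrable c μ) (hck : Integrable (fun ω => ‖c ω‖ * ‖k ω‖) μ) :
    Integrable (fun ω => ‖c ω * halfSymbol σ (k ω) ^ (-s : ℂ)‖ * ‖k ω‖) μ := by
  refine (integrable_mul_norm_rpow (r := 1 - s) (by linarith) (by linarith) hk hc hck).congr
    (ae_of_all _ fun ω => ?_)
  simp only
  rw [norm_mul, ← Complex.ofReal_neg, norm_halfSymbol_cpow hσ, mul_assoc]
  congr 1
  rcases eq_or_ne ‖k ω‖ 0 with h | h
  · rw [h, mul_zero, Real.zero_rpow (by linarith)]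
  · rw [← Real.rpow_add_one h]
    ring_nf

end Weights

lemma poissonAvg_nonneg {m : ℕ} {W : Euc (m + 1) → ℝ} (hW : ∀ x, 0 ≤ W x) (σ : ℝ) (x : Euc (m + 1))
    (a : ℝ) : 0 ≤ poissonAvg σ W x a :=
  integral_nonneg fun _ => hW _

open scoped ContDiff SchwartzMap in
lemma exists_subsolution {m : ℕ} {s δ T : ℝ} (hs0 : 0 < s) (hs1 : s < 1) (hδ : 0 < δ)
    {h : Euc (m + 1) → ℝ} (hh : ContDiff ℝ ∞ h) (hhc : HasCompactSupport h) (hh0 : ∀ x, 0 ≤ h x)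
    (hhT : ∀ x, T < x (Fin.last m) → h x = 0) :
    ∃ w : Euc (m + 1) → ℝ, Continuous w ∧ (∃ B, ∀ x, |w x| ≤ B) ∧
      (∀ x, x (Fin.last m) ≤ δ → w x = 0) ∧ Tendsto w (cocompact _) (𝓝 0) ∧
      (∀ x, ∃ g ≤ lineBump δ T (x (Fin.last m)) * h x, HasFracLapAt (m + 1) s w x g) ∧
      ∀ x, ENNReal.ofReal (Real.Gamma s ^ 2 * w x) =
        ∫⁻ a in Ioi (0 : ℝ), ENNReal.ofReal (a ^ (s - 1)) * ∫⁻ y,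
          ENNReal.ofReal (lineBump δ T (x (Fin.last m) - a)) *
          (∫⁻ b in Ioi (0 : ℝ), ENNReal.ofReal (b ^ (s - 1)) * ∫⁻ z,
            ENNReal.ofReal (h (x + appendLast (a • y) (-1 * a) + appendLast (b • z) (1 * b)))
              ∂(poissonMeasure m)) ∂(poissonMeasure m) := by
  have hσ1 : (1 : ℝ) ^ 2 = 1 := by norm_num
  have hσ2 : (-1 : ℝ) ^ 2 = 1 := by norm_num
  have hΓs := Real.Gamma_pos_of_pos hs0
  have hΓs' := Real.Gamma_pos_of_pos (s := 1 - s) (by linarith)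
  set χ := lineBump δ T with hχdef
  have hχ0 : ∀ t, 0 ≤ χ t := lineBump_nonneg δ T
  obtain ⟨c, hc⟩ := exists_schwartz_fourier_rep hh hhc
  obtain ⟨d, hd⟩ := exists_schwartz_fourier_rep (contDiff_lineBump δ T)
    (hasCompactSupport_lineBump hδ)
  have hci : Integrable (c : Euc (m + 1) → ℂ) := c.integrable
  have hdi : Integrable (d : ℝ → ℂ) := d.integrable
  have hd1 : Integrable fun τ => ‖d τ‖ * ‖τ‖ := by
    simpa [mul_comm] using d.integrable_pow_mul volume 1
  have hpi : ∀ ξ : Euc (m + 1), ‖(2 * Real.pi) • ξ‖ = 2 * Real.pi * ‖ξ‖ := fun ξ => by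
    rw [norm_smul, Real.norm_of_nonneg (by positivity)]
  have hk0 : Measurable fun ξ : Euc (m + 1) => (2 * Real.pi) • ξ := by fun_prop
  have hk0ne : ∀ᵐ ξ : Euc (m + 1), (2 * Real.pi) • ξ ≠ 0 := by
    filter_upwards [Measure.ae_ne volume (0 : Euc (m + 1))] with ξ hξ
    exact smul_ne_zero (by positivity) hξ
  have hck1 : Integrable fun ξ => ‖c ξ‖ * ‖(2 * Real.pi) • ξ‖ := by
    have h1 := (c.integrable_pow_mul volume 1).const_mul (2 * Real.pi)
    refine h1.congr (ae_of_all _ fun ξ => ?_)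
    simp only [hpi]
    ring
  have hcks : Integrable fun ξ => ‖c ξ‖ * ‖(2 * Real.pi) • ξ‖ ^ (-s) := by
    have h1 := (integrable_mul_norm_add_rpow_neg hs0.le hs1 hci.norm (fun ξ => norm_nonneg _)
      (SchwartzMap.norm_le_seminorm ℝ c) 0).1.const_mul ((2 * Real.pi) ^ (-s))
    refine h1.congr (ae_of_all _ fun ξ => ?_)
    simp only [hpi, zero_add]
    rw [Real.mul_rpow (by positivity) (norm_nonneg _)]
    ring
  choose G hG0 hGrep hGint using
    lintegral_potential_poissonMeasure hs0 hk0 hk0ne hci hcks hh0 hc hσ1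
  set c1 : Euc (m + 1) → ℂ := fun ξ => c ξ * halfSymbol 1 ((2 * Real.pi) • ξ) ^ (-s : ℂ) with hc1def
  have hc1 : Integrable c1 := by
    simpa using integrable_mul_halfSymbol_cpow (r := -s) hσ1 hk0 hci.1 hcks
  have hc1k : Integrable fun ξ => ‖c1 ξ‖ * ‖(2 * Real.pi) • ξ‖ :=
    integrable_norm_mul_halfSymbol_cpow_neg hσ1 hs0.le hs1 hk0 hci hck1
  have hc1k' : Integrable fun ξ => ‖c1 ξ‖ * ‖ξ‖ := by
    refine (hc1k.const_mul (2 * Real.pi)⁻¹).congr (ae_of_all _ fun ξ => ?_)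
    simp only [hpi]
    field_simp
  have hGT : ∀ x, T < x (Fin.last m) → G x = 0 := by
    intro x hx
    have h1 := hGint x
    rw [setLIntegral_congr_fun (g := fun _ => 0) measurableSet_Ioi, lintegral_zero] at h1
    · have h2 := ENNReal.ofReal_eq_zero.1 h1.symm
      exact le_antisymm (nonpos_of_mul_nonpos_right h2 hΓs) (hG0 x)
    · intro b hb
      have hb' : (0 : ℝ) < b := hb
      simp only
      rw [lintegral_congr (g := fun _ => 0), lintegral_zero, mul_zero]
      intro y
      rw [hhT, ENNReal.ofReal_zero]
      simp
      linarith
  obtain ⟨hGm, hGm'⟩ : (∀ x, IntegrableOn (fun a : ℝ => a ^ (-1 - s) * (G x - poissonAvg 1 G x a)) (Ioi 0)) ∧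
      ∀ x, ∫ a in Ioi (0 : ℝ), a ^ (-1 - s) * (G x - poissonAvg 1 G x a) =
        Real.Gamma (1 - s) / s * h x := by
    refine ⟨fun x => (integral_marchaud_poissonAvg hs0 hs1 hk0 hc1 hc1k hGrep hσ1 x).1, fun x => ?_⟩
    have h1 := (integral_marchaud_poissonAvg hs0 hs1 hk0 hc1 hc1k hGrep hσ1 x).2
    apply Complex.ofReal_injective
    rw [h1]
    push_cast
    rw [hc]
    congr 1
    refine integral_congr_ae ?_
    filter_upwards [hk0ne] with ξ hξ
    rw [hc1def]
    simp only
    rw [Complex.cpow_neg, mul_assoc (c ξ), inv_mul_cancel₀, mul_one]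
    rw [Complex.cpow_ne_zero_iff]
    exact Or.inl (halfSymbol_ne_zero hσ1 hξ)
  set g : Euc (m + 1) → ℝ := fun x => χ (x (Fin.last m)) * G x with hgdef
  set e : Euc (m + 1) × ℝ → ℂ := fun z => c1 z.1 * d z.2 with hedef
  have hg0 : ∀ x, 0 ≤ g x := fun x => mul_nonneg (hχ0 _) (hG0 x)
  have hgrep : ∀ x, (g x : ℂ) = ∫ z, e z * Complex.exp (⟪shiftFreq z, x⟫ * Complex.I) :=
    ofReal_mul_eq_integral_shiftFreq hGrep hd
  have hei : Integrable e := hc1.mul_prod hdi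
  have hek : Integrable fun z => ‖e z‖ * ‖shiftFreq z‖ := integrable_shiftFreq_norm hc1 hc1k' hdi hd1
  have heks : Integrable fun z => ‖e z‖ * ‖shiftFreq z‖ ^ (-s) :=
    integrable_shiftFreq_rpow_neg hs0.le hs1 hc1 hdi (SchwartzMap.norm_le_seminorm ℝ d)
  have hsf := measurable_shiftFreq (m := m)
  choose w hw0 hwrep hwint using
    lintegral_potential_poissonMeasure hs0 hsf (ae_shiftFreq_ne_zero m) hei heks hg0 hgrep hσ2
  set c2 : Euc (m + 1) × ℝ → ℂ := fun z => e z * halfSymbol (-1) (shiftFreq z) ^ (-s : ℂ) with hc2def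
  have hc2 : Integrable c2 := by
    simpa using integrable_mul_halfSymbol_cpow (r := -s) hσ2 hsf hei.1 heks
  have hc2k : Integrable fun z => ‖c2 z‖ * ‖shiftFreq z‖ ^ (2 * s) := by
    refine (integrable_mul_norm_rpow hs0.le hs1.le hsf hei hek).congr ?_
    filter_upwards [ae_shiftFreq_ne_zero m] with z hz
    rw [hc2def]
    simp only
    rw [norm_mul (e z), ← Complex.ofReal_neg, norm_halfSymbol_cpow hσ2, mul_assoc,
      ← Real.rpow_add (norm_pos_iff.2 hz)]
    ring_nf
  refine ⟨w, continuous_of_fourier hsf hc2 hwrep, ⟨_, abs_le_of_fourier hwrep⟩, ?_,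
    tendsto_cocompact_of_shiftFreq hc2 hwrep, ?_, ?_⟩
  · intro x hx
    have h1 := hwint x
    rw [setLIntegral_congr_fun (g := fun _ => 0) measurableSet_Ioi, lintegral_zero] at h1
    · have h2 := ENNReal.ofReal_eq_zero.1 h1.symm
      exact le_antisymm (nonpos_of_mul_nonpos_right h2 hΓs) (hw0 x)
    · intro a ha
      have ha' : (0 : ℝ) < a := ha
      simp only
      rw [lintegral_congr (g := fun _ => 0), lintegral_zero, mul_zero]
      intro y
      rw [hgdef]
      simp only
      rw [hχdef, lineBump_eq_zero hδ, zero_mul, ENNReal.ofReal_zero]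
      simp
      linarith
  · intro x
    obtain ⟨hgm, hgm'⟩ := integral_marchaud_poissonAvg hs0 hs1 hsf hei hek hgrep hσ1 x
    refine ⟨_, ?_, hasFracLapAt_of_fourier (m + 1) hs0 hs1 hsf hc2 hc2k hwrep x⟩
    have h1 : (∫ z, c2 z * ((‖shiftFreq z‖ ^ (2 * s) : ℝ) : ℂ) *
        Complex.exp (⟪shiftFreq z, x⟫ * Complex.I)) =
        ∫ z, e z * halfSymbol 1 (shiftFreq z) ^ (s : ℂ) *
          Complex.exp (⟪shiftFreq z, x⟫ * Complex.I) := by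
      refine integral_congr_ae ?_
      filter_upwards [ae_shiftFreq_ne_zero m] with z hz
      rw [hc2def]
      simp only
      rw [mul_assoc (e z), halfSymbol_neg_one_cpow_mul hz]
    have hle : ∫ a in Ioi (0 : ℝ), a ^ (-1 - s) * (g x - poissonAvg 1 g x a) ≤
        χ (x (Fin.last m)) * (Real.Gamma (1 - s) / s * h x) := by
      rw [← hGm', ← integral_const_mul]
      refine setIntegral_mono_on hgm ((hGm x).const_mul _) measurableSet_Ioi fun a ha => ?_
      have ha' : (0 : ℝ) < a := ha
      have hlast : ∀ y : Euc m, (x + appendLast (a • y) (1 * a)) (Fin.last m) =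
          x (Fin.last m) + a := fun y => by simp
      have hP : poissonAvg 1 g x a = χ (x (Fin.last m) + a) * poissonAvg 1 G x a := by
        rw [poissonAvg, poissonAvg, ← integral_const_mul]
        exact integral_congr_ae (ae_of_all _ fun y => by simp only [hgdef, hlast])
      have hP' : χ (x (Fin.last m)) * poissonAvg 1 G x a ≤
          χ (x (Fin.last m) + a) * poissonAvg 1 G x a := by
        rcases le_or_gt (x (Fin.last m) + a) T with hT | hT
        · exact mul_le_mul_of_nonneg_right (lineBump_mono hδ (by linarith) hT)
            (poissonAvg_nonneg hG0 1 x a)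
        · have h0 : poissonAvg 1 G x a = 0 := by
            rw [poissonAvg]
            refine (integral_congr_ae (ae_of_all _ fun y => ?_)).trans (integral_zero _ _)
            exact hGT _ (by rw [hlast]; exact hT)
          rw [h0, mul_zero, mul_zero]
      rw [hP, hgdef, mul_left_comm]
      refine mul_le_mul_of_nonneg_left ?_ (by positivity)
      linarith
    have hval : (∫ z, e z * halfSymbol 1 (shiftFreq z) ^ (s : ℂ) *
        Complex.exp (⟪shiftFreq z, x⟫ * Complex.I)) =
        ((s / Real.Gamma (1 - s) *
          ∫ a in Ioi (0 : ℝ), a ^ (-1 - s) * (g x - poissonAvg 1 g x a) : ℝ) : ℂ) := by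
      have h2 : (Real.Gamma (1 - s) : ℂ) ≠ 0 := Complex.ofReal_ne_zero.2 hΓs'.ne'
      have h3 : (s : ℂ) ≠ 0 := Complex.ofReal_ne_zero.2 hs0.ne'
      have h4 : (s : ℂ) / Real.Gamma (1 - s) * (Real.Gamma (1 - s) / s) = 1 := by field_simp
      rw [Complex.ofReal_mul, hgm', Complex.ofReal_div, ← mul_assoc, h4, one_mul]
    rw [h1, hval, Complex.ofReal_re]
    calc _ ≤ s / Real.Gamma (1 - s) * (χ (x (Fin.last m)) * (Real.Gamma (1 - s) / s * h x)) := by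
          gcongr
      _ = _ := by field_simp
  · intro x
    rw [sq, mul_assoc, ENNReal.ofReal_mul hΓs.le, ← hwint, ← lintegral_const_mul' _ _ ENNReal.ofReal_ne_top]
    refine lintegral_congr fun a => ?_
    rw [mul_left_comm, ← lintegral_const_mul' _ _ ENNReal.ofReal_ne_top]
    congr 1
    refine lintegral_congr fun y => ?_
    rw [hGint, ← ENNReal.ofReal_mul (hχ0 _), ← ENNReal.ofReal_mul hΓs.le, hgdef]
    simp only [PiLp.add_apply, appendLast_last, neg_mul, one_mul, ← sub_eq_add_neg]
    rw [mul_left_comm]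

lemma appendLast_add {m : ℕ} (y z : Euc m) (t u : ℝ) :
    appendLast y t + appendLast z u = appendLast (y + z) (t + u) := by
  ext i
  refine Fin.lastCases ?_ (fun j => ?_) i <;> simp

lemma lintegral_poissonMeasure_compose {m : ℕ} {s a : ℝ} (ha : 0 < a) (X : ℝ≥0∞) (hX : X ≠ ⊤)
    {F : Euc (m + 1) → ℝ≥0∞} (hF : Measurable F) (x : Euc (m + 1)) :
    ENNReal.ofReal (a ^ (s - 1)) * ∫⁻ y, X * (∫⁻ b in Ioi (0 : ℝ), ENNReal.ofReal (b ^ (s - 1)) * ∫⁻ z,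
      F (x + appendLast (a • y) (-1 * a) + appendLast (b • z) (1 * b))
        ∂(poissonMeasure m)) ∂(poissonMeasure m) =
    ∫⁻ b in Ioi (0 : ℝ), ENNReal.ofReal ((a * b) ^ (s - 1)) *
      (X * ∫⁻ z, F (x + appendLast ((a + b) • z) (b - a)) ∂(poissonMeasure m)) := by
  have hinner : Measurable fun p : Euc m × ℝ => ∫⁻ z,
      F (x + appendLast (a • p.1) (-1 * a) + appendLast (p.2 • z) (1 * p.2)) ∂(poissonMeasure m) :=
    Measurable.lintegral_prod_right' (f := fun q : (Euc m × ℝ) × Euc m =>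
      F (x + appendLast (a • q.1.1) (-1 * a) + appendLast (q.1.2 • q.2) (1 * q.1.2))) (by fun_prop)
  rw [lintegral_const_mul' _ _ hX, lintegral_lintegral_swap
    (by exact Measurable.aemeasurable (by fun_prop)), ← lintegral_const_mul' _ _ hX,
    ← lintegral_const_mul' _ _ ENNReal.ofReal_ne_top]
  refine setLIntegral_congr_fun measurableSet_Ioi fun b hb => ?_
  have hb' : (0 : ℝ) < b := hb
  rw [lintegral_const_mul' _ _ ENNReal.ofReal_ne_top,
    ← lintegral_lintegral_poissonMeasure m ha.le hb'.le
      (F := fun u => F (x + appendLast u (b - a))) (by fun_prop),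
    Real.mul_rpow ha.le hb'.le, ENNReal.ofReal_mul (by positivity), mul_left_comm X, mul_assoc]
  simp only [add_assoc, appendLast_add]
  ring_nf

lemma lintegral_lintegral_lintegral_eq {m : ℕ} {A B : Set ℝ} {f : (ℝ × ℝ) × Euc m → ℝ≥0∞}
    (hf : Measurable f) :
    ∫⁻ a in A, ∫⁻ b in B, ∫⁻ z, f ((a, b), z) ∂(poissonMeasure m) =
      ∫⁻ p, f p ∂(((volume.restrict A).prod (volume.restrict B)).prod (poissonMeasure m)) := by
  rw [lintegral_prod _ hf.aemeasurable,
    lintegral_prod _ (Measurable.lintegral_prod_right' hf).aemeasurable]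

lemma lintegral_le_of_tendsto {m : ℕ} {s : ℝ} {C : ℝ≥0∞} {x : Euc (m + 1)}
    {h : ℕ → Euc (m + 1) → ℝ} (hh : ∀ j, Measurable (h j)) {χ : ℕ → ℝ → ℝ} (hχ : ∀ j, Measurable (χ j))
    (hχ1 : ∀ t, 0 < t → ∀ᶠ j in atTop, χ j t = 1) {f : Euc (m + 1) → ℝ}
    (hf : ∀ y, 0 < y (Fin.last m) → Tendsto (fun j => h j y) atTop (𝓝 (f y)))
    {F : Euc (m + 1) → ℝ≥0∞} (hFm : Measurable F)
    (hF : ∀ y, 0 < y (Fin.last m) → F y = ENNReal.ofReal (f y))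
    (hC : ∀ j, ∫⁻ a in Ioi (0 : ℝ), ∫⁻ b in Ioi (0 : ℝ), ENNReal.ofReal ((a * b) ^ (s - 1)) *
      (ENNReal.ofReal (χ j (x (Fin.last m) - a)) *
        ∫⁻ z, ENNReal.ofReal (h j (x + appendLast ((a + b) • z) (b - a))) ∂(poissonMeasure m)) ≤ C) :
    ∫⁻ a in Ioo 0 (x (Fin.last m)), ∫⁻ b in Ioi (0 : ℝ), ENNReal.ofReal ((a * b) ^ (s - 1)) *
      ∫⁻ z, F (x + appendLast ((a + b) • z) (b - a)) ∂(poissonMeasure m) ≤ C := by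
  set M := ((volume.restrict (Ioo 0 (x (Fin.last m)))).prod (volume.restrict (Ioi (0 : ℝ)))).prod
    (poissonMeasure m) with hM
  set Φ : ℕ → (ℝ × ℝ) × Euc m → ℝ≥0∞ := fun j p => ENNReal.ofReal ((p.1.1 * p.1.2) ^ (s - 1)) *
    (ENNReal.ofReal (χ j (x (Fin.last m) - p.1.1)) *
      ENNReal.ofReal (h j (x + appendLast ((p.1.1 + p.1.2) • p.2) (p.1.2 - p.1.1)))) with hΦ
  set Ψ : (ℝ × ℝ) × Euc m → ℝ≥0∞ := fun p => ENNReal.ofReal ((p.1.1 * p.1.2) ^ (s - 1)) *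
    F (x + appendLast ((p.1.1 + p.1.2) • p.2) (p.1.2 - p.1.1)) with hΨ
  have hΦm : ∀ j, Measurable (Φ j) := fun j => by
    have := hh j
    have := hχ j
    fun_prop
  have hΨm : Measurable Ψ := by fun_prop
  have hmem : ∀ᵐ p ∂M, p.1.1 ∈ Ioo 0 (x (Fin.last m)) ∧ p.1.2 ∈ Ioi (0 : ℝ) := by
    have h1 : ∀ᵐ q ∂((volume.restrict (Ioo 0 (x (Fin.last m)))).prod (volume.restrict (Ioi (0 : ℝ)))),
        q.1 ∈ Ioo 0 (x (Fin.last m)) ∧ q.2 ∈ Ioi (0 : ℝ) := by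
      rw [Measure.prod_restrict]
      exact ae_restrict_mem (measurableSet_Ioo.prod measurableSet_Ioi)
    exact Measure.quasiMeasurePreserving_fst.ae h1
  have hpt : ∀ᵐ p ∂M, Ψ p = liminf (fun j => Φ j p) atTop := by
    filter_upwards [hmem] with p hp
    have hp1 : 0 < p.1.1 ∧ p.1.1 < x (Fin.last m) := hp.1
    have hp2 : 0 < p.1.2 := hp.2
    have hy : 0 < (x + appendLast ((p.1.1 + p.1.2) • p.2) (p.1.2 - p.1.1)) (Fin.last m) := by
      simp
      linarith
    refine (Tendsto.liminf_eq ?_).symm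
    rw [hΨ]
    simp only
    rw [hF _ hy]
    refine ENNReal.Tendsto.const_mul ?_ (Or.inr ENNReal.ofReal_ne_top)
    refine (ENNReal.tendsto_ofReal (hf _ hy)).congr' ?_
    filter_upwards [hχ1 (x (Fin.last m) - p.1.1) (by linarith)] with j hj
    rw [hj, ENNReal.ofReal_one, one_mul]
  have hΨM : ∫⁻ a in Ioo 0 (x (Fin.last m)), ∫⁻ b in Ioi (0 : ℝ), ENNReal.ofReal ((a * b) ^ (s - 1)) *
      ∫⁻ z, F (x + appendLast ((a + b) • z) (b - a)) ∂(poissonMeasure m) = ∫⁻ p, Ψ p ∂M := by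
    rw [hM, ← lintegral_lintegral_lintegral_eq hΨm]
    simp only [hΨ, lintegral_const_mul' _ _ ENNReal.ofReal_ne_top]
  have hΦM : ∀ j, ∫⁻ p, Φ j p ∂M ≤ C := by
    intro j
    refine le_trans (le_of_eq_of_le ?_ (lintegral_mono_set
      (Ioo_subset_Ioi_self (a := x (Fin.last m))))) (hC j)
    rw [hM, ← lintegral_lintegral_lintegral_eq (hΦm j)]
    simp only [hΦ, lintegral_const_mul' _ _ ENNReal.ofReal_ne_top]
  rw [hΨM, lintegral_congr_ae hpt]
  refine (lintegral_liminf_le hΦm).trans ?_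
  exact (liminf_le_liminf (Eventually.of_forall hΦM)).trans_eq (by simp)

lemma exists_last_bound {m : ℕ} {h : Euc (m + 1) → ℝ} (hc : HasCompactSupport h) :
    ∃ R : ℝ, ∀ x : Euc (m + 1), R < x (Fin.last m) → h x = 0 := by
  obtain ⟨R, hR⟩ := hc.isBounded.exists_norm_le
  refine ⟨R, fun x hx => by_contra fun hne => ?_⟩
  have h1 := hR x (subset_tsupport _ hne)
  have h2 := PiLp.norm_apply_le x (Fin.last m)
  linarith [Real.le_norm_self (x (Fin.last m))]

lemma lintegral_potential_le {m : ℕ} {s B : ℝ} (hs0 : 0 < s) (hs1 : s < 1)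
    {v f : Euc (m + 1) → ℝ} (hvc : ContinuousOn v {x : Euc (m + 1) | 0 < x (Fin.last m)})
    (hvm : AEStronglyMeasurable v) (hv0 : ∀ x, 0 ≤ v x) (hvB : ∀ x, v x ≤ B)
    (hv00 : ∀ x : Euc (m + 1), ¬ 0 < x (Fin.last m) → v x = 0)
    (hvL : ∀ x : Euc (m + 1), 0 < x (Fin.last m) → HasFracLapAt (m + 1) s v x (f x))
    (hf : ContinuousOn f {x : Euc (m + 1) | 0 < x (Fin.last m)}) (hf0 : ∀ x, 0 ≤ f x)
    {F : Euc (m + 1) → ℝ≥0∞} (hFm : Measurable F)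
    (hF : ∀ y, 0 < y (Fin.last m) → F y = ENNReal.ofReal (f y)) (x : Euc (m + 1)) :
    ∫⁻ a in Ioo 0 (x (Fin.last m)), ∫⁻ b in Ioi (0 : ℝ), ENNReal.ofReal ((a * b) ^ (s - 1)) *
      ∫⁻ z, F (x + appendLast ((a + b) • z) (b - a)) ∂(poissonMeasure m) ≤
      ENNReal.ofReal (Real.Gamma s ^ 2 * v x) := by
  obtain ⟨h, hh, hlim⟩ := exists_seq_smooth_le hf hf0
  choose R hR using fun j => exists_last_bound (hh j).2.1
  have hδ : ∀ j : ℕ, 0 < 1 / ((j : ℝ) + 1) := fun j => by positivity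
  refine lintegral_le_of_tendsto (χ := fun j => lineBump (1 / ((j : ℝ) + 1)) (max j (R j)))
    (fun j => (hh j).1.continuous.measurable) (fun j => (contDiff_lineBump _ _).continuous.measurable)
    (fun t ht => ?_) hlim hFm hF fun j => ?_
  · have h1 : Tendsto (fun j : ℕ => 2 * (1 / ((j : ℝ) + 1))) atTop (𝓝 0) := by
      simpa using tendsto_one_div_add_atTop_nhds_zero_nat.const_mul (2 : ℝ)
    filter_upwards [h1.eventually_le_const ht, eventually_ge_atTop ⌈t⌉₊] with j hj1 hj2
    exact lineBump_eq_one (hδ j) hj1 ((Nat.ceil_le.1 hj2).trans (le_max_left _ _))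
  · obtain ⟨w, hwc, ⟨Bw, hBw⟩, hwδ, hw0, hwL, hwint⟩ := exists_subsolution (s := s) (T := max j (R j))
      hs0 hs1 (hδ j) (hh j).1 (hh j).2.1 (fun y => ((hh j).2.2 y).1)
      (fun y hy => hR j y ((le_max_right _ _).trans_lt hy))
    have hwv : w x ≤ v x := by
      refine le_of_hasFracLapAt_le hs0 hs1 hvc hvm hv0 hvB hv00 hwc hBw (hδ j) hwδ hw0 hvL
        (fun y hy => ?_) x
      obtain ⟨g, hg, hgL⟩ := hwL y
      refine ⟨g, hg.trans ?_, hgL⟩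
      exact (mul_le_of_le_one_left ((hh j).2.2 y).1 (lineBump_le_one _ _ _)).trans ((hh j).2.2 y).2
    refine le_trans (le_of_eq ?_) (ENNReal.ofReal_le_ofReal (mul_le_mul_of_nonneg_left hwv (by positivity)))
    rw [hwint]
    refine setLIntegral_congr_fun measurableSet_Ioi fun a ha => ?_
    exact (lintegral_poissonMeasure_compose ha _ ENNReal.ofReal_ne_top
      (F := fun y => ENNReal.ofReal (h j y)) (hh j).1.continuous.measurable.ennreal_ofReal x).symm

lemma C11LocOn.continuousOn {n : ℕ} {u : Euc n → ℝ} {Ω : Set (Euc n)} (h : C11LocOn n u Ω) :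
    ContinuousOn u Ω := by
  intro x hx
  obtain ⟨ε, hε, -, hu, -⟩ := h x hx
  exact (hu.continuousOn.continuousAt (ball_mem_nhds x hε)).continuousWithinAt

lemma greenHalf_nonneg {m : ℕ} {s : ℝ} (hs0 : 0 < s) (x y : Euc (m + 1)) :
    0 ≤ greenHalf m s (greenC (m + 1) s) x y := by
  have h1 := Real.Gamma_pos_of_pos (s := ((m + 1 : ℕ) : ℝ) / 2) (by positivity)
  have h2 := Real.Gamma_pos_of_pos hs0
  have h3 : 0 ≤ greenC (m + 1) s := by
    unfold greenC
    positivity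
  unfold greenHalf
  refine mul_nonneg (by positivity) (setIntegral_nonneg measurableSet_Ioo fun t ht => ?_)
  have := ht.1
  positivity

lemma lintegral_Ioi_rpow_eq_top (r : ℝ) : ∫⁻ t in Ioi (0 : ℝ), ENNReal.ofReal (t ^ r) = ⊤ := by
  by_contra h
  refine not_integrableOn_Ioi_rpow r ?_
  refine (lintegral_ofReal_ne_top_iff_integrable (Measurable.aestronglyMeasurable (by fun_prop)) ?_).1 h
  filter_upwards [ae_restrict_mem measurableSet_Ioi] with t ht
  exact Real.rpow_nonneg (le_of_lt ht) r

lemma lintegral_potential_eq_top {m : ℕ} {s b₀ : ℝ} (hb₀ : 0 < b₀) {F : Euc (m + 1) → ℝ≥0∞}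
    (hF : ∀ y, 0 < y (Fin.last m) → ENNReal.ofReal b₀ ≤ F y) {x : Euc (m + 1)}
    (hx : 0 < x (Fin.last m)) :
    ∫⁻ a in Ioo 0 (x (Fin.last m)), ∫⁻ b in Ioi (0 : ℝ), ENNReal.ofReal ((a * b) ^ (s - 1)) *
      ∫⁻ z, F (x + appendLast ((a + b) • z) (b - a)) ∂(poissonMeasure m) = ⊤ := by
  have hinner : ∀ a ∈ Ioo 0 (x (Fin.last m)), ∫⁻ b in Ioi (0 : ℝ), ENNReal.ofReal ((a * b) ^ (s - 1)) *
      ∫⁻ z, F (x + appendLast ((a + b) • z) (b - a)) ∂(poissonMeasure m) = ⊤ := by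
    intro a ha
    have ha0 : 0 < a := ha.1
    have ha1 : a < x (Fin.last m) := ha.2
    rw [eq_top_iff]
    calc (⊤ : ℝ≥0∞) = ENNReal.ofReal (a ^ (s - 1)) * ENNReal.ofReal b₀ *
          ∫⁻ b in Ioi (0 : ℝ), ENNReal.ofReal (b ^ (s - 1)) := by
          rw [lintegral_Ioi_rpow_eq_top, ENNReal.mul_top]
          exact mul_ne_zero (ENNReal.ofReal_pos.2 (by positivity)).ne' (ENNReal.ofReal_pos.2 hb₀).ne'
      _ = ∫⁻ b in Ioi (0 : ℝ), ENNReal.ofReal (a ^ (s - 1)) * ENNReal.ofReal b₀ *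
          ENNReal.ofReal (b ^ (s - 1)) := (lintegral_const_mul' _ _ (by finiteness)).symm
      _ ≤ _ := by
          refine setLIntegral_mono' measurableSet_Ioi fun b hb => ?_
          have hb' : (0 : ℝ) < b := hb
          rw [Real.mul_rpow ha0.le hb'.le, ENNReal.ofReal_mul (by positivity), mul_right_comm]
          gcongr
          calc ENNReal.ofReal b₀ = ∫⁻ _, ENNReal.ofReal b₀ ∂(poissonMeasure m) := by simp
            _ ≤ _ := lintegral_mono fun z => hF _ (by simp; linarith)
  rw [setLIntegral_congr_fun measurableSet_Ioo hinner, setLIntegral_const, Real.volume_Ioo, sub_zero]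
  exact ENNReal.top_mul (ENNReal.ofReal_pos.2 hx).ne'

/-- Green-function lower bound and vanishing of `b`, half space: with
`n = m + 1 > 2s`, if `v ∈ C^{1,1}_{loc}(ℝⁿ_+) ∩ L_{2s}` is nonnegative, bounded, vanishes
outside `ℝⁿ_+`, and solves `(-Δ)^s v = K v^p + b` classically in `ℝⁿ_+` with `K > 0`,
`b ≥ 0`, `p > 0`, then `v(x) ≥ ∫_{ℝⁿ_+} G_∞(x,y)(K v(y)^p + b) dy` for every `x ∈ ℝⁿ_+`
(as an inequality of extended reals, so in particular the integral is finite), and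
consequently `b = 0`. -/
theorem green_lower_bound_and_b_eq_zero
    (m : ℕ) (s : ℝ) (hs0 : 0 < s) (hs1 : s < 1) (hns : 2 * s < (m : ℝ) + 1)
    (K b p : ℝ) (hK : 0 < K) (hb : 0 ≤ b) (hp : 0 < p)
    (v : Euc (m + 1) → ℝ) (hv0 : ∀ x, 0 ≤ v x) (hvbdd : ∃ B : ℝ, ∀ x, v x ≤ B)
    (hreg : C11LocOn (m + 1) v {x : Euc (m + 1) | 0 < x (Fin.last m)})
    (hL : MemL2s (m + 1) s v)
    (hv00 : ∀ x : Euc (m + 1), ¬ 0 < x (Fin.last m) → v x = 0)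
    (hsol : ∀ x : Euc (m + 1), 0 < x (Fin.last m) →
      HasFracLapAt (m + 1) s v x (K * v x ^ p + b)) :
    (∀ x : Euc (m + 1), 0 < x (Fin.last m) →
      ∫⁻ y in {y : Euc (m + 1) | 0 < y (Fin.last m)},
        ENNReal.ofReal (greenHalf m s (greenC (m + 1) s) x y * (K * v y ^ p + b)) ≤
      ENNReal.ofReal (v x)) ∧ b = 0 := by
  obtain ⟨B, hB⟩ := hvbdd
  set D : Set (Euc (m + 1)) := {y : Euc (m + 1) | 0 < y (Fin.last m)} with hD
  have hDm : MeasurableSet D := measurableSet_lt measurable_const (by fun_prop)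
  have hvc : ContinuousOn v D := hreg.continuousOn
  have hf : ContinuousOn (fun x => K * v x ^ p + b) D :=
    ((hvc.rpow_const fun _ _ => Or.inr hp.le).const_mul K).add continuousOn_const
  have hf0 : ∀ x, 0 ≤ K * v x ^ p + b := fun x => by
    have := hv0 x
    positivity
  set F : Euc (m + 1) → ℝ≥0∞ := fun y => ENNReal.ofReal (D.indicator (fun x => K * v x ^ p + b) y)
  have hFm : Measurable F := by
    refine Measurable.ennreal_ofReal ?_
    classical
    rw [← piecewise_eq_indicator]
    exact hf.measurable_piecewise continuousOn_const hDm
  have hF : ∀ y, 0 < y (Fin.last m) → F y = ENNReal.ofReal (K * v y ^ p + b) := fun y hy => by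
    simp only [F]
    rw [indicator_of_mem (show y ∈ D from hy)]
  have key := lintegral_potential_le hs0 hs1 hvc hL.1.aestronglyMeasurable hv0 hB hv00 hsol hf hf0
    hFm hF
  have hΓ := Real.Gamma_pos_of_pos hs0
  refine ⟨fun x hx => ?_, ?_⟩
  · have h1 : ∫⁻ y in D, ENNReal.ofReal (greenHalf m s (greenC (m + 1) s) x y * (K * v y ^ p + b)) =
        ∫⁻ y in D, ENNReal.ofReal (greenHalf m s (greenC (m + 1) s) x y) * F y :=
      setLIntegral_congr_fun hDm fun y hy => by
        rw [ENNReal.ofReal_mul (greenHalf_nonneg hs0 x y), hF y hy]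
    rw [h1, lintegral_greenHalf_eq hs0 hx hFm]
    calc _ ≤ ENNReal.ofReal ((Real.Gamma s ^ 2)⁻¹) * ENNReal.ofReal (Real.Gamma s ^ 2 * v x) := by
          gcongr
          exact key x
      _ = ENNReal.ofReal (v x) := by
          rw [← ENNReal.ofReal_mul (by positivity), inv_mul_cancel_left₀ (by positivity)]
  · by_contra hne
    have hb' : 0 < b := lt_of_le_of_ne hb (Ne.symm hne)
    have hx : 0 < appendLast (0 : Euc m) 1 (Fin.last m) := by simp
    have h1 := key (appendLast 0 1)
    rw [lintegral_potential_eq_top hb' (fun y hy => ?_) hx] at h1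
    · exact absurd h1 (by simp)
    · rw [hF y hy]
      refine ENNReal.ofReal_le_ofReal ?_
      have := hv0 y
      have : 0 ≤ K * v y ^ p := by positivity
      linarith
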